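/- arXiv:1506.09168 — 2 statements merged into one kernel-verified Lean document; each statement's English description precedes it below -/
import Mathlib

section
/- Let k be a field, R = (k[x,y,z]/(x^2 − y^5, x y^2 + y z^3 − z^5)) localized at (x,y,z), with maximal ideal m. Then y m^5 : m ⊆ yR and y m^4 : m ⊄ yR; consequently index(R) = 5. -/
open IsLocalRing

universe u v

/-- The length of a module, as the Krull dimension of its lattice of submodules. -/
noncomputable def mLength (R : Type u) (M : Type v) [CommRing R] [AddCommGroup M]
    [Module R M] : WithBot ℕ∞ :=
  Order.krullDim (Submodule R M)

/-- The quotient `I/J` of two ideals (i.e. `I/(I ⊓ J)`), as an `R`-module. -/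
abbrev idealQuot {R : Type u} [CommRing R] (I J : Ideal R) :=
  I ⧸ (Submodule.comap I.subtype J)

/-- A finitely generated module is maximal Cohen–Macaulay if it admits a regular sequence,
contained in the maximal ideal, of length equal to the Krull dimension of the ring. -/
def IsMCM (R : Type u) (M : Type v) [CommRing R] [IsLocalRing R] [AddCommGroup M]
    [Module R M] : Prop :=
  ∃ rs : List R, (∀ r ∈ rs, r ∈ maximalIdeal R) ∧ RingTheory.Sequence.IsRegular M rs ∧
    (rs.length : WithBot ℕ∞) = ringKrullDim R

/-- A local ring is Cohen–Macaulay if it is maximal Cohen–Macaulay as a module over itself. -/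
def IsCMLocalRing (R : Type u) [CommRing R] [IsLocalRing R] : Prop :=
  IsMCM R R

/-- A local ring is Gorenstein if it is Cohen–Macaulay and the socle of the quotient by any
maximal regular sequence is a one-dimensional vector space over the residue field. -/
def IsGorensteinLocalRing (R : Type u) [CommRing R] [IsLocalRing R] : Prop :=
  IsCMLocalRing R ∧ ∀ rs : List R, (∀ r ∈ rs, r ∈ maximalIdeal R) →
    RingTheory.Sequence.IsRegular R rs → (rs.length : WithBot ℕ∞) = ringKrullDim R →
    mLength R (idealQuot ((Ideal.ofList rs).colon (maximalIdeal R)) (Ideal.ofList rs)) = 1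

/-- The free rank of a module: the largest `n` such that `R^n` splits off as a direct summand. -/
noncomputable def freeRank (R : Type u) (M : Type v) [CommRing R] [AddCommGroup M]
    [Module R M] : ℕ :=
  sSup {n : ℕ | ∃ (f : M →ₗ[R] (Fin n → R)) (g : (Fin n → R) →ₗ[R] M),
    f ∘ₗ g = LinearMap.id}

/-- Auslander's delta invariant: the minimal free rank of a maximal Cohen–Macaulay module
admitting a surjection onto `M`. -/
noncomputable def auslanderDelta (R : Type u) [CommRing R] [IsLocalRing R]
    (M : Type v) [AddCommGroup M] [Module R M] : ℕ :=
  sInf {r : ℕ | ∃ X : ModuleCat.{u} R, Module.Finite R X ∧ IsMCM R X ∧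
    (∃ φ : X →ₗ[R] M, Function.Surjective φ) ∧ freeRank R X = r}

/-- The minimal number of generators of a module. -/
noncomputable def minGens (R : Type u) (M : Type v) [CommRing R] [AddCommGroup M]
    [Module R M] : ℕ :=
  sInf {n : ℕ | ∃ f : (Fin n → R) →ₗ[R] M, Function.Surjective f}

/-- The index of a local ring: the least `n` with `δ(R/m^n) = 1`. -/
noncomputable def ringIndex (R : Type u) [CommRing R] [IsLocalRing R] : ℕ∞ :=
  sInf ((fun n : ℕ => (n : ℕ∞)) ''
    {n : ℕ | auslanderDelta R (R ⧸ (maximalIdeal R ^ n)) = 1})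

/-- The generalized Löwy length of a local ring: the least `n` such that `m^n ⊆ (x₁,…,x_d)`
for some system of parameters `x₁,…,x_d`. -/
noncomputable def gll (R : Type u) [CommRing R] [IsLocalRing R] : ℕ∞ :=
  sInf ((fun n : ℕ => (n : ℕ∞)) ''
    {n : ℕ | ∃ rs : List R, (∀ r ∈ rs, r ∈ maximalIdeal R) ∧
      (rs.length : WithBot ℕ∞) = ringKrullDim R ∧
      maximalIdeal R ^ n ≤ Ideal.ofList rs})


namespace IdxFive

/-- Krull dimension one from a parameter. -/
theorem dim_one {R : Type*} [CommRing R] [IsLocalRing R] [IsNoetherianRing R] (y : R)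
    (hy : IsSMulRegular R y) (hym : y ∈ maximalIdeal R) (N : ℕ)
    (hN : maximalIdeal R ^ N ≤ Ideal.span {y}) : ringKrullDim R = 1 := by
  rw [← ringKrullDim_quotient_span_singleton_succ_eq_ringKrullDim hy hym]
  have hle : Ideal.span {y} ≤ maximalIdeal R := by
    rw [Ideal.span_singleton_le_iff_mem]; exact hym
  haveI : Nontrivial (R ⧸ Ideal.span {y}) :=
    Ideal.Quotient.nontrivial_iff.mpr (fun h => (maximalIdeal.isMaximal R).ne_top
      (top_le_iff.mp (h ▸ hle)))
  have h0 : Ring.KrullDimLE 0 (R ⧸ Ideal.span {y}) := by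
    refine .mk₀ fun Q hQ => ?_
    have hc : Q.comap (Ideal.Quotient.mk (Ideal.span {y})) = maximalIdeal R := by
      have hp : (Q.comap (Ideal.Quotient.mk (Ideal.span {y}))).IsPrime := inferInstance
      refine le_antisymm (le_maximalIdeal hp.ne_top) ?_
      refine Ideal.IsPrime.le_of_pow_le (n := N) (hN.trans ?_)
      rw [Ideal.span_singleton_le_iff_mem, Ideal.mem_comap,
        Ideal.Quotient.eq_zero_iff_mem.mpr (Ideal.mem_span_singleton_self y)]
      exact Q.zero_mem
    have := Ideal.map_comap_of_surjective _ (Ideal.Quotient.mk_surjective (I := Ideal.span {y})) Q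
    rw [← this, hc]
    rcases Ideal.map_eq_top_or_isMaximal_of_surjective _ 
      (Ideal.Quotient.mk_surjective (I := Ideal.span {y})) (maximalIdeal.isMaximal R) with h | h
    · rw [← hc, this] at h
      exact (hQ.ne_top h).elim
    · exact h
  rw [ringKrullDimZero_iff_ringKrullDim_eq_zero.mp h0]
  rfl

section A

variable {A R : Type*} [CommRing A] [IsDomain A] [IsDiscreteValuationRing A]
  [CommRing R] [IsLocalRing R] [Algebra A R] [Module.Finite A R]

/-- y regular on X. -/
theorem regular_of_mcm {X : Type*} [AddCommGroup X] [Module R X] (y r : R) (N : ℕ)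
    (hN : maximalIdeal R ^ N ≤ Ideal.span {y}) (hr : r ∈ maximalIdeal R)
    (hX : IsSMulRegular X r) : IsSMulRegular X y := by
  rw [isSMulRegular_iff_right_eq_zero_of_smul]
  intro v hv
  have h1 : r ^ N ∈ Ideal.span {y} := hN (Ideal.pow_mem_pow hr N)
  obtain ⟨c, hc⟩ := Ideal.mem_span_singleton'.mp h1
  have h2 : r ^ N • v = 0 := by rw [← hc, mul_smul, hv, smul_zero]
  have := hX.pow N
  exact (isSMulRegular_iff_right_eq_zero_of_smul.mp this) v h2

theorem torsionFree_of_regular {X : Type*} [AddCommGroup X] [Module R X] [Module A X]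
    [IsScalarTower A R X] (t : A) (ht : Irreducible t)
    (hX : IsSMulRegular X (algebraMap A R t)) : Module.IsTorsionFree A X := by
  refine Module.isTorsionFree_iff_smul_eq_zero.mpr ?_
  intro a v hav
  by_contra! hne
  obtain ⟨n, u, rfl⟩ := IsDiscreteValuationRing.eq_unit_mul_pow_irreducible hne.1 ht
  have h1 : t ^ n • v = 0 := by
    rw [mul_smul] at hav
    have := congrArg (fun w => (↑u⁻¹ : A) • w) hav
    simpa [← mul_smul] using this
  rw [← algebraMap_smul R, map_pow] at h1
  exact hne.2 ((isSMulRegular_iff_right_eq_zero_of_smul.mp (hX.pow n)) v h1)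

/-- The lifting lemma: if `1 ∈ m (R : I)` then each MCM module mapping onto `R / I` maps onto `R`. -/
theorem exists_unit_functional {X : Type*} [AddCommGroup X] [Module R X] [Module.Finite R X]
    (t : A) (ht : Irreducible t) (hX : IsSMulRegular X (algebraMap A R t))
    (lam : R →ₗ[A] A)
    (hinj : ∀ r : R, (∀ s, lam (s * r) = 0) → r = 0)
    (hsurj : ∀ h : R →ₗ[A] A, ∃ r : R, ∀ s, lam (s * r) = h s)
    (I : Ideal R) (hI : I ≤ maximalIdeal R) {ι : Type*} [Fintype ι] (c : ι → R)
    (hc : ∀ i, c i ∈ maximalIdeal R) (g : ι → (I →ₗ[R] R))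
    (hg : ∀ b : I, ∑ i, c i * g i b = b)
    (φ : X →ₗ[R] (R ⧸ I)) (hφ : Function.Surjective φ) :
    ∃ (f : X →ₗ[R] R) (e : X), f e = 1 := by
  letI : Module A X := Module.compHom X (algebraMap A R)
  haveI : IsScalarTower A R X := IsScalarTower.of_algebraMap_smul fun _ _ => rfl
  haveI := torsionFree_of_regular (R := R) (X := X) t ht hX
  haveI : Module.Finite A X := Module.Finite.trans R X
  haveI : Module.Free A X := inferInstance
  obtain ⟨ψ, hψ⟩ := Module.projective_lifting_property
    ((Ideal.Quotient.mkₐ A I).toLinearMap) (φ.restrictScalars A) (Ideal.Quotient.mkₐ_surjective A I)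
  have hψ' : ∀ x, Ideal.Quotient.mk I (ψ x) = φ x := fun x => LinearMap.congr_fun hψ x
  have hmem : ∀ (s : R) (x : X), s * ψ x - ψ (s • x) ∈ I := by
    intro s x
    rw [← Ideal.Quotient.eq_zero_iff_mem, map_sub, map_mul, hψ', hψ', map_smul]
    rw [← Ideal.Quotient.mk_eq_mk, ← smul_eq_mul, Ideal.Quotient.mk_eq_mk]
    exact sub_self _
  have hGex : ∀ (i : ι) (x : X), ∃ r : R, ∀ s, lam (s * r) =
      lam (g i ⟨s * ψ x - ψ (s • x), hmem s x⟩) := by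
    intro i x
    obtain ⟨r, hr⟩ := hsurj
      { toFun := fun s => lam (g i ⟨s * ψ x - ψ (s • x), hmem s x⟩)
        map_add' := by
          intro s s'
          rw [← map_add, ← map_add]
          congr 2
          ext
          simp only [add_smul, map_add, Submodule.coe_add]
          ring
        map_smul' := by
          intro a s
          have : (⟨(a • s) * ψ x - ψ ((a • s) • x), hmem (a • s) x⟩ : I)
              = (algebraMap A R a) • ⟨s * ψ x - ψ (s • x), hmem s x⟩ := by
            ext
            have h3 : ψ ((a • s) • x) = algebraMap A R a * ψ (s • x) := by
              rw [smul_assoc, map_smul, Algebra.smul_def]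
            rw [Algebra.smul_def] at h3
            simp only [h3, Submodule.coe_smul, smul_eq_mul, Algebra.smul_def]
            ring
          rw [this, map_smul, algebraMap_smul, map_smul]
          rfl }
    exact ⟨r, hr⟩
  choose G hG using hGex
  have huniq : ∀ r r' : R, (∀ s, lam (s * r) = lam (s * r')) → r = r' := by
    intro r r' h
    refine sub_eq_zero.mp (hinj _ fun s => ?_)
    rw [mul_sub, map_sub, h, sub_self]
  have hGadd : ∀ i x x', G i (x + x') = G i x + G i x' := by
    intro i x x'
    refine huniq _ _ fun s => ?_
    rw [mul_add, map_add, hG, hG, hG, ← map_add, ← map_add]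
    congr 2
    ext
    simp only [smul_add, map_add, Submodule.coe_add]
    ring
  have hGsmul : ∀ i (s : R) x, s * G i x - G i (s • x) = g i ⟨s * ψ x - ψ (s • x), hmem s x⟩ := by
    intro i s x
    refine huniq _ _ fun s' => ?_
    rw [mul_sub, map_sub, ← mul_assoc, hG, hG, ← map_sub, ← map_sub, ← smul_eq_mul s' (g i _), ← map_smul]
    congr 2
    ext
    simp only [mul_smul, Submodule.coe_sub, Submodule.coe_smul, smul_eq_mul]
    ring
  let f : X →ₗ[R] R :=
    { toFun := fun x => ψ x - ∑ i, c i * G i x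
      map_add' := by
        intro x x'
        simp only [hGadd, mul_add, Finset.sum_add_distrib, map_add]
        ring
      map_smul' := by
        intro s x
        have h := hg ⟨s * ψ x - ψ (s • x), hmem s x⟩
        simp only [← hGsmul, mul_sub, Finset.sum_sub_distrib] at h
        simp only [RingHom.id_apply, smul_eq_mul, mul_sub, Finset.mul_sum]
        have h2 : ∑ i, s * (c i * G i x) = ∑ i, c i * (s * G i x) :=
          Finset.sum_congr rfl fun i _ => by ring
        rw [h2]
        linear_combination h }
  obtain ⟨e, he⟩ := hφ 1
  have h1 : f e - 1 ∈ maximalIdeal R := by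
    have h2 : ψ e - 1 ∈ I := by
      rw [← Ideal.Quotient.eq_zero_iff_mem, map_sub, hψ', he, map_one, sub_self]
    have h3 : ∑ i, c i * G i e ∈ maximalIdeal R :=
      Ideal.sum_mem _ fun i _ => Ideal.mul_mem_right _ _ (hc i)
    have : f e - 1 = (ψ e - 1) - ∑ i, c i * G i e := by
      change ψ e - _ - 1 = _
      ring
    rw [this]
    exact Ideal.sub_mem _ (hI h2) h3
  have hu : IsUnit (f e) := by
    by_contra hne
    have h4 : f e ∈ maximalIdeal R := (mem_maximalIdeal _).mpr hne
    have := Ideal.sub_mem _ h4 h1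
    rw [sub_sub_cancel] at this
    exact (Ideal.ne_top_iff_one _).mp (maximalIdeal.isMaximal R).ne_top this
  obtain ⟨u, hu⟩ := hu
  refine ⟨f, (↑u⁻¹ : R) • e, ?_⟩
  rw [map_smul, ← hu]
  simp

end A

section freeRank

variable {R : Type*} [CommRing R] [Nontrivial R] {X : Type*} [AddCommGroup X] [Module R X]

theorem one_le_freeRank [Module.Finite R X] (f : X →ₗ[R] R) (e : X) (h : f e = 1) :
    1 ≤ freeRank R X := by
  unfold freeRank
  refine le_csSup ?_ ?_
  · obtain ⟨n, s, hs⟩ := Module.Finite.exists_fin' R X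
    refine ⟨n, ?_⟩
    rintro m ⟨f, g, hfg⟩
    refine le_of_fin_surjective R (f ∘ₗ s) ?_
    rw [LinearMap.coe_comp]
    refine Function.Surjective.comp (fun v => ⟨g v, LinearMap.congr_fun hfg v⟩) hs
  · refine ⟨LinearMap.pi fun _ => f, (LinearMap.toSpanSingleton R X e) ∘ₗ LinearMap.proj 0, ?_⟩
    ext i j
    simp [h, Subsingleton.elim i 0, Subsingleton.elim j 0]

theorem freeRank_self : freeRank R R = 1 := by
  refine le_antisymm ?_ (one_le_freeRank LinearMap.id 1 rfl)
  unfold freeRank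
  refine csSup_le ⟨0, 0, 0, Subsingleton.elim _ _⟩ ?_
  rintro m ⟨f, g, hfg⟩
  refine le_of_fin_surjective R (f ∘ₗ (LinearMap.proj (0 : Fin 1))) ?_
  intro v
  exact ⟨fun _ => g v, LinearMap.congr_fun hfg v⟩

theorem freeRank_eq_zero (h : ∀ (f : X →ₗ[R] R) (e : X), f e ≠ 1) : freeRank R X = 0 := by
  unfold freeRank
  refine le_antisymm (csSup_le ⟨0, 0, 0, Subsingleton.elim _ _⟩ ?_) (Nat.zero_le _)
  rintro (_ | m) ⟨f, g, hfg⟩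
  · exact le_rfl
  · refine (h (LinearMap.proj 0 ∘ₗ f) (g (fun _ => 1)) ?_).elim
    exact congrFun (LinearMap.congr_fun hfg (fun _ => 1)) 0

end freeRank

section ideals

variable {R : Type*} [CommRing R] {x y z : R}

theorem pow_span_le (K : Ideal R) (n : ℕ)
    (h : ∀ i j l, i + j + l = n → x ^ i * y ^ j * z ^ l ∈ K) :
    Ideal.span {x, y, z} ^ n ≤ K := by
  induction n generalizing K with
  | zero =>
    have := h 0 0 0 rfl
    simp only [pow_zero, mul_one] at this
    rw [(Ideal.eq_top_iff_one K).mpr this]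
    exact le_top
  | succ n ih =>
    rw [pow_succ, Ideal.mul_le]
    have key : ∀ w ∈ ({x, y, z} : Set R), Ideal.span {x, y, z} ^ n ≤ K.colon {w} := by
      intro w hw
      refine ih _ fun i j l hijl => ?_
      rw [Submodule.mem_colon_singleton, smul_eq_mul]
      rcases hw with rfl | rfl | rfl
      · convert! h (i + 1) j l (by omega) using 1; ring
      · convert! h i (j + 1) l (by omega) using 1; ring
      · convert! h i j (l + 1) (by omega) using 1; ring
    intro r hr s hs
    have : Ideal.span {x, y, z} ≤ K.colon {r} := by
      rw [Ideal.span_le]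
      intro w hw
      have := key w hw hr
      rw [Submodule.mem_colon_singleton, smul_eq_mul] at this
      rw [SetLike.mem_coe, Submodule.mem_colon_singleton, smul_eq_mul, mul_comm]
      exact this
    have := this hs
    rwa [Submodule.mem_colon_singleton, smul_eq_mul, mul_comm] at this

theorem pow_le_span (hx : x ^ 2 = y ^ 5) (hz : x * y ^ 2 + y * z ^ 3 - z ^ 5 = 0) :
    Ideal.span {x, y, z} ^ 7 ≤ Ideal.span {y} := by
  refine pow_span_le _ _ fun i j l h => ?_
  rw [Ideal.mem_span_singleton]
  rcases Nat.eq_zero_or_pos j with rfl | hj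
  · rcases Nat.lt_or_ge i 2 with hi | hi
    · obtain ⟨l, rfl⟩ := Nat.exists_eq_add_of_le (show 5 ≤ l by omega)
      refine ⟨x ^ i * z ^ l * (x * y + z ^ 3), ?_⟩
      linear_combination (- x ^ i * z ^ l) * hz
    · obtain ⟨i, rfl⟩ := Nat.exists_eq_add_of_le hi
      refine ⟨x ^ i * z ^ l * y ^ 4, ?_⟩
      linear_combination (x ^ i * z ^ l) * hx
  · obtain ⟨j, rfl⟩ := Nat.exists_eq_add_of_le hj
    refine ⟨x ^ i * z ^ l * y ^ j, ?_⟩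
    ring

theorem dvd_aux (hx : x ^ 2 = y ^ 5) (hz : x * y ^ 2 + y * z ^ 3 - z ^ 5 = 0)
    (c : R) (h0 : y ^ 3 ∣ c * z ^ 5) (h1 : y ^ 3 ∣ c * (y * z ^ 4))
    (h2 : y ^ 3 ∣ c * (y ^ 2 * z ^ 3)) (h3 : y ^ 3 ∣ c * (x * z ^ 4))
    (h4 : y ^ 3 ∣ c * (x * y * z ^ 3)) (h5 : y ^ 3 ∣ c * (x * y ^ 2 * z ^ 2)) :
    ∀ b ∈ Ideal.span {x, y, z} ^ 5, y ^ 3 ∣ c * b := by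
  have : Ideal.span {x, y, z} ^ 5 ≤ (Ideal.span {y ^ 3}).colon {c} := by
    refine pow_span_le _ _ fun i j l h => ?_
    rw [Submodule.mem_colon_singleton, smul_eq_mul, Ideal.mem_span_singleton, mul_comm]
    rcases Nat.lt_or_ge i 2 with hi | hi
    · rcases Nat.lt_or_ge j 3 with hj | hj
      · interval_cases i <;> interval_cases j
        · obtain rfl : l = 5 := by omega
          simpa using h0
        · obtain rfl : l = 4 := by omega
          simpa using h1
        · obtain rfl : l = 3 := by omega
          simpa using h2
        · obtain rfl : l = 4 := by omega
          simpa using h3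
        · obtain rfl : l = 3 := by omega
          simpa using h4
        · obtain rfl : l = 2 := by omega
          simpa using h5
      · obtain ⟨j, rfl⟩ := Nat.exists_eq_add_of_le hj
        exact ⟨c * x ^ i * y ^ j * z ^ l, by ring⟩
    · obtain ⟨i, rfl⟩ := Nat.exists_eq_add_of_le hi
      exact ⟨c * x ^ i * y ^ j * z ^ l * y ^ 2, by
        linear_combination c * x ^ i * y ^ j * z ^ l * hx⟩
  intro b hb
  have := this hb
  rwa [Submodule.mem_colon_singleton, smul_eq_mul, Ideal.mem_span_singleton, mul_comm] at this

theorem dvd_c2 (hx : x ^ 2 = y ^ 5) (hz : x * y ^ 2 + y * z ^ 3 - z ^ 5 = 0) :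
    ∀ b ∈ Ideal.span {x, y, z} ^ 5, y ^ 3 ∣ (y * z ^ 3) * b := by
  have h5 : z ^ 5 = y * z ^ 3 + x * y ^ 2 := by linear_combination -hz
  have h6 : z ^ 6 = y * z ^ 4 + x * y ^ 2 * z := by linear_combination -z * hz
  have h7 : z ^ 7 = y ^ 2 * z ^ 3 + x * y ^ 3 + x * y ^ 2 * z ^ 2 := by
    linear_combination (-z ^ 2 - y) * hz
  refine dvd_aux hx hz _ ?_ ?_ ?_ ?_ ?_ ?_
  · exact ⟨z ^ 4 + x * y * z + x * z ^ 3, by linear_combination y * z * h7⟩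
  · exact ⟨y * z ^ 3 + x * y ^ 2 + x * y * z ^ 2, by linear_combination y ^ 2 * h7⟩
  · exact ⟨z ^ 6, by ring⟩
  · refine ⟨x * z ^ 3 + x ^ 2 * y + x ^ 2 * z ^ 2, by linear_combination x * y * h7⟩
  · refine ⟨x * z ^ 4 + x ^ 2 * y * z, by linear_combination x * y ^ 2 * h6⟩
  · exact ⟨x * z ^ 5, by ring⟩

theorem dvd_c1 (hx : x ^ 2 = y ^ 5) (hz : x * y ^ 2 + y * z ^ 3 - z ^ 5 = 0) :
    ∀ b ∈ Ideal.span {x, y, z} ^ 5,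
    y ^ 3 ∣ (y ^ 2 - z ^ 4 + x * z ^ 3) * b := by
  have h5 : z ^ 5 = y * z ^ 3 + x * y ^ 2 := by linear_combination -hz
  have h6 : z ^ 6 = y * z ^ 4 + x * y ^ 2 * z := by linear_combination -z * hz
  have h7 : z ^ 7 = y ^ 2 * z ^ 3 + x * y ^ 3 + x * y ^ 2 * z ^ 2 := by
    linear_combination (-z ^ 2 - y) * hz
  have h8 : z ^ 8 = y ^ 2 * z ^ 4 + x * y ^ 3 * z + x * y ^ 2 * z ^ 3 := by
    linear_combination (-z ^ 3 - y * z) * hz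
  have h9 : z ^ 9 = y ^ 3 * z ^ 3 + x * y ^ 4 + x * y ^ 3 * z ^ 2 + x * y ^ 2 * z ^ 4 := by
    linear_combination (-z ^ 4 - y * z ^ 2 - y ^ 2) * hz
  refine dvd_aux hx hz _ ?_ ?_ ?_ ?_ ?_ ?_
  · exact ⟨-x * z ^ 2 + x ^ 2 * z + y ^ 4 * z ^ 3, by
      linear_combination y ^ 2 * h5 - h9 + x * h8 + (y ^ 2 * z ^ 3) * hx⟩
  · exact ⟨-x * y * z + x ^ 2 * y + x ^ 2 * z ^ 2, by
      linear_combination -y * h8 + x * y * h7⟩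
  · exact ⟨-x * y ^ 2 - x * y * z ^ 2 + x * z ^ 4 + x ^ 2 * y * z, by
      linear_combination -y ^ 2 * h7 + x * y ^ 2 * h6⟩
  · exact ⟨-x ^ 2 * z + x ^ 3 + x * y ^ 4 * z ^ 2, by
      linear_combination -x * h8 + x ^ 2 * h7 + x * y ^ 2 * z ^ 2 * hx⟩
  · exact ⟨-x ^ 2 * y - x ^ 2 * z ^ 2 + y ^ 4 * z ^ 4 + x ^ 3 * z, by
      linear_combination -x * y * h7 + x ^ 2 * y * h6 + y ^ 2 * z ^ 4 * hx⟩
  · exact ⟨x * (y * z ^ 2 - z ^ 4 - x * y * z + x * z ^ 3 + x ^ 2 * y), by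
      linear_combination -x * y ^ 2 * h6 + x ^ 2 * y ^ 2 * h5⟩

/-- The functionals `g_i` on `m^5` witnessing `1 ∈ m (R : m^5)`. -/
theorem exists_g (hx : x ^ 2 = y ^ 5) (hz : x * y ^ 2 + y * z ^ 3 - z ^ 5 = 0)
    (hreg : IsSMulRegular R y) :
    ∃ g : Fin 3 → (↥(Ideal.span {x, y, z} ^ 5) →ₗ[R] R),
      ∀ b : ↥(Ideal.span {x, y, z} ^ 5), ∑ i, (![x, y, z] i) * g i b = b := by
  have hreg3 : ∀ a b : R, y ^ 3 * a = y ^ 3 * b → a = b := fun a b h => (hreg.pow 3) h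
  have mk : ∀ c : R, (∀ b ∈ Ideal.span {x, y, z} ^ 5, y ^ 3 ∣ c * b) →
      ∃ g : ↥(Ideal.span {x, y, z} ^ 5) →ₗ[R] R, ∀ b, y ^ 3 * g b = c * b := by
    intro c hc
    choose w hw using fun b : ↥(Ideal.span {x, y, z} ^ 5) => hc b b.2
    refine ⟨{ toFun := w, map_add' := ?_, map_smul' := ?_ }, fun b => (hw b).symm⟩
    · intro a b
      apply hreg3
      rw [mul_add, ← hw, ← hw, ← hw, Submodule.coe_add]
      ring
    · intro r b
      apply hreg3
      rw [← hw, RingHom.id_apply, smul_eq_mul, mul_left_comm, ← hw, Submodule.coe_smul, smul_eq_mul]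
      ring
  obtain ⟨g1, h1⟩ := mk _ (dvd_c1 hx hz)
  obtain ⟨g2, h2⟩ := mk _ (dvd_c2 hx hz)
  refine ⟨![-g2, g1, g2], fun b => hreg3 _ _ ?_⟩
  simp only [Fin.sum_univ_three, Matrix.cons_val, LinearMap.neg_apply]
  linear_combination (z - x) * h2 b + y * h1 b

end ideals

section main

theorem freeRank_ideal {R : Type*} [CommRing R] [IsLocalRing R] (y a : R)
    (hreg : IsSMulRegular R y) (hym : y ∈ maximalIdeal R)
    (ha : a ∉ Ideal.span {y}) (ham : ∀ s ∈ maximalIdeal R, s * a ∈ Ideal.span {y} * maximalIdeal R) :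
    freeRank R (Ideal.span {y, a} : Ideal R) = 0 := by
  have hreg' : ∀ r, y * r = 0 → r = 0 := isSMulRegular_iff_right_eq_zero_of_smul.mp hreg
  refine freeRank_eq_zero fun f e hfe => ?_
  have key : ∀ j : (Ideal.span {y, a} : Ideal R), (j : R) = e * f j := by
    intro j
    have h1 : (j : R) • e = (e : R) • j := by
      ext
      simp [mul_comm]
    have h2 := congrArg f h1
    rw [map_smul, map_smul, hfe] at h2
    simpa using h2
  set Y : (Ideal.span {y, a} : Ideal R) := ⟨y, Ideal.subset_span (by simp)⟩
  set B : (Ideal.span {y, a} : Ideal R) := ⟨a, Ideal.subset_span (by simp)⟩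
  have hY : y = e * f Y := key Y
  have hB : a = e * f B := key B
  have hu : ¬ IsUnit (f Y) := by
    rintro ⟨u, hu⟩
    apply ha
    rw [Ideal.mem_span_singleton]
    refine ⟨↑u⁻¹ * f B, ?_⟩
    calc a = e * (↑u * ↑u⁻¹) * f B := by simpa using hB
      _ = _ := by rw [hu]; linear_combination -(↑u⁻¹ * f B) * hY
  have hum : f Y ∈ maximalIdeal R := (mem_maximalIdeal _).mpr hu
  obtain ⟨α, β, hαβ⟩ := Ideal.mem_span_pair.mp e.2
  have hereg : ∀ r, (e : R) * r = 0 → r = 0 := by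
    intro r hr
    apply hreg'
    rw [hY, mul_right_comm, hr, zero_mul]
  have h1 : α * f Y + β * f B = 1 := by
    refine sub_eq_zero.mp (hereg _ ?_)
    linear_combination hαβ - α * hY - β * hB
  have hv : IsUnit (f B) := by
    by_contra hv
    have hvm : f B ∈ maximalIdeal R := (mem_maximalIdeal _).mpr hv
    refine (Ideal.ne_top_iff_one _).mp (maximalIdeal.isMaximal R).ne_top ?_
    rw [← h1]
    exact Ideal.add_mem _ (Ideal.mul_mem_left _ _ hum) (Ideal.mul_mem_left _ _ hvm)
  obtain ⟨v, hv⟩ := hv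
  have h2 : y = (↑v⁻¹ * f Y) * a := by
    calc y = e * (↑v * ↑v⁻¹) * f Y := by simpa using hY
      _ = _ := by rw [hv]; linear_combination -(↑v⁻¹ * f Y) * hB
  have h3 := ham _ (Ideal.mul_mem_left _ (↑v⁻¹ : R) hum)
  rw [← h2] at h3
  obtain ⟨w, hw, hw2⟩ := Ideal.mem_span_singleton_mul.mp h3
  have h4 : w - 1 = 0 := by
    apply hreg'
    rw [mul_sub, hw2, mul_one, sub_self]
  rw [sub_eq_zero.mp h4] at hw
  exact (Ideal.ne_top_iff_one _).mp (maximalIdeal.isMaximal R).ne_top hw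

theorem isMCM_of_regular {R : Type*} [CommRing R] [IsLocalRing R] (hdim : ringKrullDim R = 1)
    {X : Type*} [AddCommGroup X] [Module R X] [Module.Finite R X] [Nontrivial X]
    (y : R) (hym : y ∈ maximalIdeal R) (hy : IsSMulRegular X y) : IsMCM R X := by
  refine ⟨[y], by simpa using hym, ⟨(RingTheory.Sequence.isWeaklyRegular_singleton_iff X y).mpr hy, ?_⟩,
    by simp [hdim]⟩
  intro h
  have hle : Ideal.ofList [y] ≤ Ideal.jacobson ⊥ := by
    rw [IsLocalRing.jacobson_eq_maximalIdeal _ bot_ne_top]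
    simpa [Ideal.ofList_singleton, Ideal.span_singleton_le_iff_mem] using hym
  have := Submodule.eq_bot_of_le_smul_of_le_jacobson_bot _ (⊤ : Submodule R X)
    Module.Finite.fg_top h.le hle
  exact top_ne_bot this

theorem mapsOnto {R : Type*} [CommRing R] [IsLocalRing R] (y a : R) (I : Ideal R)
    (hreg : IsSMulRegular R y)
    (ha : a ∉ Ideal.span {y}) (ham : ∀ s ∈ maximalIdeal R, s * a ∈ Ideal.span {y} * I) :
    ∃ φ : (Ideal.span {y, a} : Ideal R) →ₗ[R] (R ⧸ I), Function.Surjective φ := by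
  have hreg' : ∀ r, y * r = 0 → r = 0 := isSMulRegular_iff_right_eq_zero_of_smul.mp hreg
  let g : (R × R) →ₗ[R] (Ideal.span {y, a} : Ideal R) :=
    LinearMap.codRestrict _ ((LinearMap.toSpanSingleton R R y).coprod
      (LinearMap.toSpanSingleton R R a)) (by
        intro p
        simp only [LinearMap.coprod_apply, LinearMap.toSpanSingleton_apply, smul_eq_mul]
        exact Ideal.mem_span_pair.mpr ⟨_, _, rfl⟩)
  have hg : ∀ p, (g p : R) = p.1 * y + p.2 * a := fun p => rfl
  have hgs : Function.Surjective g := by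
    rintro ⟨j, hj⟩
    obtain ⟨α, β, h⟩ := Ideal.mem_span_pair.mp hj
    exact ⟨(α, β), Subtype.ext h⟩
  let h : (R × R) →ₗ[R] (R ⧸ I) := I.mkQ ∘ₗ LinearMap.fst R R R
  have hker : LinearMap.ker g ≤ LinearMap.ker h := by
    rintro ⟨r, s⟩ hrs
    have h1 : r * y + s * a = 0 := by
      have := congrArg (Subtype.val) (LinearMap.mem_ker.mp hrs)
      simpa [hg] using this
    have hs : s ∈ maximalIdeal R := by
      rw [mem_maximalIdeal]
      rintro ⟨u, rfl⟩
      apply ha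
      rw [Ideal.mem_span_singleton]
      refine ⟨- ↑u⁻¹ * r, ?_⟩
      calc a = ↑u⁻¹ * (↑u * a) := by simp
        _ = _ := by linear_combination (↑u⁻¹ : R) * h1
    obtain ⟨w, hw, hw2⟩ := Ideal.mem_span_singleton_mul.mp (ham s hs)
    have h2 : r + w = 0 := by
      apply hreg'
      linear_combination hw2 + h1
    rw [LinearMap.mem_ker]
    change I.mkQ r = 0
    rw [Submodule.mkQ_apply, Submodule.Quotient.mk_eq_zero, eq_neg_of_add_eq_zero_left h2]
    exact I.neg_mem hw
  refine ⟨(LinearMap.ker g).liftQ h hker ∘ₗ (g.quotKerEquivOfSurjective hgs).symm.toLinearMap, ?_⟩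
  rw [LinearMap.coe_comp]
  refine Function.Surjective.comp ?_ (LinearEquiv.surjective _)
  intro q
  obtain ⟨r, rfl⟩ := Submodule.mkQ_surjective _ q
  exact ⟨Submodule.Quotient.mk (r, 0), rfl⟩

theorem main_abstract {A : Type*} [CommRing A] [IsDomain A] [IsDiscreteValuationRing A]
    {R : Type u} [CommRing R] [IsLocalRing R] [Algebra A R] [Module.Finite A R]
    (t : A) (ht : Irreducible t) (x y z : R) (hty : algebraMap A R t = y)
    (hm : maximalIdeal R = Ideal.span {x, y, z})
    (hx : x ^ 2 = y ^ 5) (hz : x * y ^ 2 + y * z ^ 3 - z ^ 5 = 0)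
    (hreg : IsSMulRegular R y) (hnot : x * z ^ 4 ∉ Ideal.span {y})
    (lam : R →ₗ[A] A)
    (hinj : ∀ r : R, (∀ s, lam (s * r) = 0) → r = 0)
    (hsurj : ∀ h : R →ₗ[A] A, ∃ r : R, ∀ s, lam (s * r) = h s) :
    (Ideal.span {y} * maximalIdeal R ^ 5).colon (maximalIdeal R) ≤ Ideal.span {y} ∧
      ¬ (Ideal.span {y} * maximalIdeal R ^ 4).colon (maximalIdeal R) ≤ Ideal.span {y} ∧
      ringIndex R = 5 := by
  have hnoeth : IsNoetherianRing R := IsNoetherianRing.of_finite A R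
  have hym : y ∈ maximalIdeal R := hm ▸ Ideal.subset_span (by simp)
  have hxm : x ∈ maximalIdeal R := hm ▸ Ideal.subset_span (by simp)
  have hzm : z ∈ maximalIdeal R := hm ▸ Ideal.subset_span (by simp)
  have hreg' : ∀ r, y * r = 0 → r = 0 := isSMulRegular_iff_right_eq_zero_of_smul.mp hreg
  have h7 : maximalIdeal R ^ 7 ≤ Ideal.span {y} := by rw [hm]; exact pow_le_span hx hz
  have hdim : ringKrullDim R = 1 := dim_one y hreg hym 7 h7
  have hgex := exists_g hx hz hreg
  rw [← hm] at hgex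
  obtain ⟨g, hg⟩ := hgex
  have hcm : ∀ i, (![x, y, z] : Fin 3 → R) i ∈ maximalIdeal R := by
    intro i
    fin_cases i
    · exact hxm
    · exact hym
    · exact hzm
  -- the element `a = x z^4`
  have ham : ∀ s ∈ maximalIdeal R, s * (x * z ^ 4) ∈ Ideal.span {y} * maximalIdeal R ^ 4 := by
    have hle : maximalIdeal R ≤
        (Ideal.span {y} * maximalIdeal R ^ 4).colon {x * z ^ 4} := by
      conv_lhs => rw [hm]
      rw [Ideal.span_le]
      have hz4 := Ideal.pow_mem_pow hzm 4
      have hz3 := Ideal.pow_mem_pow hzm 3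
      rintro s (rfl | rfl | rfl) <;>
        rw [SetLike.mem_coe, Submodule.mem_colon_singleton, smul_eq_mul,
          Ideal.mem_span_singleton_mul]
      · refine ⟨y ^ 4 * z ^ 4, Ideal.mul_mem_left _ _ hz4, ?_⟩
        linear_combination -z ^ 4 * hx
      · exact ⟨x * z ^ 4, Ideal.mul_mem_left _ _ hz4, rfl⟩
      · refine ⟨x * s ^ 3 + y ^ 4 * y ^ 2, Ideal.add_mem _ ?_ ?_, ?_⟩
        · rw [mul_comm, pow_succ]
          exact Ideal.mul_mem_mul hz3 hxm
        · exact Ideal.mul_mem_right _ _ (Ideal.pow_mem_pow hym 4)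
        · linear_combination -y ^ 2 * hx + x * hz
    intro s hs
    have := hle hs
    rwa [Submodule.mem_colon_singleton, smul_eq_mul] at this
  refine ⟨?_, ?_, ?_⟩
  · intro a ha
    rw [Submodule.mem_colon] at ha
    have h5 : a ∈ maximalIdeal R ^ 5 := by
      obtain ⟨w, hw, hw2⟩ := Ideal.mem_span_singleton_mul.mp (ha y hym)
      have : w - a = 0 := by
        apply hreg'
        rw [smul_eq_mul] at hw2
        linear_combination hw2
      rwa [← sub_eq_zero.mp this]
    have hd : ∀ i, y ∣ (![x, y, z] i) * g i ⟨a, h5⟩ := by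
      intro i
      obtain ⟨w, hw, hw2⟩ := Ideal.mem_span_singleton_mul.mp (ha _ (hcm i))
      refine ⟨g i ⟨w, hw⟩, ?_⟩
      rw [← smul_eq_mul, ← smul_eq_mul, ← map_smul, ← map_smul]
      congr 1
      ext
      simp only [Submodule.coe_smul, smul_eq_mul]
      rw [hw2, smul_eq_mul, mul_comm]
    rw [Ideal.mem_span_singleton]
    have := hg ⟨a, h5⟩
    simp only at this
    rw [← this]
    exact Finset.dvd_sum fun i _ => hd i
  · intro hle
    refine hnot (hle ?_)
    rw [Submodule.mem_colon]
    intro s hs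
    rw [smul_eq_mul, mul_comm (x * z ^ 4) s]
    exact ham s hs
  · have hlow : ∀ n, n ≤ 4 → auslanderDelta R (R ⧸ (maximalIdeal R ^ n)) = 0 := by
      intro n hn
      unfold auslanderDelta
      refine le_antisymm (Nat.sInf_le ?_) (Nat.zero_le _)
      have hne : Nontrivial (Ideal.span {y, x * z ^ 4} : Ideal R) := by
        refine ⟨⟨y, Ideal.subset_span (by simp)⟩, 0, fun h => ?_⟩
        have h0 : y = 0 := congrArg Subtype.val h
        exact one_ne_zero (hreg' 1 (by rw [h0, zero_mul]))
      refine ⟨ModuleCat.of R (Ideal.span {y, x * z ^ 4} : Ideal R), ?_, ?_, ?_, ?_⟩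
      · change Module.Finite R (Ideal.span {y, x * z ^ 4} : Ideal R)
        infer_instance
      · change IsMCM R (Ideal.span {y, x * z ^ 4} : Ideal R)
        refine isMCM_of_regular hdim y hym ?_
        refine isSMulRegular_iff_right_eq_zero_of_smul.mpr fun j hj => ?_
        ext
        exact hreg' _ (congrArg Subtype.val hj)
      · obtain ⟨φ, hφ⟩ := mapsOnto y (x * z ^ 4) (maximalIdeal R ^ 4) hreg hnot ham
        have hle : maximalIdeal R ^ 4 ≤ maximalIdeal R ^ n := Ideal.pow_le_pow_right hn
        refine ⟨Submodule.factor hle ∘ₗ φ, ?_⟩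
        rw [LinearMap.coe_comp]
        exact (Submodule.factor_surjective hle).comp hφ
      · change freeRank R (Ideal.span {y, x * z ^ 4} : Ideal R) = 0
        refine freeRank_ideal _ _ hreg hym hnot fun s hs => ?_
        exact Ideal.mul_mono_right (Ideal.pow_le_self (by norm_num)) (ham s hs)
    have hfive : auslanderDelta R (R ⧸ (maximalIdeal R ^ 5)) = 1 := by
      unfold auslanderDelta
      have hmem : (1 : ℕ) ∈ {r : ℕ | ∃ X : ModuleCat.{u} R, Module.Finite R X ∧ IsMCM R X ∧
          (∃ φ : X →ₗ[R] (R ⧸ (maximalIdeal R ^ 5)), Function.Surjective φ) ∧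
            freeRank R X = r} := by
        refine ⟨ModuleCat.of R R, ?_, ?_, ?_, ?_⟩
        · change Module.Finite R R
          infer_instance
        · change IsMCM R R
          exact isMCM_of_regular hdim y hym hreg
        · exact ⟨(maximalIdeal R ^ 5).mkQ, Submodule.mkQ_surjective _⟩
        · exact freeRank_self (R := R)
      refine le_antisymm (Nat.sInf_le hmem) ?_
      refine le_csInf ⟨1, hmem⟩ ?_
      rintro r ⟨X, hXf, ⟨rs, hrs, hrs2, hrs3⟩, ⟨φ, hφ⟩, rfl⟩
      rw [hdim] at hrs3
      have hlen : rs.length = 1 := by exact_mod_cast hrs3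
      obtain ⟨r, rfl⟩ := List.length_eq_one_iff.mp hlen
      have hrX : IsSMulRegular X r :=
        (RingTheory.Sequence.isWeaklyRegular_singleton_iff X r).mp hrs2.toIsWeaklyRegular
      have hyX : IsSMulRegular X y := regular_of_mcm y r 7 h7 (hrs r (by simp)) hrX
      obtain ⟨f, e, hfe⟩ := exists_unit_functional t ht (hty ▸ hyX) lam hinj hsurj
        (maximalIdeal R ^ 5) (Ideal.pow_le_self (by norm_num)) ![x, y, z] hcm g hg φ hφ
      exact one_le_freeRank f e hfe
    unfold ringIndex
    refine le_antisymm (sInf_le ⟨5, hfive, rfl⟩) ?_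
    refine le_sInf ?_
    rintro _ ⟨n, hn, rfl⟩
    by_contra! hlt
    have hlt' : n < 5 := by exact_mod_cast hlt
    have := hlow n (by omega)
    rw [Set.mem_setOf_eq, this] at hn
    exact zero_ne_one hn

end main

section model

/-- A functional whose associated trace form is perfect. -/
def Perf {A R : Type*} [CommRing A] [CommRing R] [Algebra A R] (l : R →ₗ[A] A) : Prop :=
  (∀ r : R, (∀ s, l (s * r) = 0) → r = 0) ∧
    (∀ h : R →ₗ[A] A, ∃ r : R, ∀ s, l (s * r) = h s)

theorem Perf.of_basis {A R : Type*} [CommRing A] [CommRing R] [Algebra A R] (l : R →ₗ[A] A)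
    {ι : Type*} [Fintype ι] [DecidableEq ι] (b : Module.Basis ι A R) (d : ι → R)
    (h : ∀ i j, l (b i * d j) = if i = j then 1 else 0) : Perf l := by
  constructor
  · intro r hr
    have : b.repr r = 0 := by
      ext j
      have h1 := hr (d j)
      nth_rewrite 1 [← b.sum_repr r] at h1
      rw [mul_comm, Finset.sum_mul, map_sum] at h1
      simpa [h] using h1
    simpa using this
  · intro f
    refine ⟨∑ j, f (b j) • d j, fun s => ?_⟩
    have : (l ∘ₗ LinearMap.mulRight A (∑ j, f (b j) • d j)) = f := by
      refine b.ext fun i => ?_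
      simp [Finset.mul_sum, h]
    exact LinearMap.congr_fun this s

theorem Perf.comp {A B D : Type*} [CommRing A] [CommRing B] [CommRing D] [Algebra A B]
    [Algebra B D] [Algebra A D] [IsScalarTower A B D] {l1 : B →ₗ[A] A} {l2 : D →ₗ[B] B}
    (h1 : Perf l1) (h2 : Perf l2) : Perf (l1 ∘ₗ l2.restrictScalars A) := by
  have uniq : ∀ q q' : B, (∀ c, l1 (c * q) = l1 (c * q')) → q = q' := by
    intro q q' h
    refine sub_eq_zero.mp (h1.1 _ fun s => ?_)
    rw [mul_sub, map_sub, h, sub_self]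
  constructor
  · intro r hr
    refine h2.1 r fun s => h1.1 _ fun c => ?_
    rw [← smul_eq_mul c, ← map_smul, ← smul_mul_assoc]
    exact hr _
  · intro h
    have : ∀ d : D, ∃ q : B, ∀ c, l1 (c * q) = h (c • d) := by
      intro d
      obtain ⟨q, hq⟩ := h1.2 (h ∘ₗ (LinearMap.toSpanSingleton B D d).restrictScalars A)
      exact ⟨q, hq⟩
    choose H hH using this
    obtain ⟨r, hr⟩ := h2.2
      { toFun := H
        map_add' := by
          intro d d'
          refine uniq _ _ fun c => ?_
          rw [mul_add, map_add, hH, hH, hH, smul_add, map_add]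
        map_smul' := by
          intro c' d
          refine uniq _ _ fun c => ?_
          rw [hH, RingHom.id_apply, smul_eq_mul, ← mul_assoc, hH, mul_smul] }
    refine ⟨r, fun s => ?_⟩
    have h3 := hH s 1
    rw [one_mul, one_smul] at h3
    change l1 (l2 (s * r)) = _
    rw [hr, ← h3]
    rfl

open Polynomial in
theorem quad_model {A : Type*} [CommRing A] [Nontrivial A] (p : A) :
    ∃ l : AdjoinRoot (X ^ 2 - C p : A[X]) →ₗ[A] A, Perf l ∧ l (AdjoinRoot.root _) = 1 ∧
      Module.Finite A (AdjoinRoot (X ^ 2 - C p : A[X])) ∧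
      Module.Free A (AdjoinRoot (X ^ 2 - C p : A[X])) := by
  have hmon : (X ^ 2 - C p : A[X]).Monic := by monicity!
  have hdeg : (X ^ 2 - C p : A[X]).natDegree = 2 := by compute_degree!
  let b := ((AdjoinRoot.powerBasis' hmon).basis).reindex (finCongr hdeg)
  have hb : ∀ i : Fin 2, b i = AdjoinRoot.root (X ^ 2 - C p : A[X]) ^ (i : ℕ) := by
    intro i
    simp only [b, Module.Basis.reindex_apply, PowerBasis.coe_basis, AdjoinRoot.powerBasis'_gen]
    rfl
  have hl : ∀ i : Fin 2, b.coord 1 (AdjoinRoot.root (X ^ 2 - C p : A[X]) ^ (i : ℕ)) =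
      if i = 1 then 1 else 0 := by
    intro i
    rw [← hb, Module.Basis.coord_apply, Module.Basis.repr_self, Finsupp.single_apply]
  have hrel : AdjoinRoot.root (X ^ 2 - C p : A[X]) ^ 2 = algebraMap A _ p := by
    have := AdjoinRoot.eval₂_root (X ^ 2 - C p : A[X])
    simp only [eval₂_sub, eval₂_pow, eval₂_X, eval₂_C] at this
    exact sub_eq_zero.mp this
  generalize hr : AdjoinRoot.root (X ^ 2 - C p : A[X]) = r at *
  have e0 : b.coord 1 1 = 0 := by simpa using hl 0
  have e1 : b.coord 1 r = 1 := by simpa using hl 1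
  have e2 : b.coord 1 (r ^ 2) = 0 := by
    rw [hrel, Algebra.algebraMap_eq_smul_one, map_smul, e0, smul_zero]
  refine ⟨b.coord 1, ?_, e1, Module.Finite.of_basis b, Module.Free.of_basis b⟩
  refine Perf.of_basis _ b ![r, 1] ?_
  intro i j
  rw [hb]
  have e2' : b.coord 1 (r * r) = 0 := by rw [← pow_two, e2]
  fin_cases i <;> fin_cases j
  · simpa using e1
  · simpa using e0
  · simpa using e2'
  · simpa using e1

open Polynomial in
theorem quint_model {B : Type*} [CommRing B] [Nontrivial B] (y w : B) :
    ∃ l : AdjoinRoot (X ^ 5 - C y * X ^ 3 - C w : B[X]) →ₗ[B] B, Perf l ∧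
      l (AdjoinRoot.root _ ^ 4) = 1 ∧
      Module.Finite B (AdjoinRoot (X ^ 5 - C y * X ^ 3 - C w : B[X])) ∧
      Module.Free B (AdjoinRoot (X ^ 5 - C y * X ^ 3 - C w : B[X])) := by
  have hmon : (X ^ 5 - C y * X ^ 3 - C w : B[X]).Monic := by monicity!
  have hdeg : (X ^ 5 - C y * X ^ 3 - C w : B[X]).natDegree = 5 := by compute_degree!
  let b := ((AdjoinRoot.powerBasis' hmon).basis).reindex (finCongr hdeg)
  have hb : ∀ i : Fin 5, b i = AdjoinRoot.root (X ^ 5 - C y * X ^ 3 - C w : B[X]) ^ (i : ℕ) := by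
    intro i
    simp only [b, Module.Basis.reindex_apply, PowerBasis.coe_basis, AdjoinRoot.powerBasis'_gen]
    rfl
  have hl : ∀ i : Fin 5, b.coord 4 (AdjoinRoot.root (X ^ 5 - C y * X ^ 3 - C w : B[X]) ^ (i : ℕ)) =
      if i = 4 then 1 else 0 := by
    intro i
    rw [← hb, Module.Basis.coord_apply, Module.Basis.repr_self, Finsupp.single_apply]
  have hrel : AdjoinRoot.root (X ^ 5 - C y * X ^ 3 - C w : B[X]) ^ 5 =
      y • AdjoinRoot.root (X ^ 5 - C y * X ^ 3 - C w : B[X]) ^ 3 + w • 1 := by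
    have := AdjoinRoot.eval₂_root (X ^ 5 - C y * X ^ 3 - C w : B[X])
    simp only [eval₂_sub, eval₂_pow, eval₂_X, eval₂_C, eval₂_mul] at this
    rw [Algebra.smul_def, Algebra.smul_def, AdjoinRoot.algebraMap_eq]
    linear_combination this
  generalize hr : AdjoinRoot.root (X ^ 5 - C y * X ^ 3 - C w : B[X]) = r at *
  have e0 : b.coord 4 1 = 0 := by simpa using hl 0
  have e1 : b.coord 4 r = 0 := by simpa using hl 1
  have e2 : b.coord 4 (r ^ 2) = 0 := by simpa using hl 2
  have e3 : b.coord 4 (r ^ 3) = 0 := by simpa using hl 3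
  have e4 : b.coord 4 (r ^ 4) = 1 := by simpa using hl 4
  have hstep : ∀ n, b.coord 4 (r ^ (n + 5)) =
      y * b.coord 4 (r ^ (n + 3)) + w * b.coord 4 (r ^ n) := by
    intro n
    have : r ^ (n + 5) = y • r ^ (n + 3) + w • r ^ n := by
      rw [pow_add, hrel, mul_add, mul_smul_comm, mul_smul_comm, mul_one, ← pow_add]
    rw [this, map_add, map_smul, map_smul, smul_eq_mul, smul_eq_mul]
  have e5 : b.coord 4 (r ^ 5) = 0 := by
    have := hstep 0
    simpa [e3, e0] using this
  have e6 : b.coord 4 (r ^ 6) = y := by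
    have := hstep 1
    simpa [e4, e1] using this
  have e7 : b.coord 4 (r ^ 7) = 0 := by
    have := hstep 2
    simpa [e5, e2] using this
  have e8 : b.coord 4 (r ^ 8) = y * y := by
    have := hstep 3
    simpa [e6, e3] using this
  refine ⟨b.coord 4, ?_, e4, Module.Finite.of_basis b, Module.Free.of_basis b⟩
  refine Perf.of_basis _ b ![r ^ 4 - y • r ^ 2, r ^ 3 - y • r ^ 1, r ^ 2 - y • r ^ 0, r, 1] ?_
  intro i j
  rw [hb]
  generalize b.coord 4 = l at *
  have f0 : l (r ^ 0) = 0 := by simpa using e0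
  have f1 : l (r ^ 1) = 0 := by simpa using e1
  have g2 : l (r * r) = 0 := by rw [← pow_two, e2]
  have g3 : l (r * r ^ 2) = 0 := by rw [← pow_succ', e3]
  have g4 : l (r * r ^ 3) = 1 := by rw [← pow_succ', e4]
  have g5 : l (r * r ^ 4) = 0 := by rw [← pow_succ', e5]
  fin_cases i <;> fin_cases j <;>
    simp only [Fin.zero_eta, Fin.mk_one, Fin.reduceFinMk, Matrix.cons_val, Fin.isValue,
      Fin.val_zero, Fin.val_one, Fin.val_two, mul_sub, mul_smul_comm, ← pow_add, ← pow_succ,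
      map_sub, map_smul, mul_one, Fin.val_ofNat, Nat.reduceMod, Nat.reduceAdd, zero_add,
      e0, e1, e2, e3, e4, e5, e6, e7, e8, f0, f1, smul_eq_mul, mul_zero, sub_zero, sub_self,
      pow_zero, one_mul, pow_one] <;>
    simp [g2, g3, g4, g5]

end model

section concrete

open Polynomial in
theorem modelA (k : Type u) [Field k] : ∃ (A : Type u) (_ : CommRing A) (_ : IsDomain A)
    (_ : IsDiscreteValuationRing A) (i : k →+* A) (t : A), Irreducible t ∧
    (∀ (R : Type u) [CommRing R] [IsLocalRing R] (j : k →+* R) (y : R),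
      y ∈ maximalIdeal R → ∃ f : A →+* R, f.comp i = j ∧ f t = y) ∧
    (∀ (R : Type u) [CommRing R] (f g : A →+* R), f.comp i = g.comp i → f t = g t → f = g) := by
  have hP : (Ideal.span {X} : Ideal k[X]).IsPrime :=
    (Ideal.span_singleton_prime X_ne_zero).mpr prime_X
  have hP0 : (Ideal.span {X} : Ideal k[X]) ≠ ⊥ := by
    rw [Ne, Ideal.span_singleton_eq_bot]
    exact X_ne_zero
  let A := Localization.AtPrime (Ideal.span {X} : Ideal k[X])
  have hdvr : IsDiscreteValuationRing A :=
    IsLocalization.AtPrime.isDiscreteValuationRing_of_dedekind_domain k[X] hP0 A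
  refine ⟨A, inferInstance, inferInstance, hdvr, (algebraMap k[X] A).comp C,
    algebraMap k[X] A X, ?_, ?_, ?_⟩
  · rw [IsDiscreteValuationRing.irreducible_iff_uniformizer]
    have := Localization.AtPrime.map_eq_maximalIdeal (I := (Ideal.span {X} : Ideal k[X]))
    rw [Ideal.map_span, Set.image_singleton] at this
    exact this.symm
  · intro R _ _ j y hy
    have hu : ∀ s : (Ideal.span {X} : Ideal k[X]).primeCompl, IsUnit (eval₂RingHom j y s) := by
      rintro ⟨s, hs⟩
      have hs' : s.coeff 0 ≠ 0 := by
        intro h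
        exact hs (Ideal.mem_span_singleton.mpr (X_dvd_iff.mpr h))
      obtain ⟨q, hq⟩ : X ∣ s - C (s.coeff 0) := by
        rw [X_dvd_iff]; simp
      have e : eval₂RingHom j y s = j (s.coeff 0) + y * eval₂RingHom j y q := by
        have h1 : s = C (s.coeff 0) + X * q := by rw [← hq]; ring
        conv_lhs => rw [h1]
        simp
      change IsUnit (eval₂RingHom j y s)
      rw [e]
      by_contra hcon
      have h2 := (mem_maximalIdeal _).mpr hcon
      have h3 := (Ideal.add_mem_iff_left _ (Ideal.mul_mem_right _ _ hy)).mp h2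
      exact (mem_maximalIdeal _).mp h3 ((isUnit_iff_ne_zero.mpr hs').map j)
    refine ⟨IsLocalization.lift (M := (Ideal.span {X} : Ideal k[X]).primeCompl) hu, ?_, ?_⟩
    · ext a
      simp
    · simp
  · intro R _ f g h1 h2
    refine IsLocalization.ringHom_ext (Ideal.span {X} : Ideal k[X]).primeCompl ?_
    refine Polynomial.ringHom_ext ?_ h2
    intro a
    exact RingHom.congr_fun h1 a

open Polynomial in
theorem modelB {A : Type u} [CommRing A] [Nontrivial A] (p : A) :
    ∃ (B : Type u) (_ : CommRing B) (_ : Algebra A B) (_ : Nontrivial B) (_ : Module.Finite A B)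
    (_ : Module.Free A B) (x : B) (l : B →ₗ[A] A),
    Perf l ∧ l x = 1 ∧ x ^ 2 = algebraMap A B p ∧
    (∀ (R : Type u) [CommRing R] (f : A →+* R) (x' : R), x' ^ 2 = f p →
      ∃ g : B →+* R, g.comp (algebraMap A B) = f ∧ g x = x') ∧
    (∀ (R : Type u) [CommRing R] (f g : B →+* R),
      f.comp (algebraMap A B) = g.comp (algebraMap A B) → f x = g x → f = g) := by
  obtain ⟨l1, hl1, hl1r, hfin1, hfree1⟩ := quad_model p
  have hx0 := AdjoinRoot.eval₂_root (X ^ 2 - C p : A[X])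
  simp only [eval₂_sub, eval₂_pow, eval₂_X, eval₂_C] at hx0
  have hnt : Nontrivial (AdjoinRoot (X ^ 2 - C p : A[X])) := by
    refine ⟨AdjoinRoot.root _, 0, fun h => ?_⟩
    rw [h, map_zero] at hl1r
    exact zero_ne_one hl1r
  refine ⟨_, inferInstance, inferInstance, hnt, hfin1, hfree1, AdjoinRoot.root _, l1, hl1, hl1r,
    sub_eq_zero.mp hx0, ?_, ?_⟩
  · intro R _ f x' h
    have : (X ^ 2 - C p : A[X]).eval₂ f x' = 0 := by
      simp only [eval₂_sub, eval₂_pow, eval₂_X, eval₂_C, h, sub_self]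
    exact ⟨AdjoinRoot.lift f x' this, AdjoinRoot.lift_comp_of _, AdjoinRoot.lift_root _⟩
  · intro R _ f g h1 h2
    exact AdjoinRoot.ringHom_ext h1 h2

open Polynomial in
theorem modelQ {A : Type u} [CommRing A] [Nontrivial A] (y w : A) :
    ∃ (B : Type u) (_ : CommRing B) (_ : Algebra A B) (_ : Module.Finite A B)
    (_ : Module.Free A B) (z : B) (l : B →ₗ[A] A),
    Perf l ∧ l (z ^ 4) = 1 ∧ algebraMap A B w + algebraMap A B y * z ^ 3 - z ^ 5 = 0 ∧
    (∀ (R : Type u) [CommRing R] (f : A →+* R) (z' : R), f w + f y * z' ^ 3 - z' ^ 5 = 0 →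
      ∃ g : B →+* R, g.comp (algebraMap A B) = f ∧ g z = z') ∧
    (∀ (R : Type u) [CommRing R] (f g : B →+* R),
      f.comp (algebraMap A B) = g.comp (algebraMap A B) → f z = g z → f = g) := by
  obtain ⟨l1, hl1, hl1r, hfin1, hfree1⟩ := quint_model y w
  have hx0 := AdjoinRoot.eval₂_root (X ^ 5 - C y * X ^ 3 - C w : A[X])
  simp only [eval₂_sub, eval₂_pow, eval₂_X, eval₂_C, eval₂_mul] at hx0
  refine ⟨_, inferInstance, inferInstance, hfin1, hfree1, AdjoinRoot.root _, l1, hl1, hl1r,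
    ?_, ?_, ?_⟩
  · rw [AdjoinRoot.algebraMap_eq]
    linear_combination -hx0
  · intro R _ f z' h
    have : (X ^ 5 - C y * X ^ 3 - C w : A[X]).eval₂ f z' = 0 := by
      simp only [eval₂_sub, eval₂_pow, eval₂_X, eval₂_C, eval₂_mul]
      linear_combination -h
    exact ⟨AdjoinRoot.lift f z' this, AdjoinRoot.lift_comp_of _, AdjoinRoot.lift_root _⟩
  · intro R _ f g h1 h2
    exact AdjoinRoot.ringHom_ext h1 h2

theorem modelD (k : Type u) [Field k] : ∃ (A D : Type u) (_ : CommRing A) (_ : IsDomain A)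
    (_ : IsDiscreteValuationRing A) (_ : CommRing D) (_ : Algebra A D) (_ : Module.Finite A D)
    (_ : Module.Free A D) (i : k →+* D) (t : A) (x z : D) (l : D →ₗ[A] A),
    Irreducible t ∧ x ^ 2 = algebraMap A D t ^ 5 ∧
    x * algebraMap A D t ^ 2 + algebraMap A D t * z ^ 3 - z ^ 5 = 0 ∧
    Perf l ∧ l (x * z ^ 4) = 1 ∧
    (∀ (R : Type u) [CommRing R] [IsLocalRing R] (j : k →+* R) (x' y' z' : R),
      y' ∈ maximalIdeal R → x' ^ 2 = y' ^ 5 → x' * y' ^ 2 + y' * z' ^ 3 - z' ^ 5 = 0 →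
      ∃ f : D →+* R, f.comp i = j ∧ f x = x' ∧ f (algebraMap A D t) = y' ∧ f z = z') ∧
    (∀ (R : Type u) [CommRing R] (f g : D →+* R), f.comp i = g.comp i → f x = g x →
      f (algebraMap A D t) = g (algebraMap A D t) → f z = g z → f = g) := by
  obtain ⟨A, _, _, _, i, t, ht, hlift, hext⟩ := modelA k
  obtain ⟨B, _, _, _, _, _, x, l1, hl1, hl1x, hx, hlift1, hext1⟩ := modelB (t ^ 5)
  obtain ⟨D, _, _, _, _, z, l2, hl2, hl2z, hz, hlift2, hext2⟩ :=
    modelQ (algebraMap A B t) (x * algebraMap A B t ^ 2)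
  letI : Algebra A D := ((algebraMap B D).comp (algebraMap A B)).toAlgebra
  haveI : IsScalarTower A B D := IsScalarTower.of_algebraMap_eq' rfl
  have hAD : ∀ a, algebraMap A D a = algebraMap B D (algebraMap A B a) := fun _ => rfl
  refine ⟨A, D, inferInstance, inferInstance, inferInstance, inferInstance, inferInstance,
    Module.Finite.trans B D, Module.Free.trans (S := B), (algebraMap A D).comp i, t,
    algebraMap B D x, z, l1 ∘ₗ l2.restrictScalars A, ht, ?_, ?_, hl1.comp hl2, ?_, ?_, ?_⟩
  · rw [hAD, ← map_pow, ← map_pow, hx, map_pow]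
  · rw [hAD, ← hz, map_mul, map_pow]
  · change l1 (l2 _) = 1
    rw [← Algebra.smul_def, map_smul, hl2z, smul_eq_mul, mul_one, hl1x]
  · intro R _ _ j x' y' z' hy' hx' hz'
    obtain ⟨f0, hf0, hf0t⟩ := hlift R j y' hy'
    obtain ⟨f1, hf1, hf1x⟩ := hlift1 R f0 x' (by rw [map_pow, hf0t, hx'])
    have hf1' : ∀ a, f1 (algebraMap A B a) = f0 a := fun a => RingHom.congr_fun hf1 a
    obtain ⟨f2, hf2, hf2z⟩ := hlift2 R f1 z' (by rw [map_mul, map_pow, hf1', hf0t, hf1x, hz'])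
    have hf2' : ∀ a, f2 (algebraMap B D a) = f1 a := fun a => RingHom.congr_fun hf2 a
    refine ⟨f2, ?_, ?_, ?_, hf2z⟩
    · rw [← hf0]
      ext a
      simp only [RingHom.comp_apply, hAD, hf2', hf1']
    · rw [hf2', hf1x]
    · rw [hAD, hf2', hf1', hf0t]
  · intro R _ f g h1 h2 h3 h4
    exact hext2 R f g (hext1 R _ _ (hext R _ _ h1 h3) h2) h4

end concrete

section final

theorem main_transfer {A D : Type*} [CommRing A] [IsDomain A] [IsDiscreteValuationRing A]
    [CommRing D] [Algebra A D] [Module.Finite A D] [Module.Free A D]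
    {R : Type u} [CommRing R] [IsLocalRing R] (e : D ≃+* R)
    (t : A) (ht : Irreducible t) (x z : D) (l : D →ₗ[A] A)
    (hx : x ^ 2 = algebraMap A D t ^ 5)
    (hz : x * algebraMap A D t ^ 2 + algebraMap A D t * z ^ 3 - z ^ 5 = 0)
    (hl : Perf l) (hl1 : l (x * z ^ 4) = 1)
    (x' y' z' : R) (hx' : e x = x') (hy' : e (algebraMap A D t) = y') (hz' : e z = z')
    (hm : maximalIdeal R = Ideal.span {x', y', z'}) :
    (Ideal.span {y'} * maximalIdeal R ^ 5).colon (maximalIdeal R) ≤ Ideal.span {y'} ∧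
      ¬ (Ideal.span {y'} * maximalIdeal R ^ 4).colon (maximalIdeal R) ≤ Ideal.span {y'} ∧
      ringIndex R = 5 := by
  letI : Algebra A R := ((e : D →+* R).comp (algebraMap A D)).toAlgebra
  let e' : D ≃ₐ[A] R := AlgEquiv.ofRingEquiv (f := e) (fun _ => rfl)
  have he : ∀ d, e' d = e d := fun _ => rfl
  haveI : Module.Finite A R := Module.Finite.equiv e'.toLinearEquiv
  have htD : ∀ r : D, algebraMap A D t * r = t • r := fun r => (Algebra.smul_def t r).symm
  refine main_abstract t ht x' y' z' hy' hm ?_ ?_ ?_ ?_ (l ∘ₗ e'.symm.toLinearMap) ?_ ?_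
  · rw [← hx', ← hy', ← map_pow, hx, map_pow]
  · have h1 := congrArg e hz
    simpa only [map_sub, map_add, map_mul, map_pow, map_zero, hx', hy', hz'] using h1
  · intro a b hab
    have h1 : y' * a = y' * b := hab
    obtain ⟨a, rfl⟩ := e.surjective a
    obtain ⟨b, rfl⟩ := e.surjective b
    rw [← hy', ← map_mul, ← map_mul] at h1
    have h2 := e.injective h1
    rw [htD, htD] at h2
    have : a = b := smul_right_injective D ht.ne_zero h2
    rw [this]
  · intro hmem
    obtain ⟨r, hr⟩ := Ideal.mem_span_singleton.mp hmem
    obtain ⟨r, rfl⟩ := e.surjective r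
    rw [← hx', ← hy', ← hz', ← map_pow, ← map_mul, ← map_mul] at hr
    have h2 := e.injective hr
    rw [h2, htD, map_smul, smul_eq_mul] at hl1
    exact ht.not_isUnit (IsUnit.of_mul_eq_one _ hl1)
  · intro r hr
    have : e'.symm r = 0 := by
      refine hl.1 _ fun s => ?_
      have := hr (e' s)
      simpa using this
    simpa using this
  · intro h
    obtain ⟨r, hr⟩ := hl.2 (h ∘ₗ e'.toLinearMap)
    refine ⟨e' r, fun s => ?_⟩
    have := hr (e'.symm s)
    simpa using this

theorem mem_of_maximal {A D : Type*} [CommRing A] [IsLocalRing A]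
    [CommRing D] [Algebra A D] [Module.Finite A D] (t : A) (ht : ¬ IsUnit t) (x z : D)
    (hx : x ^ 2 = algebraMap A D t ^ 5)
    (hz : x * algebraMap A D t ^ 2 + algebraMap A D t * z ^ 3 - z ^ 5 = 0)
    (M : Ideal D) [hM : M.IsMaximal] : x ∈ M ∧ algebraMap A D t ∈ M ∧ z ∈ M := by
  have h1 : (M.comap (algebraMap A D)).IsMaximal :=
    Ideal.isMaximal_comap_of_isIntegral_of_isMaximal M
  have hy : algebraMap A D t ∈ M := by
    rw [← Ideal.mem_comap, IsLocalRing.eq_maximalIdeal h1]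
    exact (mem_maximalIdeal _).mpr ht
  refine ⟨?_, hy, ?_⟩
  · refine hM.isPrime.mem_of_pow_mem 2 ?_
    rw [hx]
    exact Ideal.pow_mem_of_mem M hy 5 (by norm_num)
  · refine hM.isPrime.mem_of_pow_mem 5 ?_
    have : z ^ 5 = (x * algebraMap A D t + z ^ 3) * algebraMap A D t := by
      linear_combination -hz
    rw [this]
    exact M.mul_mem_left _ hy

open MvPolynomial

theorem sub_const_mem (k : Type*) [Field k] (p : MvPolynomial (Fin 3) k) :
    p - C (constantCoeff p) ∈ (Ideal.span {X 0, X 1, X 2} : Ideal (MvPolynomial (Fin 3) k)) := by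
  induction p using MvPolynomial.induction_on with
  | C a => simp
  | add p q hp hq =>
    have := Ideal.add_mem _ hp hq
    rw [map_add, map_add]
    convert this using 1
    ring
  | mul_X p i hp =>
    rw [map_mul, constantCoeff_X, mul_zero, map_zero, sub_zero]
    refine Ideal.mul_mem_left _ _ (Ideal.subset_span ?_)
    fin_cases i <;> simp

theorem mem_iff_const (k : Type*) [Field k] (p : MvPolynomial (Fin 3) k) :
    p ∈ (Ideal.span {X 0, X 1, X 2} : Ideal (MvPolynomial (Fin 3) k)) ↔ constantCoeff p = 0 := by
  constructor
  · intro h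
    have : (Ideal.span {X 0, X 1, X 2} : Ideal (MvPolynomial (Fin 3) k)) ≤
        RingHom.ker (constantCoeff (R := k) (σ := Fin 3)) := by
      rw [Ideal.span_le]
      rintro _ (rfl | rfl | rfl) <;> simp [RingHom.mem_ker]
    exact this h
  · intro h
    simpa [h] using sub_const_mem k p

theorem prime_span (k : Type*) [Field k] :
    (Ideal.span {X 0, X 1, X 2} : Ideal (MvPolynomial (Fin 3) k)).IsPrime := by
  have : (Ideal.span {X 0, X 1, X 2} : Ideal (MvPolynomial (Fin 3) k)) =
        RingHom.ker (constantCoeff (R := k) (σ := Fin 3)) := by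
    ext p
    rw [mem_iff_const, RingHom.mem_ker]
  rw [this]
  exact RingHom.ker_isPrime _

theorem exists_phi (k : Type u) [Field k]
    (hP : (Ideal.span {X 0, X 1, X 2} : Ideal (MvPolynomial (Fin 3) k)).IsPrime)
    (S : Type u) [CommRing S] [Algebra (MvPolynomial (Fin 3) k) S]
    [IsLocalization.AtPrime S (Ideal.span {X 0, X 1, X 2} : Ideal (MvPolynomial (Fin 3) k))]
    (I : Ideal S) (hI : I = (Ideal.span {(X 0) ^ 2 - (X 1) ^ 5,
        (X 0) * (X 1) ^ 2 + (X 1) * (X 2) ^ 3 - (X 2) ^ 5}).map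
          (algebraMap (MvPolynomial (Fin 3) k) S))
    (D : Type u) [CommRing D] (i : k →+* D) (x y z : D)
    (hM : ∀ M : Ideal D, M.IsMaximal → x ∈ M ∧ y ∈ M ∧ z ∈ M)
    (hx : x ^ 2 = y ^ 5) (hz : x * y ^ 2 + y * z ^ 3 - z ^ 5 = 0) :
    ∃ φ : S ⧸ I →+* D, ∀ p : MvPolynomial (Fin 3) k,
      φ (Ideal.Quotient.mk I (algebraMap _ S p)) = eval₂Hom i ![x, y, z] p := by
  let F : MvPolynomial (Fin 3) k →+* D := eval₂Hom i ![x, y, z]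
  have hu : ∀ s : (Ideal.span {X 0, X 1, X 2} : Ideal (MvPolynomial (Fin 3) k)).primeCompl,
      IsUnit (F s) := by
    rintro ⟨s, hs⟩
    change IsUnit (F s)
    have hs0 : constantCoeff s ≠ 0 := fun h => hs ((mem_iff_const k s).mpr h)
    by_contra hcon
    obtain ⟨M, hMm, hsM⟩ := exists_max_ideal_of_mem_nonunits hcon
    obtain ⟨h1, h2, h3⟩ := hM M hMm
    have hle : (Ideal.span {X 0, X 1, X 2} : Ideal (MvPolynomial (Fin 3) k)) ≤ M.comap F := by
      rw [Ideal.span_le]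
      rintro _ (rfl | rfl | rfl) <;> simpa [F]
    have h4 : F (s - C (constantCoeff s)) ∈ M := hle (sub_const_mem k s)
    rw [map_sub] at h4
    have h5 : F (C (constantCoeff s)) ∈ M := by
      have := M.sub_mem hsM h4
      simpa using this
    refine hMm.ne_top (Ideal.eq_top_of_isUnit_mem _ h5 ?_)
    exact (isUnit_iff_ne_zero.mpr hs0).map (F.comp C)
  let G : S →+* D := IsLocalization.lift
    (M := (Ideal.span {X 0, X 1, X 2} : Ideal (MvPolynomial (Fin 3) k)).primeCompl) hu
  have hG : ∀ p, G (algebraMap _ S p) = F p := fun p => IsLocalization.lift_eq hu p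
  have hk : I ≤ RingHom.ker G := by
    rw [hI, Ideal.map_le_iff_le_comap, Ideal.span_le]
    rintro _ (rfl | rfl)
    · simp only [SetLike.mem_coe, Ideal.mem_comap, RingHom.mem_ker, hG]
      simp [F, hx]
    · simp only [SetLike.mem_coe, Ideal.mem_comap, RingHom.mem_ker, hG]
      simp [F, hz]
  refine ⟨Ideal.Quotient.lift I G fun a ha => RingHom.mem_ker.mp (hk ha), fun p => ?_⟩
  rw [Ideal.Quotient.lift_mk, hG]

theorem main_S (k : Type u) [Field k]
    (hP : (Ideal.span {X 0, X 1, X 2} : Ideal (MvPolynomial (Fin 3) k)).IsPrime)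
    (S : Type u) [CommRing S] [Algebra (MvPolynomial (Fin 3) k) S]
    [IsLocalization.AtPrime S (Ideal.span {X 0, X 1, X 2} : Ideal (MvPolynomial (Fin 3) k))]
    (I : Ideal S) (hI : I = (Ideal.span {(X 0) ^ 2 - (X 1) ^ 5,
        (X 0) * (X 1) ^ 2 + (X 1) * (X 2) ^ 3 - (X 2) ^ 5}).map
          (algebraMap (MvPolynomial (Fin 3) k) S)) :
    Nontrivial (S ⧸ I) ∧ ∀ [IsLocalRing (S ⧸ I)] (y' : S ⧸ I),
      y' = Ideal.Quotient.mk I (algebraMap (MvPolynomial (Fin 3) k) S (X 1)) →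
    ((Ideal.span {y'} * maximalIdeal (S ⧸ I) ^ 5).colon (maximalIdeal (S ⧸ I)) ≤ Ideal.span {y'} ∧
      ¬ (Ideal.span {y'} * maximalIdeal (S ⧸ I) ^ 4).colon (maximalIdeal (S ⧸ I)) ≤
        Ideal.span {y'} ∧
      ringIndex (S ⧸ I) = 5) := by
  obtain ⟨A, D, _, _, _, _, _, _, _, i, t, x, z, l, ht, hx, hz, hl, hl1, hlift, hext⟩ := modelD k
  obtain ⟨φ, hφ⟩ := exists_phi k hP S I hI D i x (algebraMap A D t) z
    (fun M hM => mem_of_maximal t ht.not_isUnit x z hx hz M) hx hz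
  have hnt : Nontrivial D := by
    refine ⟨x * z ^ 4, 0, fun h => ?_⟩
    rw [h, map_zero] at hl1
    exact zero_ne_one hl1
  refine ⟨φ.domain_nontrivial, ?_⟩
  intro _ y' hy'
  let q : MvPolynomial (Fin 3) k →+* S ⧸ I := (Ideal.Quotient.mk I).comp (algebraMap _ S)
  have hq : ∀ p, φ (q p) = eval₂Hom i ![x, algebraMap A D t, z] p := hφ
  have hqy : q (X 1) = y' := hy'.symm
  have hm : maximalIdeal (S ⧸ I) = Ideal.span {q (X 0), y', q (X 2)} := by
    have hloc : IsLocalRing S := IsLocalization.AtPrime.isLocalRing S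
      (Ideal.span {X 0, X 1, X 2} : Ideal (MvPolynomial (Fin 3) k))
    have h1 : ((maximalIdeal (S ⧸ I)).comap (Ideal.Quotient.mk I)).IsMaximal :=
      Ideal.comap_isMaximal_of_surjective _ Ideal.Quotient.mk_surjective
    have h2 := IsLocalRing.eq_maximalIdeal h1
    have h3 := Ideal.map_comap_of_surjective _ (Ideal.Quotient.mk_surjective (I := I))
      (maximalIdeal (S ⧸ I))
    rw [h2, ← IsLocalization.AtPrime.map_eq_maximalIdeal
      (Ideal.span {X 0, X 1, X 2} : Ideal (MvPolynomial (Fin 3) k)) S, Ideal.map_map,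
      Ideal.map_span] at h3
    rw [← h3, ← hqy]
    simp only [Set.image_insert_eq, Set.image_singleton]
    rfl
  have hrel : ∀ p ∈ (Ideal.span {(X 0) ^ 2 - (X 1) ^ 5,
        (X 0) * (X 1) ^ 2 + (X 1) * (X 2) ^ 3 - (X 2) ^ 5} : Ideal (MvPolynomial (Fin 3) k)),
        q p = 0 := by
    intro p hp
    exact Ideal.Quotient.eq_zero_iff_mem.mpr (hI ▸ Ideal.mem_map_of_mem _ hp)
  have hr1 := hrel _ (Ideal.subset_span (Set.mem_insert _ _))
  have hr2 := hrel _ (Ideal.subset_span (Set.mem_insert_of_mem _ rfl))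
  simp only [map_sub, map_add, map_mul, map_pow, hqy] at hr1 hr2
  obtain ⟨ψ, hψi, hψx, hψy, hψz⟩ := hlift (S ⧸ I) (q.comp C) (q (X 0)) y' (q (X 2))
    (hm ▸ Ideal.subset_span (by simp)) (sub_eq_zero.mp hr1) hr2
  have hψi' : ∀ a, ψ (i a) = q (C a) := fun a => RingHom.congr_fun hψi a
  have h1 : φ.comp ψ = RingHom.id D := by
    refine hext D _ _ ?_ ?_ ?_ ?_
    · ext a
      simp [hψi', hq]
    · simp [hψx, hq]
    · simp [hψy, ← hqy, hq]
    · simp [hψz, hq]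
  have h2 : ψ.comp φ = RingHom.id (S ⧸ I) := by
    refine Ideal.Quotient.ringHom_ext ?_
    refine IsLocalization.ringHom_ext
      (Ideal.span {X 0, X 1, X 2} : Ideal (MvPolynomial (Fin 3) k)).primeCompl ?_
    refine MvPolynomial.ringHom_ext ?_ ?_
    · intro a
      change ψ (φ (q (C a))) = q (C a)
      rw [hq]
      simp [hψi']
    · intro j
      change ψ (φ (q (X j))) = q (X j)
      rw [hq]
      fin_cases j <;> simp [hψx, hψy, hψz, hqy]
  exact main_transfer (RingEquiv.ofRingHom ψ φ h2 h1) t ht x z l hx hz hl hl1 (q (X 0)) y' (q (X 2))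
    hψx hψy hψz hm

end final

end IdxFive

open MvPolynomial

set_option synthInstance.maxHeartbeats 1000000
set_option maxHeartbeats 2000000

/-- For the ring `R = (k[x,y,z]/(x² − y⁵, xy² + yz³ − z⁵))` localized at
`(x,y,z)`, one has `y m⁵ : m ⊆ yR` and `y m⁴ : m ⊄ yR`; consequently `index(R) = 5`
(here `x = X 0`, `y = X 1`, `z = X 2`). -/
theorem index_eq_five (k : Type*) [Field k] :
    ∃ hP : (Ideal.span {X 0, X 1, X 2} : Ideal (MvPolynomial (Fin 3) k)).IsPrime,
      letI := hP
      let T := MvPolynomial (Fin 3) k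
      let S := Localization.AtPrime (Ideal.span {X 0, X 1, X 2} : Ideal T)
      let I : Ideal S := (Ideal.span {(X 0) ^ 2 - (X 1) ^ 5,
        (X 0) * (X 1) ^ 2 + (X 1) * (X 2) ^ 3 - (X 2) ^ 5}).map (algebraMap T S)
      let R := S ⧸ I
      ∃ hnt : Nontrivial R,
        letI := hnt
        letI : IsLocalRing R :=
          IsLocalRing.of_surjective' (Ideal.Quotient.mk I) Ideal.Quotient.mk_surjective
        let y : R := Ideal.Quotient.mk I (algebraMap T S (X 1))
        let m := IsLocalRing.maximalIdeal R
        (Ideal.span {y} * m ^ 5).colon m ≤ Ideal.span {y} ∧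
          ¬ (Ideal.span {y} * m ^ 4).colon m ≤ Ideal.span {y} ∧
          ringIndex R = 5 := by
  refine ⟨IdxFive.prime_span k, ?_⟩
  letI := IdxFive.prime_span k
  have h := IdxFive.main_S k (IdxFive.prime_span k)
    (Localization.AtPrime (Ideal.span {X 0, X 1, X 2} : Ideal (MvPolynomial (Fin 3) k))) _ rfl
  refine ⟨h.1, ?_⟩
  letI := h.1
  letI : IsLocalRing (Localization.AtPrime (Ideal.span {X 0, X 1, X 2} :
      Ideal (MvPolynomial (Fin 3) k)) ⧸ ((Ideal.span {(X 0) ^ 2 - (X 1) ^ 5,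
        (X 0) * (X 1) ^ 2 + (X 1) * (X 2) ^ 3 - (X 2) ^ 5}).map
          (algebraMap (MvPolynomial (Fin 3) k) _))) :=
    IsLocalRing.of_surjective' (Ideal.Quotient.mk _) Ideal.Quotient.mk_surjective
  exact h.2 _ rfl
end

section
/- Let k be a field and R = (k[x,y,z]/(x^2 − y^5, x y^2 + y z^3 − z^5)) localized at (x,y,z), with maximal ideal m. Then for every nonzero f ∈ m, m^5 ⊄ fR. Hence gℓℓ(R) = 6 while index(R) = 5, so index(R) ≠ gℓℓ(R). -/
open IsLocalRing

universe u v

/-- Data: `R` is free over `V` with basis `x^i z^j`. -/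
structure DD (V : Type*) (R : Type*) [CommRing V] [CommRing R] [Algebra V R] where
  x : R
  z : R
  p : V
  b : Module.Basis (Fin 2 × Fin 5) V R
  hb : ∀ i j, b (i, j) = x ^ (i : ℕ) * z ^ (j : ℕ)
  h1 : x ^ 2 = (algebraMap V R p) ^ 5
  h2 : z ^ 5 = (algebraMap V R p) * z ^ 3 + x * (algebraMap V R p) ^ 2

namespace DD

variable {V : Type*} {R : Type*} [CommRing V] [CommRing R] [Algebra V R] (D : DD V R)

def y : R := algebraMap V R D.p

theorem h1' : D.x ^ 2 = D.y ^ 5 := D.h1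
theorem h2' : D.z ^ 5 = D.y * D.z ^ 3 + D.x * D.y ^ 2 := D.h2

/-- The element with given coordinates. -/
def E (c d : Fin 5 → V) : R :=
  (algebraMap V R (c 0) + algebraMap V R (c 1) * D.z + algebraMap V R (c 2) * D.z ^ 2 +
    algebraMap V R (c 3) * D.z ^ 3 + algebraMap V R (c 4) * D.z ^ 4) +
  D.x * (algebraMap V R (d 0) + algebraMap V R (d 1) * D.z + algebraMap V R (d 2) * D.z ^ 2 +
    algebraMap V R (d 3) * D.z ^ 3 + algebraMap V R (d 4) * D.z ^ 4)

theorem E_eq_sum (c d : Fin 5 → V) :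
    D.E c d = ∑ ij : Fin 2 × Fin 5, (if ij.1 = 0 then c ij.2 else d ij.2) • D.b ij := by
  rw [Fintype.sum_prod_type]
  simp only [Fin.sum_univ_two, Fin.sum_univ_five, D.hb, Algebra.smul_def, E]
  simp
  ring

theorem exists_E (r : R) : ∃ c d, r = D.E c d := by
  refine ⟨fun j => D.b.repr r (0, j), fun j => D.b.repr r (1, j), ?_⟩
  rw [E_eq_sum]
  conv_lhs => rw [← D.b.sum_repr r]
  refine Finset.sum_congr rfl ?_
  rintro ⟨i, j⟩ -
  fin_cases i <;> simp

theorem repr_E (c d : Fin 5 → V) (i : Fin 2) (j : Fin 5) :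
    D.b.repr (D.E c d) (i, j) = if i = 0 then c j else d j := by
  rw [E_eq_sum, D.b.repr_sum_self]

theorem E_inj {c d c' d' : Fin 5 → V} (h : D.E c d = D.E c' d') : c = c' ∧ d = d' := by
  constructor
  · ext j
    have := congrArg (fun r => D.b.repr r (0, j)) h
    simpa [repr_E] using this
  · ext j
    have := congrArg (fun r => D.b.repr r (1, j)) h
    simpa [repr_E] using this

theorem E_smul (v : V) (c d : Fin 5 → V) : algebraMap V R v * D.E c d =
    D.E (fun j => v * c j) (fun j => v * d j) := by
  simp only [E, map_mul]; ring

theorem z_mul_E (c d : Fin 5 → V) : D.z * D.E c d =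
    D.E ![D.p ^ 7 * d 4, c 0, c 1, c 2 + D.p * c 4, c 3]
      ![D.p ^ 2 * c 4, d 0, d 1, d 2 + D.p * d 4, d 3] := by
  simp [E]
  linear_combination (algebraMap V R (c 4) + D.x * algebraMap V R (d 4)) * D.h2 +
    algebraMap V R (d 4) * (algebraMap V R D.p) ^ 2 * D.h1

theorem x_mul_E (c d : Fin 5 → V) : D.x * D.E c d =
    D.E (fun j => D.p ^ 5 * d j) c := by
  simp only [E, map_mul, map_pow]
  linear_combination (algebraMap V R (d 0) + algebraMap V R (d 1) * D.z +
    algebraMap V R (d 2) * D.z ^ 2 +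
    algebraMap V R (d 3) * D.z ^ 3 + algebraMap V R (d 4) * D.z ^ 4) * D.h1

/-- The trace-like functional. -/
noncomputable def tau : R →ₗ[V] V := D.b.coord (1, 4)

theorem tau_E (c d : Fin 5 → V) : D.tau (D.E c d) = d 4 := by
  simp [tau, repr_E]

theorem tau_table (c d : Fin 5 → V) :
    D.tau (D.E c d) = d 4 ∧ D.tau (D.z * D.E c d) = d 3 ∧
    D.tau (D.z ^ 2 * D.E c d) = d 2 + D.p * d 4 ∧ D.tau (D.z ^ 3 * D.E c d) = d 1 + D.p * d 3 ∧
    D.tau (D.z ^ 4 * D.E c d) = d 0 + D.p * (d 2 + D.p * d 4) := by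
  refine ⟨D.tau_E _ _, ?_, ?_, ?_, ?_⟩
  · rw [z_mul_E, tau_E]; rfl
  · rw [pow_two, mul_assoc, z_mul_E, z_mul_E, tau_E]; rfl
  · rw [pow_succ, pow_two, mul_assoc, mul_assoc, z_mul_E, z_mul_E, z_mul_E, tau_E]; rfl
  · rw [pow_succ, pow_succ, pow_two, mul_assoc, mul_assoc, mul_assoc,
      z_mul_E, z_mul_E, z_mul_E, z_mul_E, tau_E]; rfl

theorem dvd_of_tau (t : V) (a : R) (h : ∀ r, t ∣ D.tau (r * a)) :
    algebraMap V R t ∣ a := by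
  obtain ⟨c, d, rfl⟩ := D.exists_E a
  have key : ∀ c d : Fin 5 → V, (∀ r, t ∣ D.tau (r * D.E c d)) → ∀ j, t ∣ d j := by
    intro c d h
    obtain ⟨e0, e1, e2, e3, e4⟩ := D.tau_table c d
    have h0 := h 1
    have h1 := h D.z
    have h2 := h (D.z ^ 2)
    have h3 := h (D.z ^ 3)
    have h4 := h (D.z ^ 4)
    rw [one_mul, e0] at h0
    rw [e1] at h1
    rw [e2] at h2
    rw [e3] at h3
    rw [e4] at h4
    have h2' := (dvd_add_left (h0.mul_left D.p)).1 h2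
    have h3' := (dvd_add_left (h1.mul_left D.p)).1 h3
    have h4' := (dvd_add_left (h2.mul_left D.p)).1 h4
    intro j
    fin_cases j <;> assumption
  have hd := key c d h
  have hc := key (fun j => D.p ^ 5 * d j) c (fun r => by
    rw [← x_mul_E, ← mul_assoc]; exact h _)
  choose c' hc' using hc
  choose d' hd' using hd
  refine ⟨D.E c' d', ?_⟩
  rw [E_smul]
  congr 1
  · ext j; exact hc' j
  · ext j; exact hd' j

theorem eq_of_tau (a a' : R) (h : ∀ r, D.tau (r * a) = D.tau (r * a')) : a = a' := by
  have := D.dvd_of_tau 0 (a - a') (fun r => by rw [mul_sub, map_sub, h, sub_self])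
  rw [map_zero, zero_dvd_iff] at this
  exact sub_eq_zero.1 this

theorem exists_tau (H : R →ₗ[V] V) : ∃ a, ∀ r, D.tau (r * a) = H r := by
  set al : Fin 5 → V := fun j => H (D.z ^ (j : ℕ)) with hal
  set be : Fin 5 → V := fun j => H (D.x * D.z ^ (j : ℕ)) with hbe
  let F : (Fin 5 → V) → (Fin 5 → V) := fun al =>
    ![al 4 - D.p * al 2, al 3 - D.p * al 1, al 2 - D.p * al 0, al 1, al 0]
  refine ⟨D.E (F be) (F al), ?_⟩
  intro r
  have : D.tau ∘ₗ LinearMap.mulRight V (D.E (F be) (F al)) = H := by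
    refine D.b.ext ?_
    rintro ⟨i, j⟩
    rw [D.hb]
    simp only [LinearMap.comp_apply, LinearMap.mulRight_apply]
    have e := D.tau_table (F be) (F al)
    have f := D.tau_table (fun j => D.p ^ 5 * F al j) (F be)
    rw [← x_mul_E] at f
    generalize D.E (F be) (F al) = A at e f ⊢
    obtain ⟨e0, e1, e2, e3, e4⟩ := e
    obtain ⟨f0, f1, f2, f3, f4⟩ := f
    have hF : ∀ a : Fin 5 → V, F a 4 = a 0 ∧ F a 3 = a 1 ∧ F a 2 + D.p * F a 4 = a 2 ∧
        F a 1 + D.p * F a 3 = a 3 ∧ F a 0 + D.p * (F a 2 + D.p * F a 4) = a 4 := by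
      intro a
      refine ⟨rfl, rfl, ?_, ?_, ?_⟩ <;> simp [F]
    obtain ⟨u0, u1, u2, u3, u4⟩ := hF al
    obtain ⟨v0, v1, v2, v3, v4⟩ := hF be
    have ea : ∀ j : Fin 5, D.tau (D.z ^ (j : ℕ) * A) = al j := by
      intro j
      fin_cases j
      · exact (congrArg D.tau (by simp)).trans (e0.trans u0)
      · exact (congrArg D.tau (by simp)).trans (e1.trans u1)
      · exact e2.trans u2
      · exact e3.trans u3
      · exact e4.trans u4
    have eb : ∀ j : Fin 5, D.tau (D.z ^ (j : ℕ) * (D.x * A)) = be j := by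
      intro j
      fin_cases j
      · exact (congrArg D.tau (by simp)).trans (f0.trans v0)
      · exact (congrArg D.tau (by simp)).trans (f1.trans v1)
      · exact f2.trans v2
      · exact f3.trans v3
      · exact f4.trans v4
    have hi : i = 0 ∨ i = 1 := by omega
    rcases hi with h | h <;> subst h
    · have : D.x ^ ((0 : Fin 2) : ℕ) * D.z ^ (j : ℕ) = D.z ^ (j : ℕ) := by simp
      rw [this]; exact ea j
    · have : D.x ^ ((1 : Fin 2) : ℕ) * D.z ^ (j : ℕ) = D.x * D.z ^ (j : ℕ) := by simp
      rw [this, mul_comm D.x, mul_assoc, eb j, mul_comm]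
  rw [← this]; rfl

theorem exists_hom {X : Type*} [AddCommGroup X] [Module R X] [Module V X] [IsScalarTower V R X]
    (H : X →ₗ[V] V) : ∃ h : X →ₗ[R] R, ∀ m r, D.tau (r * h m) = H (r • m) := by
  have : ∀ m : X, ∃ a, ∀ r, D.tau (r * a) = H (r • m) := fun m =>
    D.exists_tau (H ∘ₗ ((LinearMap.toSpanSingleton R X m).restrictScalars V))
  choose h hh using this
  refine ⟨{ toFun := h, map_add' := ?_, map_smul' := ?_ }, hh⟩
  · intro m n
    refine D.eq_of_tau _ _ fun r => ?_
    rw [mul_add, map_add, hh, hh, hh, smul_add, map_add]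
  · intro s m
    refine D.eq_of_tau _ _ fun r => ?_
    rw [hh, smul_eq_mul, ← mul_assoc, RingHom.id_apply, hh, mul_smul]

theorem y_pow_cancel [IsDomain V] (hp : D.p ≠ 0) (n : ℕ) {a c : R}
    (h : D.y ^ n * a = D.y ^ n * c) : a = c := by
  have hf : Module.Free V R := Module.Free.of_basis D.b
  have : IsSMulRegular R (D.p ^ n) :=
    IsSMulRegular.of_ne_zero (pow_ne_zero n hp)
  apply this
  simpa [Algebra.smul_def, y] using h

end DD

theorem span_three_pow_le {R : Type*} [CommRing R] (x y z : R) (Q : Ideal R) (n : ℕ)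
    (h : ∀ a b c : ℕ, a + b + c = n → x ^ a * y ^ b * z ^ c ∈ Q) :
    (Ideal.span {x, y, z}) ^ n ≤ Q := by
  have key : ∀ n : ℕ, (Ideal.span {x, y, z}) ^ n ≤
      Ideal.span {r | ∃ a b c : ℕ, a + b + c = n ∧ r = x ^ a * y ^ b * z ^ c} := by
    intro n
    induction n with
    | zero =>
      rw [pow_zero, Ideal.one_eq_top, top_le_iff, Ideal.eq_top_iff_one]
      exact Ideal.subset_span ⟨0, 0, 0, rfl, by simp⟩
    | succ n ih =>
      rw [pow_succ]
      refine (Ideal.mul_mono_left ih).trans ?_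
      rw [Ideal.span_mul_span', Ideal.span_le]
      rintro _ ⟨_, ⟨a, b, c, hn, rfl⟩, s, hs, rfl⟩
      apply Ideal.subset_span
      rcases hs with rfl | rfl | rfl
      · exact ⟨a + 1, b, c, by omega, by simp only []; ring⟩
      · exact ⟨a, b + 1, c, by omega, by simp only []; ring⟩
      · exact ⟨a, b, c + 1, by omega, by simp only []; ring⟩
  refine (key n).trans (Ideal.span_le.2 ?_)
  rintro _ ⟨a, b, c, hn, rfl⟩
  exact h a b c hn

namespace DD

section Rel
variable {V : Type*} {R : Type*} [CommRing V] [CommRing R] [Algebra V R] (D : DD V R)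

theorem m5_a {r : R} (hr : r ∈ (Ideal.span {D.x, D.y, D.z}) ^ 5) :
    D.y ^ 2 ∣ (D.y - D.z ^ 2) * r := by
  let Q : Ideal R := Submodule.comap (LinearMap.mulLeft R (D.y - D.z ^ 2)) (Ideal.span {D.y ^ 2})
  have : (Ideal.span {D.x, D.y, D.z}) ^ 5 ≤ Q := by
    refine span_three_pow_le _ _ _ _ _ fun a b c h => ?_
    change (D.y - D.z ^ 2) * (D.x ^ a * D.y ^ b * D.z ^ c) ∈ Ideal.span {D.y ^ 2}
    rw [Ideal.mem_span_singleton]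
    by_cases hb : 2 ≤ b
    · obtain ⟨b, rfl⟩ := Nat.exists_eq_add_of_le hb
      exact ⟨(D.y - D.z ^ 2) * D.x ^ a * D.y ^ b * D.z ^ c, by ring⟩
    by_cases ha : 2 ≤ a
    · obtain ⟨a, rfl⟩ := Nat.exists_eq_add_of_le ha
      refine ⟨D.y ^ 3 * (D.y - D.z ^ 2) * D.x ^ a * D.y ^ b * D.z ^ c, ?_⟩
      rw [pow_add, D.h1']; ring
    have hc : 3 ≤ c := by omega
    obtain ⟨c, rfl⟩ := Nat.exists_eq_add_of_le hc
    refine ⟨- D.x * D.x ^ a * D.y ^ b * D.z ^ c, ?_⟩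
    linear_combination (-D.x ^ a * D.y ^ b * D.z ^ c) * D.h2'
  exact Ideal.mem_span_singleton.1 (this hr)

theorem m5_b {r : R} (hr : r ∈ (Ideal.span {D.x, D.y, D.z}) ^ 5) : D.y ∣ D.z * r := by
  let Q : Ideal R := Submodule.comap (LinearMap.mulLeft R (D.z)) (Ideal.span {D.y})
  have : (Ideal.span {D.x, D.y, D.z}) ^ 5 ≤ Q := by
    refine span_three_pow_le _ _ _ _ _ fun a b c h => ?_
    change D.z * (D.x ^ a * D.y ^ b * D.z ^ c) ∈ Ideal.span {D.y}
    rw [Ideal.mem_span_singleton]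
    by_cases hb : 1 ≤ b
    · obtain ⟨b, rfl⟩ := Nat.exists_eq_add_of_le hb
      exact ⟨D.z * D.x ^ a * D.y ^ b * D.z ^ c, by ring⟩
    by_cases ha : 2 ≤ a
    · obtain ⟨a, rfl⟩ := Nat.exists_eq_add_of_le ha
      refine ⟨D.y ^ 4 * D.z * D.x ^ a * D.y ^ b * D.z ^ c, ?_⟩
      rw [pow_add, D.h1']; ring
    have hc : 4 ≤ c := by omega
    obtain ⟨c, rfl⟩ := Nat.exists_eq_add_of_le hc
    refine ⟨(D.z ^ 3 + D.x * D.y) * D.x ^ a * D.y ^ b * D.z ^ c, ?_⟩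
    linear_combination (D.x ^ a * D.y ^ b * D.z ^ c) * D.h2'
  exact Ideal.mem_span_singleton.1 (this hr)

theorem m6_y : (Ideal.span {D.x, D.y, D.z}) ^ 6 ≤ Ideal.span {D.y} := by
  refine span_three_pow_le _ _ _ _ _ fun a b c h => ?_
  rw [Ideal.mem_span_singleton]
  by_cases hb : 1 ≤ b
  · obtain ⟨b, rfl⟩ := Nat.exists_eq_add_of_le hb
    exact ⟨D.x ^ a * D.y ^ b * D.z ^ c, by ring⟩
  by_cases ha : 2 ≤ a
  · obtain ⟨a, rfl⟩ := Nat.exists_eq_add_of_le ha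
    refine ⟨D.y ^ 4 * D.x ^ a * D.y ^ b * D.z ^ c, ?_⟩
    rw [pow_add, D.h1']; ring
  have hc : 5 ≤ c := by omega
  obtain ⟨c, rfl⟩ := Nat.exists_eq_add_of_le hc
  refine ⟨(D.z ^ 3 + D.x * D.y) * D.x ^ a * D.y ^ b * D.z ^ c, ?_⟩
  linear_combination (D.x ^ a * D.y ^ b * D.z ^ c) * D.h2'

theorem m6_f (hu : IsUnit (1 - 3 * D.y + D.y ^ 2)) :
    (Ideal.span {D.x, D.y, D.z}) ^ 6 ≤ Ideal.span {D.z - D.y} := by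
  set Q := Ideal.span {D.z - D.y} with hQ
  let q := Ideal.Quotient.mk Q
  have hz : q D.z = q D.y := by
    rw [Ideal.Quotient.eq]; exact Ideal.subset_span rfl
  have r1 : q D.x ^ 2 = q D.y ^ 5 := by rw [← map_pow, D.h1', map_pow]
  have r2 : q D.x * q D.y ^ 2 = q D.y ^ 5 - q D.y ^ 4 := by
    have := congrArg q D.h2'
    simp only [map_pow, map_add, map_mul, hz] at this
    linear_combination -this
  have r3 : q D.y ^ 6 = 0 := by
    have hu' := hu.map q
    have : q (1 - 3 * D.y + D.y ^ 2) * q D.y ^ 6 = 0 := by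
      simp only [map_add, map_sub, map_one, map_mul, map_pow, map_ofNat]
      linear_combination (q D.x - q D.y ^ 2 + q D.y ^ 3) * (-r2) + (q D.y) ^ 2 * r1
    exact (hu'.mul_right_eq_zero).1 this
  refine span_three_pow_le _ _ _ _ _ fun a b c h => ?_
  rw [← Ideal.Quotient.eq_zero_iff_mem]
  change q _ = 0
  simp only [map_mul, map_pow, hz]
  rw [mul_assoc, ← pow_add]
  generalize hn : b + c = n
  have hy : ∀ n, 6 ≤ n → q D.y ^ n = 0 := fun n hn => by
    obtain ⟨k, rfl⟩ := Nat.exists_eq_add_of_le hn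
    rw [pow_add, r3, zero_mul]
  by_cases h0 : a = 0
  · rw [h0, hy n (by omega), mul_zero]
  by_cases h1 : a = 1
  · obtain rfl : n = 5 := by omega
    rw [h1]
    linear_combination q D.y ^ 3 * r2 + (q D.y ^ 2 - q D.y) * r3
  by_cases h6 : a = 6
  · rw [h6, show q D.x ^ 6 = (q D.x ^ 2) ^ 3 by ring, r1, ← pow_mul, hy _ (by norm_num), zero_mul]
  · obtain ⟨a, rfl⟩ := Nat.exists_eq_add_of_le (show 2 ≤ a by omega)
    obtain ⟨n, rfl⟩ := Nat.exists_eq_add_of_le (show 1 ≤ n by omega)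
    rw [pow_add, r1]
    linear_combination q D.x ^ a * q D.y ^ n * r3

variable [IsDomain V]

theorem z_not (hp0 : D.p ≠ 0) (hp : ¬ IsUnit D.p) : ¬ D.y ^ 5 ∣ D.z := by
  rintro ⟨s, hs⟩
  obtain ⟨c, d, rfl⟩ := D.exists_E s
  rw [y, ← map_pow, E_smul] at hs
  have : D.z = D.E ![0, 1, 0, 0, 0] ![0, 0, 0, 0, 0] := by simp [E]
  rw [this] at hs
  have := congrFun (D.E_inj hs).1 1
  simp only [Matrix.cons_val] at this
  exact hp (IsUnit.of_mul_eq_one (D.p ^ 4 * c 1) (by rw [this]; ring))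

theorem y5_eq : D.y ^ 5 = D.E ![D.p ^ 5, 0, 0, 0, 0] ![0, 0, 0, 0, 0] := by simp [E, y]

theorem y5_not (hp0 : D.p ≠ 0) (hp : ¬ IsUnit D.p) : ¬ D.z ∣ D.y ^ 5 := by
  rintro ⟨s, hs⟩
  obtain ⟨c, d, rfl⟩ := D.exists_E s
  rw [y5_eq, z_mul_E] at hs
  have := congrFun (D.E_inj hs).1 0
  simp only [Matrix.cons_val] at this
  have h : D.p ^ 5 * 1 = D.p ^ 5 * (D.p * (D.p * d 4)) := by linear_combination this
  have h := mul_left_cancel₀ (pow_ne_zero 5 hp0) h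
  exact hp (IsUnit.of_mul_eq_one _ h.symm)

theorem colon_le (hp0 : D.p ≠ 0) {r : R} (h : D.y ^ 5 ∣ D.z * r) :
    r ∈ (Ideal.span {D.x, D.y, D.z}) ^ 4 := by
  obtain ⟨s, hs⟩ := h
  obtain ⟨c, d, rfl⟩ := D.exists_E r
  obtain ⟨c', d', rfl⟩ := D.exists_E s
  rw [z_mul_E, y, ← map_pow, E_smul] at hs
  obtain ⟨h1, h2⟩ := D.E_inj hs
  have a1 := congrFun h1 1
  have a2 := congrFun h1 2
  have a3 := congrFun h1 3
  have a4 := congrFun h1 4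
  have b0 := congrFun h2 0
  have b1 := congrFun h2 1
  have b2 := congrFun h2 2
  have b3 := congrFun h2 3
  have b4 := congrFun h2 4
  simp only [Matrix.cons_val] at a1 a2 a3 a4 b0 b1 b2 b3 b4
  have b0' : c 4 = D.p ^ 3 * d' 0 :=
    mul_left_cancel₀ (pow_ne_zero 2 hp0) (by linear_combination b0)
  have c2 : c 2 = D.p ^ 5 * c' 3 - D.p * c 4 := by linear_combination a3
  have d2 : d 2 = D.p ^ 5 * d' 3 - D.p * d 4 := by linear_combination b3
  have hx : D.x ∈ Ideal.span {D.x, D.y, D.z} := Ideal.subset_span (by simp)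
  have hy : D.y ∈ Ideal.span {D.x, D.y, D.z} := Ideal.subset_span (by simp)
  have hz : D.z ∈ Ideal.span {D.x, D.y, D.z} := Ideal.subset_span (by simp)
  have y4 : D.y ^ 4 ∈ (Ideal.span {D.x, D.y, D.z}) ^ 4 := Ideal.pow_mem_pow hy 4
  have z4 : D.z ^ 4 ∈ (Ideal.span {D.x, D.y, D.z}) ^ 4 := Ideal.pow_mem_pow hz 4
  have xyz : D.x * D.y * D.z ^ 2 ∈ (Ideal.span {D.x, D.y, D.z}) ^ 4 := by
    have := Ideal.mul_mem_mul (Ideal.mul_mem_mul hx hy) (Ideal.pow_mem_pow hz 2)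
    rwa [← pow_two, ← pow_add] at this
  have : D.E c d = D.y ^ 4 * (D.y * D.E ![c' 1, c' 2, c' 3, c' 4, 0] ![d' 1, d' 2, d' 3, d' 4, 0]
      - algebraMap V R (d' 0) * D.z ^ 2) +
      D.z ^ 4 * (algebraMap V R (c 4) + D.x * algebraMap V R (d 4)) +
      (D.x * D.y * D.z ^ 2) * (- algebraMap V R (d 4)) := by
    simp only [E, a1, a2, a4, b1, b2, b4, c2, d2, b0', Matrix.cons_val, map_mul, map_sub, map_pow,
      map_zero, y]
    ring
  rw [this]
  exact add_mem (add_mem (Ideal.mul_mem_right _ _ y4) (Ideal.mul_mem_right _ _ z4))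
    (Ideal.mul_mem_right _ _ xyz)

end Rel

end DD

theorem lift_aux {V R X : Type*} [CommRing V] [CommRing R] [Algebra V R] [AddCommGroup X]
    [Module R X] [Module V X] [IsScalarTower V R X] [Module.Free V X] (J : Ideal R)
    (φ : X →ₗ[R] (R ⧸ J)) :
    ∃ ψ : X →ₗ[V] R, ∀ m, (Submodule.Quotient.mk (ψ m) : R ⧸ J) = φ m := by
  let b := Module.Free.chooseBasis V X
  have hex : ∀ q : R ⧸ J, ∃ r : R, (Submodule.Quotient.mk r : R ⧸ J) = q :=
    Submodule.Quotient.mk_surjective J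
  choose s hs using hex
  refine ⟨b.constr V (fun i => s (φ (b i))), fun m => ?_⟩
  have hm : m ∈ Submodule.span V (Set.range b) := b.mem_span m
  induction hm using Submodule.span_induction with
  | mem x hx =>
    obtain ⟨i, rfl⟩ := hx
    rw [Module.Basis.constr_basis, hs]
  | zero => rw [map_zero, map_zero, Submodule.Quotient.mk_zero]
  | add x y _ _ hx hy => rw [map_add, map_add, Submodule.Quotient.mk_add, hx, hy]
  | smul v x _ hx =>
    rw [map_smul, ← algebraMap_smul R v x, map_smul, ← hx, ← Submodule.Quotient.mk_smul,
      algebraMap_smul]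

namespace DD

section Loc
universe w
variable {V : Type w} {R : Type u} [CommRing V] [IsDomain V] [IsDiscreteValuationRing V]
  [CommRing R] [IsLocalRing R] [Algebra V R] (D : DD V R)

theorem y_mem (hm : maximalIdeal R = Ideal.span {D.x, D.y, D.z}) : D.y ∈ maximalIdeal R := by
  rw [hm]; exact Ideal.subset_span (by simp)

theorem z_mem (hm : maximalIdeal R = Ideal.span {D.x, D.y, D.z}) : D.z ∈ maximalIdeal R := by
  rw [hm]; exact Ideal.subset_span (by simp)

theorem krull [IsNoetherianRing R] (hp : Irreducible D.p)
    (hm : maximalIdeal R = Ideal.span {D.x, D.y, D.z}) : ringKrullDim R = 1 := by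
  have reg : IsSMulRegular R D.y := by
    intro a c h
    exact D.y_pow_cancel hp.ne_zero 1 (by simpa using h)
  have hj : D.y ∈ Ring.jacobson R := by
    rw [IsLocalRing.ringJacobson_eq_maximalIdeal]; exact D.y_mem hm
  rw [← ringKrullDim_quotient_span_singleton_succ_eq_ringKrullDim_of_mem_jacobson reg hj]
  have hne : Ideal.span {D.y} ≠ ⊤ := fun h => by
    have : Ideal.span {D.y} ≤ maximalIdeal R := by
      rw [Ideal.span_singleton_le_iff_mem]; exact D.y_mem hm
    rw [h] at this
    exact (maximalIdeal.isMaximal R).ne_top (top_le_iff.1 this)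
  have : Nontrivial (R ⧸ Ideal.span {D.y}) := Ideal.Quotient.nontrivial_iff.2 hne
  have h0 : Ring.KrullDimLE 0 (R ⧸ Ideal.span {D.y}) := by
    rw [Ring.krullDimLE_zero_iff]
    intro I hI
    have : I.comap (Ideal.Quotient.mk (Ideal.span {D.y})) = maximalIdeal R := by
      apply le_antisymm
      · exact IsLocalRing.le_maximalIdeal (Ideal.IsPrime.ne_top (hI.comap _))
      · have hP := hI.comap (Ideal.Quotient.mk (Ideal.span {D.y}))
        refine (hP.pow_le_iff (n := 6) (by norm_num)).1 ?_
        rw [hm]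
        refine D.m6_y.trans ?_
        rw [Ideal.span_singleton_le_iff_mem, Ideal.mem_comap]
        have : Ideal.Quotient.mk (Ideal.span {D.y}) D.y = 0 :=
          Ideal.Quotient.eq_zero_iff_mem.2 (Ideal.mem_span_singleton_self _)
        rw [this]; exact zero_mem _
    have hmax : (I.comap (Ideal.Quotient.mk (Ideal.span {D.y}))).IsMaximal := by
      rw [this]; infer_instance
    rw [← Ideal.map_comap_of_surjective _ Ideal.Quotient.mk_surjective I]
    exact (Ideal.map_eq_top_or_isMaximal_of_surjective _ Ideal.Quotient.mk_surjective hmax).resolve_left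
      (by rw [Ideal.map_comap_of_surjective _ Ideal.Quotient.mk_surjective I]; exact hI.ne_top)
  rw [ringKrullDimZero_iff_ringKrullDim_eq_zero.1 h0, zero_add]

theorem torsion_free (hp : Irreducible D.p)
    (hm : maximalIdeal R = Ideal.span {D.x, D.y, D.z}) (hd : ringKrullDim R = 1)
    {X : Type*} [AddCommGroup X] [Module R X] [Module V X] [IsScalarTower V R X]
    (hX : IsMCM R X) : Module.IsTorsionFree V X := by
  obtain ⟨rs, hrs, hreg, hlen⟩ := hX
  rw [hd] at hlen
  have hlen : rs.length = 1 := by exact_mod_cast hlen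
  obtain ⟨r, rfl⟩ := List.length_eq_one_iff.1 hlen
  have hr := hrs r (by simp)
  have hr' : IsSMulRegular X r :=
    (RingTheory.Sequence.isWeaklyRegular_singleton_iff X r).1 hreg.toIsWeaklyRegular
  have hy : ∀ m : X, D.y • m = 0 → m = 0 := by
    intro m h
    have h6 : r ^ 6 ∈ Ideal.span {D.y} := D.m6_y (hm ▸ Ideal.pow_mem_pow hr 6)
    obtain ⟨s, hs⟩ := Ideal.mem_span_singleton.1 h6
    have : IsSMulRegular X (r ^ 6) := hr'.pow 6
    apply this
    change r ^ 6 • m = r ^ 6 • (0 : X)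
    rw [smul_zero, hs, mul_comm, mul_smul, h, smul_zero]
  have hpm : ∀ n : ℕ, ∀ m : X, D.p ^ n • m = 0 → m = 0 := by
    intro n
    induction n with
    | zero => intro m h; simpa using h
    | succ n ih =>
      intro m h
      rw [pow_succ, mul_smul] at h
      have := ih _ h
      apply hy
      rw [y, algebraMap_smul]; exact this
  refine Module.isTorsionFree_iff_smul_eq_zero.2 ?_
  intro v m h
  by_cases hv : v = 0
  · exact Or.inl hv
  right
  obtain ⟨n, u, rfl⟩ := IsDiscreteValuationRing.eq_unit_mul_pow_irreducible hv hp
  rw [mul_smul] at h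
  apply hpm n
  have h' := congrArg (fun t => (↑u⁻¹ : V) • t) h
  simpa [smul_smul, ← mul_assoc] using h'

theorem exists_surj (hp : Irreducible D.p)
    (hm : maximalIdeal R = Ideal.span {D.x, D.y, D.z}) (hd : ringKrullDim R = 1)
    {X : Type*} [AddCommGroup X] [Module R X] [Module.Finite R X]
    (hX : IsMCM R X) (φ : X →ₗ[R] (R ⧸ maximalIdeal R ^ 5)) (hφ : Function.Surjective φ) :
    ∃ h : X →ₗ[R] R, Function.Surjective h := by
  letI : Module V X := Module.compHom X (algebraMap V R)
  haveI : IsScalarTower V R X := ⟨fun v r m => by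
    change (v • r) • m = algebraMap V R v • (r • m)
    rw [Algebra.smul_def, mul_smul]⟩
  haveI : Module.Finite V R := Module.Finite.of_basis D.b
  haveI : Module.Finite V X := Module.Finite.trans R X
  haveI : Module.IsTorsionFree V X := D.torsion_free hp hm hd hX
  haveI : Module.Free V X := inferInstance
  obtain ⟨ψ, hψ'⟩ := lift_aux (V := V) (maximalIdeal R ^ 5) φ
  have main : ∀ a : R, (∀ r ∈ maximalIdeal R ^ 5, D.y ^ 2 ∣ a * r) →
      ∃ h : X →ₗ[R] R, ∀ m, D.y ^ 2 ∣ h m - a * ψ m := by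
    intro a ha
    obtain ⟨h, hh⟩ := D.exists_hom (X := X) (D.tau ∘ₗ LinearMap.mulLeft V a ∘ₗ ψ)
    refine ⟨h, fun m => ?_⟩
    have := D.dvd_of_tau (D.p ^ 2) (h m - a * ψ m) ?_
    · simpa [y] using this
    intro r
    have hmem : ψ (r • m) - r * ψ m ∈ maximalIdeal R ^ 5 := by
      have : (Submodule.Quotient.mk (ψ (r • m)) : R ⧸ maximalIdeal R ^ 5) =
          Submodule.Quotient.mk (r • ψ m) := by
        rw [Submodule.Quotient.mk_smul, hψ', hψ', map_smul]
      exact (Submodule.Quotient.eq _).1 this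
    obtain ⟨s, hs⟩ := ha _ hmem
    have e : D.tau (r * (h m - a * ψ m)) = D.p ^ 2 * D.tau s := by
      rw [mul_sub, map_sub, hh]
      change D.tau (a * ψ (r • m)) - _ = _
      rw [← map_sub, ← smul_eq_mul (D.p ^ 2), ← map_smul]
      congr 1
      rw [Algebra.smul_def, map_pow]
      change _ = D.y ^ 2 * s
      rw [← hs]; ring
    exact ⟨_, e⟩
  obtain ⟨f1, hf1⟩ := main (D.y - D.z ^ 2) (fun r hr => D.m5_a (hm ▸ hr))
  obtain ⟨f2, hf2⟩ := main (D.y * D.z) (fun r hr => by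
    obtain ⟨s, hs⟩ := D.m5_b (hm ▸ hr)
    exact ⟨s, by rw [mul_assoc, hs]; ring⟩)
  choose s1 hs1 using hf1
  choose s2 hs2 using hf2
  let g : X → R := fun m => ψ m + D.y * s1 m + D.z * s2 m
  have hg : ∀ m, D.y ^ 2 * g m = (D.y • f1 + D.z • f2) m := by
    intro m
    simp only [LinearMap.add_apply, LinearMap.smul_apply, smul_eq_mul, g]
    linear_combination -D.y * hs1 m - D.z * hs2 m
  let gl : X →ₗ[R] R :=
    { toFun := g
      map_add' := fun m n => D.y_pow_cancel hp.ne_zero 2 (by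
        rw [hg (m + n), map_add, ← hg m, ← hg n]; ring)
      map_smul' := fun r m => D.y_pow_cancel hp.ne_zero 2 (by
        rw [hg (r • m), map_smul, ← hg m, RingHom.id_apply, smul_eq_mul, smul_eq_mul]; ring) }
  obtain ⟨e, he⟩ := hφ (Submodule.Quotient.mk 1)
  have hu : IsUnit (gl e) := by
    have h1 : ψ e - 1 ∈ maximalIdeal R := by
      have : ψ e - 1 ∈ maximalIdeal R ^ 5 := by
        rw [← Submodule.Quotient.eq, hψ', he]
      exact Ideal.pow_le_self (by norm_num) this
    by_contra hnu
    have h2 : g e ∈ maximalIdeal R := (IsLocalRing.mem_maximalIdeal _).2 hnu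
    have h3 : (1 : R) ∈ maximalIdeal R := by
      have : (1 : R) = g e - (ψ e - 1) - s1 e * D.y - s2 e * D.z := by simp only [g]; ring
      rw [this]
      exact sub_mem (sub_mem (sub_mem h2 h1) (Ideal.mul_mem_left _ _ (D.y_mem hm)))
        (Ideal.mul_mem_left _ _ (D.z_mem hm))
    exact (Ideal.ne_top_iff_one _).1 (maximalIdeal.isMaximal R).ne_top h3
  refine ⟨gl, fun r => ?_⟩
  obtain ⟨u, hu⟩ := hu
  refine ⟨(r * (↑u⁻¹ : R)) • e, ?_⟩
  rw [map_smul, ← hu, smul_eq_mul, mul_assoc, Units.inv_mul, mul_one]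

theorem mcm_of_regular {X : Type*} [AddCommGroup X] [Module R X] [Module.Finite R X] [Nontrivial X]
    (hm : maximalIdeal R = Ideal.span {D.x, D.y, D.z}) (hd : ringKrullDim R = 1)
    (h : IsSMulRegular X D.y) : IsMCM R X := by
  refine ⟨[D.y], by simpa using D.y_mem hm, ?_, by simp [hd]⟩
  exact RingTheory.Sequence.IsRegular.of_isWeaklyRegular_of_mem_maximalIdeal X
    (by simpa using D.y_mem hm)
    ((RingTheory.Sequence.isWeaklyRegular_singleton_iff X _).2 h)

end Loc

end DD

theorem freeRank_bdd {R : Type u} [CommRing R] [Nontrivial R] {X : Type v} [AddCommGroup X]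
    [Module R X] (N : ℕ) (q : (Fin N → R) →ₗ[R] X) (hq : Function.Surjective q) :
    ∀ n ∈ {n : ℕ | ∃ (f : X →ₗ[R] (Fin n → R)) (g : (Fin n → R) →ₗ[R] X),
    f ∘ₗ g = LinearMap.id}, n ≤ N := by
  rintro n ⟨f, g, h⟩
  have hf : Function.Surjective f := fun t => ⟨g t, congrArg (fun l => l t) h⟩
  exact le_of_fin_surjective R (f ∘ₗ q) (hf.comp hq)

theorem freeRank_ne_zero {R : Type u} [CommRing R] [Nontrivial R] {X : Type v} [AddCommGroup X]
    [Module R X] [Module.Finite R X] (h : X →ₗ[R] R) (hh : Function.Surjective h) :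
    freeRank R X ≠ 0 := by
  obtain ⟨N, q, hq⟩ := Module.Finite.exists_fin' R X
  have hb := freeRank_bdd N q hq
  have : 1 ≤ freeRank R X := by
    refine le_csSup ⟨N, hb⟩ ?_
    obtain ⟨e, he⟩ := hh 1
    refine ⟨LinearMap.pi fun _ => h, (LinearMap.toSpanSingleton R X e) ∘ₗ LinearMap.proj 0, ?_⟩
    refine LinearMap.ext fun t => ?_
    ext i
    simp [he, Subsingleton.elim i 0]
  omega

theorem freeRank_self (R : Type u) [CommRing R] [Nontrivial R] : freeRank R R = 1 := by
  apply le_antisymm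
  · refine csSup_le ⟨0, 0, 0, by ext i; exact i.elim0⟩ ?_
    exact freeRank_bdd 1 (LinearMap.proj 0) (fun r => ⟨fun _ => r, rfl⟩)
  · have := freeRank_ne_zero (LinearMap.id : R →ₗ[R] R) Function.surjective_id
    omega

theorem freeRank_eq_zero {R : Type u} [CommRing R] [Nontrivial R] {X : Type v} [AddCommGroup X]
    [Module R X] (h : ∀ h : X →ₗ[R] R, ¬ Function.Surjective h) : freeRank R X = 0 := by
  rw [freeRank, ← Nat.le_zero]
  refine csSup_le ⟨0, 0, 0, by ext i; exact i.elim0⟩ ?_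
  rintro n ⟨f, g, hfg⟩
  by_contra hn
  have hn : 0 < n := by omega
  refine h (LinearMap.proj ⟨0, hn⟩ ∘ₗ f) (fun r => ⟨g (fun _ => r), ?_⟩)
  have := congrArg (fun l => l (fun _ => r) ⟨0, hn⟩) hfg
  simpa using this

namespace DD

section Inv
universe w
variable {V : Type w} {R : Type u} [CommRing V] [IsDomain V] [IsDiscreteValuationRing V]
  [CommRing R] [IsLocalRing R] [Algebra V R] (D : DD V R)

theorem delta_small (hp : Irreducible D.p)
    (hm : maximalIdeal R = Ideal.span {D.x, D.y, D.z}) (hd : ringKrullDim R = 1)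
    (J : Ideal R) (hJ : maximalIdeal R ^ 4 ≤ J) :
    auslanderDelta R (R ⧸ J) = 0 := by
  let g : (R × R) →ₗ[R] R :=
    (LinearMap.toSpanSingleton R R (D.y ^ 5)).coprod (LinearMap.toSpanSingleton R R D.z)
  have hg : ∀ a b : R, g (a, b) = a * D.y ^ 5 + b * D.z := fun a b => by simp [g]
  let X := (R × R) ⧸ LinearMap.ker g
  let φ : X →ₗ[R] (R ⧸ J) := (LinearMap.ker g).liftQ (Submodule.mkQ J ∘ₗ LinearMap.snd R R R) (by
    rintro ⟨a, b⟩ hab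
    rw [LinearMap.mem_ker, hg] at hab
    rw [LinearMap.mem_ker]
    change Submodule.mkQ J b = 0
    rw [Submodule.mkQ_apply, Submodule.Quotient.mk_eq_zero]
    apply hJ
    rw [hm]
    apply D.colon_le hp.ne_zero
    exact ⟨-a, by linear_combination hab⟩)
  have hφ : Function.Surjective φ := by
    intro q
    obtain ⟨r, rfl⟩ := Submodule.Quotient.mk_surjective J q
    exact ⟨Submodule.Quotient.mk (0, r), rfl⟩
  let ι : X →ₗ[R] R := (LinearMap.ker g).liftQ g le_rfl
  have hι : Function.Injective ι := by
    rw [← LinearMap.ker_eq_bot]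
    exact Submodule.ker_liftQ_eq_bot _ _ _ le_rfl
  have hreg : IsSMulRegular X D.y := by
    intro a b hab
    apply hι
    apply D.y_pow_cancel hp.ne_zero 1
    have := congrArg ι hab
    simpa using this
  have hz : D.z ≠ 0 := fun h => D.z_not hp.ne_zero hp.not_isUnit (h ▸ dvd_zero _)
  haveI : Nontrivial X := by
    refine ⟨⟨Submodule.Quotient.mk (0, 1), 0, fun h => hz ?_⟩⟩
    have := congrArg ι h
    rw [map_zero] at this
    have h2 : ι (Submodule.Quotient.mk (0, 1)) = g (0, 1) := rfl
    rw [h2, hg] at this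
    simpa using this
  have hX : IsMCM R X := D.mcm_of_regular hm hd hreg
  have hfr : freeRank R X = 0 := by
    apply freeRank_eq_zero
    intro h hsurj
    let q := h ∘ₗ (LinearMap.ker g).mkQ
    have hq : Function.Surjective q := hsurj.comp (Submodule.mkQ_surjective _)
    have hlin : ∀ a b : R, q (a, b) = a * q (1, 0) + b * q (0, 1) := by
      intro a b
      rw [← smul_eq_mul, ← smul_eq_mul, ← map_smul, ← map_smul, ← map_add]
      simp
    have hrel : D.z * q (1, 0) = D.y ^ 5 * q (0, 1) := by
      have h1 : (D.z, -D.y ^ 5) ∈ LinearMap.ker g := by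
        rw [LinearMap.mem_ker, hg]; ring
      have h2 : q (D.z, -D.y ^ 5) = 0 := by
        change h ((LinearMap.ker g).mkQ _) = 0
        rw [Submodule.mkQ_apply, (Submodule.Quotient.mk_eq_zero _).2 h1, map_zero]
      rw [hlin] at h2
      linear_combination h2
    by_cases h0 : IsUnit (q (1, 0))
    · obtain ⟨t, ht⟩ := h0.exists_right_inv
      exact D.z_not hp.ne_zero hp.not_isUnit ⟨q (0, 1) * t, by
        linear_combination t * hrel - D.z * ht⟩
    by_cases h1 : IsUnit (q (0, 1))
    · obtain ⟨t, ht⟩ := h1.exists_right_inv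
      exact D.y5_not hp.ne_zero hp.not_isUnit ⟨q (1, 0) * t, by
        linear_combination - t * hrel - D.y ^ 5 * ht⟩
    obtain ⟨⟨a, b⟩, hab⟩ := hq 1
    rw [hlin] at hab
    have : (1 : R) ∈ maximalIdeal R := by
      rw [← hab]
      exact add_mem (Ideal.mul_mem_left _ _ ((mem_maximalIdeal _).2 h0))
        (Ideal.mul_mem_left _ _ ((mem_maximalIdeal _).2 h1))
    exact (Ideal.ne_top_iff_one _).1 (maximalIdeal.isMaximal R).ne_top this
  rw [auslanderDelta, Nat.sInf_eq_zero]
  left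
  exact ⟨ModuleCat.of R X, inferInstanceAs (Module.Finite R X), hX, ⟨φ, hφ⟩, hfr⟩

theorem delta_five (hp : Irreducible D.p)
    (hm : maximalIdeal R = Ideal.span {D.x, D.y, D.z}) (hd : ringKrullDim R = 1) :
    auslanderDelta R (R ⧸ maximalIdeal R ^ 5) = 1 := by
  have hreg : IsSMulRegular R D.y := fun a b hab =>
    D.y_pow_cancel hp.ne_zero 1 (by simpa using hab)
  have h1 : 1 ∈ {r : ℕ | ∃ X : ModuleCat.{u} R, Module.Finite R X ∧ IsMCM R X ∧
    (∃ φ : X →ₗ[R] (R ⧸ maximalIdeal R ^ 5), Function.Surjective φ) ∧ freeRank R X = r} :=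
    ⟨ModuleCat.of R R, inferInstanceAs (Module.Finite R R), D.mcm_of_regular hm hd hreg,
      ⟨Submodule.mkQ _, Submodule.mkQ_surjective _⟩, freeRank_self R⟩
  apply le_antisymm
  · exact Nat.sInf_le h1
  · obtain ⟨X, hf, hX, ⟨φ, hφ⟩, hr⟩ := Nat.sInf_mem ⟨1, h1⟩
    obtain ⟨h, hh⟩ := D.exists_surj hp hm hd hX φ hφ
    have := freeRank_ne_zero h hh
    rw [auslanderDelta]
    omega

theorem index_eq (hp : Irreducible D.p)
    (hm : maximalIdeal R = Ideal.span {D.x, D.y, D.z}) (hd : ringKrullDim R = 1) :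
    ringIndex R = 5 := by
  apply le_antisymm
  · exact sInf_le ⟨5, D.delta_five hp hm hd, rfl⟩
  · refine le_sInf ?_
    rintro _ ⟨n, hn, rfl⟩
    by_contra hlt
    have hlt : n < 5 := by
      have h5 : ((n : ℕ∞)) < 5 := not_le.1 hlt
      exact_mod_cast h5
    have := D.delta_small hp hm hd (maximalIdeal R ^ n) (Ideal.pow_le_pow_right (by omega))
    rw [Set.mem_setOf_eq] at hn
    omega

theorem gll_eq (hp : Irreducible D.p)
    (hm : maximalIdeal R = Ideal.span {D.x, D.y, D.z}) (hd : ringKrullDim R = 1)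
    (hA : ∀ f ∈ maximalIdeal R, ¬ maximalIdeal R ^ 5 ≤ Ideal.span {f}) :
    gll R = 6 := by
  have hu : IsUnit (1 - 3 * D.y + D.y ^ 2) := by
    by_contra h
    have h2 : (1 - 3 * D.y + D.y ^ 2) ∈ maximalIdeal R := (mem_maximalIdeal _).2 h
    have : (1 : R) ∈ maximalIdeal R := by
      have e : (1 : R) = (1 - 3 * D.y + D.y ^ 2) + (3 - D.y) * D.y := by ring
      rw [e]
      exact add_mem h2 (Ideal.mul_mem_left _ _ (D.y_mem hm))
    exact (Ideal.ne_top_iff_one _).1 (maximalIdeal.isMaximal R).ne_top this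
  apply le_antisymm
  · refine sInf_le ⟨6, ⟨[D.z - D.y], ?_, by simp [hd], ?_⟩, rfl⟩
    · intro r hr
      rw [List.mem_singleton.1 hr]
      exact sub_mem (D.z_mem hm) (D.y_mem hm)
    · rw [Ideal.ofList_singleton, hm]
      exact D.m6_f hu
  · refine le_sInf ?_
    rintro _ ⟨n, ⟨rs, hrs, hlen, hle⟩, rfl⟩
    by_contra hlt
    have hlt : n < 6 := by
      have h5 : ((n : ℕ∞)) < 6 := not_le.1 hlt
      exact_mod_cast h5
    rw [hd] at hlen
    have hlen : rs.length = 1 := by exact_mod_cast hlen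
    obtain ⟨r, rfl⟩ := List.length_eq_one_iff.1 hlen
    rw [Ideal.ofList_singleton] at hle
    exact hA r (hrs r (by simp)) ((Ideal.pow_le_pow_right (by omega)).trans hle)

end Inv

end DD

/-- The truncation of the ring of the counterexample modulo the sixth power of its maximal ideal:
`pij` is the coefficient of `y^i z^j` and `qij` the coefficient of `x y^i z^j`. -/
@[ext]
structure Tr (k : Type*) where
  p00 : k
  p10 : k
  p01 : k
  p20 : k
  p11 : k
  p02 : k
  p30 : k
  p21 : k
  p12 : k
  p03 : k
  p40 : k
  p31 : k
  p22 : k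
  p13 : k
  p04 : k
  p50 : k
  p41 : k
  p32 : k
  p23 : k
  p14 : k
  p05 : k
  q00 : k
  q10 : k
  q01 : k
  q11 : k
  q02 : k
  q12 : k
  q03 : k
  q04 : k

namespace Tr

section Ring
variable {k : Type*} [CommRing k]

instance : Zero (Tr k) :=
  ⟨⟨0, 0, 0, 0, 0, 0, 0, 0, 0, 0, 0, 0, 0, 0, 0, 0, 0, 0, 0, 0, 0, 0, 0, 0, 0, 0, 0, 0, 0⟩⟩

instance : One (Tr k) :=
  ⟨⟨1, 0, 0, 0, 0, 0, 0, 0, 0, 0, 0, 0, 0, 0, 0, 0, 0, 0, 0, 0, 0, 0, 0, 0, 0, 0, 0, 0, 0⟩⟩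

instance : Add (Tr k) :=
  ⟨fun f g => ⟨f.p00 + g.p00, f.p10 + g.p10, f.p01 + g.p01, f.p20 + g.p20, f.p11 + g.p11, f.p02
    + g.p02, f.p30 + g.p30, f.p21 + g.p21, f.p12 + g.p12, f.p03 + g.p03, f.p40 + g.p40, f.p31 +
    g.p31, f.p22 + g.p22, f.p13 + g.p13, f.p04 + g.p04, f.p50 + g.p50, f.p41 + g.p41, f.p32 +
    g.p32, f.p23 + g.p23, f.p14 + g.p14, f.p05 + g.p05, f.q00 + g.q00, f.q10 + g.q10, f.q01 +
    g.q01, f.q11 + g.q11, f.q02 + g.q02, f.q12 + g.q12, f.q03 + g.q03, f.q04 + g.q04⟩⟩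

instance : Neg (Tr k) :=
  ⟨fun f => ⟨-f.p00, -f.p10, -f.p01, -f.p20, -f.p11, -f.p02, -f.p30, -f.p21, -f.p12, -f.p03,
    -f.p40, -f.p31, -f.p22, -f.p13, -f.p04, -f.p50, -f.p41, -f.p32, -f.p23, -f.p14, -f.p05,
    -f.q00, -f.q10, -f.q01, -f.q11, -f.q02, -f.q12, -f.q03, -f.q04⟩⟩

instance : Mul (Tr k) :=
  ⟨fun f g =>
    { p00 := f.p00 * g.p00
      p10 := f.p00 * g.p10 + f.p10 * g.p00
      p01 := f.p00 * g.p01 + f.p01 * g.p00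
      p20 := f.p00 * g.p20 + f.p10 * g.p10 + f.p20 * g.p00
      p11 := f.p00 * g.p11 + f.p01 * g.p10 + f.p10 * g.p01 + f.p11 * g.p00
      p02 := f.p00 * g.p02 + f.p01 * g.p01 + f.p02 * g.p00
      p30 := f.p00 * g.p30 + f.p10 * g.p20 + f.p20 * g.p10 + f.p30 * g.p00
      p21 := f.p00 * g.p21 + f.p01 * g.p20 + f.p10 * g.p11 + f.p11 * g.p10 + f.p20 * g.p01 + f.p21 *
        g.p00
      p12 := f.p00 * g.p12 + f.p01 * g.p11 + f.p02 * g.p10 + f.p10 * g.p02 + f.p11 * g.p01 + f.p12 *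
        g.p00
      p03 := f.p00 * g.p03 + f.p01 * g.p02 + f.p02 * g.p01 + f.p03 * g.p00
      p40 := f.p00 * g.p40 + f.p10 * g.p30 + f.p20 * g.p20 + f.p30 * g.p10 + f.p40 * g.p00
      p31 := f.p00 * g.p31 + f.p01 * g.p30 + f.p10 * g.p21 + f.p11 * g.p20 + f.p20 * g.p11 + f.p21 *
        g.p10 + f.p30 * g.p01 + f.p31 * g.p00
      p22 := f.p00 * g.p22 + f.p01 * g.p21 + f.p02 * g.p20 + f.p10 * g.p12 + f.p11 * g.p11 + f.p12 *
        g.p10 + f.p20 * g.p02 + f.p21 * g.p01 + f.p22 * g.p00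
      p13 := f.p00 * g.p13 + f.p01 * g.p12 + f.p02 * g.p11 + f.p03 * g.p10 + f.p10 * g.p03 + f.p11 *
        g.p02 + f.p12 * g.p01 + f.p13 * g.p00 - (f.p20 * g.q00 + f.q00 * g.p20 + f.p10 * g.q10 +
        f.q10 * g.p10)
      p04 := f.p00 * g.p04 + f.p01 * g.p03 + f.p02 * g.p02 + f.p03 * g.p01 + f.p04 * g.p00
      p50 := f.p00 * g.p50 + f.p10 * g.p40 + f.p20 * g.p30 + f.p30 * g.p20 + f.p40 * g.p10 + f.p50 *
        g.p00 + f.q00 * g.q00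
      p41 := f.p00 * g.p41 + f.p01 * g.p40 + f.p10 * g.p31 + f.p11 * g.p30 + f.p20 * g.p21 + f.p21 *
        g.p20 + f.p30 * g.p11 + f.p31 * g.p10 + f.p40 * g.p01 + f.p41 * g.p00
      p32 := f.p00 * g.p32 + f.p01 * g.p31 + f.p02 * g.p30 + f.p10 * g.p22 + f.p11 * g.p21 + f.p12 *
        g.p20 + f.p20 * g.p12 + f.p21 * g.p11 + f.p22 * g.p10 + f.p30 * g.p02 + f.p31 * g.p01 +
        f.p32 * g.p00
      p23 := f.p00 * g.p23 + f.p01 * g.p22 + f.p02 * g.p21 + f.p03 * g.p20 + f.p10 * g.p13 + f.p11 *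
        g.p12 + f.p12 * g.p11 + f.p13 * g.p10 + f.p20 * g.p03 + f.p21 * g.p02 + f.p22 * g.p01 +
        f.p23 * g.p00 - (f.p30 * g.q00 + f.q00 * g.p30 + f.p20 * g.q10 + f.q10 * g.p20)
      p14 := f.p00 * g.p14 + f.p01 * g.p13 + f.p02 * g.p12 + f.p03 * g.p11 + f.p04 * g.p10 + f.p10 *
        g.p04 + f.p11 * g.p03 + f.p12 * g.p02 + f.p13 * g.p01 + f.p14 * g.p00 - (f.p21 * g.q00 +
        f.q00 * g.p21 + f.p11 * g.q10 + f.q10 * g.p11 + f.p20 * g.q01 + f.q01 * g.p20 + f.p10 *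
        g.q11 + f.q11 * g.p10)
      p05 := f.p00 * g.p05 + f.p01 * g.p04 + f.p02 * g.p03 + f.p03 * g.p02 + f.p04 * g.p01 + f.p05 *
        g.p00 + (f.p20 * g.q00 + f.q00 * g.p20 + f.p10 * g.q10 + f.q10 * g.p10)
      q00 := f.p00 * g.q00 + f.q00 * g.p00
      q10 := f.p10 * g.q00 + f.q00 * g.p10 + f.p00 * g.q10 + f.q10 * g.p00
      q01 := f.p01 * g.q00 + f.q00 * g.p01 + f.p00 * g.q01 + f.q01 * g.p00
      q11 := f.p11 * g.q00 + f.q00 * g.p11 + f.p01 * g.q10 + f.q10 * g.p01 + f.p10 * g.q01 + f.q01 *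
        g.p10 + f.p00 * g.q11 + f.q11 * g.p00
      q02 := f.p02 * g.q00 + f.q00 * g.p02 + f.p01 * g.q01 + f.q01 * g.p01 + f.p00 * g.q02 + f.q02 *
        g.p00
      q12 := f.p12 * g.q00 + f.q00 * g.p12 + f.p02 * g.q10 + f.q10 * g.p02 + f.p11 * g.q01 + f.q01 *
        g.p11 + f.p01 * g.q11 + f.q11 * g.p01 + f.p10 * g.q02 + f.q02 * g.p10 + f.p00 * g.q12 +
        f.q12 * g.p00
      q03 := f.p03 * g.q00 + f.q00 * g.p03 + f.p02 * g.q01 + f.q01 * g.p02 + f.p01 * g.q02 + f.q02 *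
        g.p01 + f.p00 * g.q03 + f.q03 * g.p00
      q04 := f.p04 * g.q00 + f.q00 * g.p04 + f.p03 * g.q01 + f.q01 * g.p03 + f.p02 * g.q02 + f.q02 *
        g.p02 + f.p01 * g.q03 + f.q03 * g.p01 + f.p00 * g.q04 + f.q04 * g.p00 }⟩

@[simp] theorem zero_p00 : (0 : Tr k).p00 = 0 := rfl
@[simp] theorem one_p00 : (1 : Tr k).p00 = 1 := rfl
@[simp] theorem add_p00 (f g : Tr k) : (f + g).p00 = f.p00 + g.p00 := rfl
@[simp] theorem neg_p00 (f : Tr k) : (-f).p00 = -f.p00 := rfl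
@[simp] theorem mul_p00 (f g : Tr k) : (f * g).p00 =
    f.p00 * g.p00 := rfl
@[simp] theorem zero_p10 : (0 : Tr k).p10 = 0 := rfl
@[simp] theorem one_p10 : (1 : Tr k).p10 = 0 := rfl
@[simp] theorem add_p10 (f g : Tr k) : (f + g).p10 = f.p10 + g.p10 := rfl
@[simp] theorem neg_p10 (f : Tr k) : (-f).p10 = -f.p10 := rfl
@[simp] theorem mul_p10 (f g : Tr k) : (f * g).p10 =
    f.p00 * g.p10 + f.p10 * g.p00 := rfl
@[simp] theorem zero_p01 : (0 : Tr k).p01 = 0 := rfl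
@[simp] theorem one_p01 : (1 : Tr k).p01 = 0 := rfl
@[simp] theorem add_p01 (f g : Tr k) : (f + g).p01 = f.p01 + g.p01 := rfl
@[simp] theorem neg_p01 (f : Tr k) : (-f).p01 = -f.p01 := rfl
@[simp] theorem mul_p01 (f g : Tr k) : (f * g).p01 =
    f.p00 * g.p01 + f.p01 * g.p00 := rfl
@[simp] theorem zero_p20 : (0 : Tr k).p20 = 0 := rfl
@[simp] theorem one_p20 : (1 : Tr k).p20 = 0 := rfl
@[simp] theorem add_p20 (f g : Tr k) : (f + g).p20 = f.p20 + g.p20 := rfl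
@[simp] theorem neg_p20 (f : Tr k) : (-f).p20 = -f.p20 := rfl
@[simp] theorem mul_p20 (f g : Tr k) : (f * g).p20 =
    f.p00 * g.p20 + f.p10 * g.p10 + f.p20 * g.p00 := rfl
@[simp] theorem zero_p11 : (0 : Tr k).p11 = 0 := rfl
@[simp] theorem one_p11 : (1 : Tr k).p11 = 0 := rfl
@[simp] theorem add_p11 (f g : Tr k) : (f + g).p11 = f.p11 + g.p11 := rfl
@[simp] theorem neg_p11 (f : Tr k) : (-f).p11 = -f.p11 := rfl
@[simp] theorem mul_p11 (f g : Tr k) : (f * g).p11 =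
    f.p00 * g.p11 + f.p01 * g.p10 + f.p10 * g.p01 + f.p11 * g.p00 := rfl
@[simp] theorem zero_p02 : (0 : Tr k).p02 = 0 := rfl
@[simp] theorem one_p02 : (1 : Tr k).p02 = 0 := rfl
@[simp] theorem add_p02 (f g : Tr k) : (f + g).p02 = f.p02 + g.p02 := rfl
@[simp] theorem neg_p02 (f : Tr k) : (-f).p02 = -f.p02 := rfl
@[simp] theorem mul_p02 (f g : Tr k) : (f * g).p02 =
    f.p00 * g.p02 + f.p01 * g.p01 + f.p02 * g.p00 := rfl
@[simp] theorem zero_p30 : (0 : Tr k).p30 = 0 := rfl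
@[simp] theorem one_p30 : (1 : Tr k).p30 = 0 := rfl
@[simp] theorem add_p30 (f g : Tr k) : (f + g).p30 = f.p30 + g.p30 := rfl
@[simp] theorem neg_p30 (f : Tr k) : (-f).p30 = -f.p30 := rfl
@[simp] theorem mul_p30 (f g : Tr k) : (f * g).p30 =
    f.p00 * g.p30 + f.p10 * g.p20 + f.p20 * g.p10 + f.p30 * g.p00 := rfl
@[simp] theorem zero_p21 : (0 : Tr k).p21 = 0 := rfl
@[simp] theorem one_p21 : (1 : Tr k).p21 = 0 := rfl
@[simp] theorem add_p21 (f g : Tr k) : (f + g).p21 = f.p21 + g.p21 := rfl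
@[simp] theorem neg_p21 (f : Tr k) : (-f).p21 = -f.p21 := rfl
@[simp] theorem mul_p21 (f g : Tr k) : (f * g).p21 =
    f.p00 * g.p21 + f.p01 * g.p20 + f.p10 * g.p11 + f.p11 * g.p10 + f.p20 * g.p01 + f.p21 *
      g.p00 := rfl
@[simp] theorem zero_p12 : (0 : Tr k).p12 = 0 := rfl
@[simp] theorem one_p12 : (1 : Tr k).p12 = 0 := rfl
@[simp] theorem add_p12 (f g : Tr k) : (f + g).p12 = f.p12 + g.p12 := rfl
@[simp] theorem neg_p12 (f : Tr k) : (-f).p12 = -f.p12 := rfl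
@[simp] theorem mul_p12 (f g : Tr k) : (f * g).p12 =
    f.p00 * g.p12 + f.p01 * g.p11 + f.p02 * g.p10 + f.p10 * g.p02 + f.p11 * g.p01 + f.p12 *
      g.p00 := rfl
@[simp] theorem zero_p03 : (0 : Tr k).p03 = 0 := rfl
@[simp] theorem one_p03 : (1 : Tr k).p03 = 0 := rfl
@[simp] theorem add_p03 (f g : Tr k) : (f + g).p03 = f.p03 + g.p03 := rfl
@[simp] theorem neg_p03 (f : Tr k) : (-f).p03 = -f.p03 := rfl
@[simp] theorem mul_p03 (f g : Tr k) : (f * g).p03 =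
    f.p00 * g.p03 + f.p01 * g.p02 + f.p02 * g.p01 + f.p03 * g.p00 := rfl
@[simp] theorem zero_p40 : (0 : Tr k).p40 = 0 := rfl
@[simp] theorem one_p40 : (1 : Tr k).p40 = 0 := rfl
@[simp] theorem add_p40 (f g : Tr k) : (f + g).p40 = f.p40 + g.p40 := rfl
@[simp] theorem neg_p40 (f : Tr k) : (-f).p40 = -f.p40 := rfl
@[simp] theorem mul_p40 (f g : Tr k) : (f * g).p40 =
    f.p00 * g.p40 + f.p10 * g.p30 + f.p20 * g.p20 + f.p30 * g.p10 + f.p40 * g.p00 := rfl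
@[simp] theorem zero_p31 : (0 : Tr k).p31 = 0 := rfl
@[simp] theorem one_p31 : (1 : Tr k).p31 = 0 := rfl
@[simp] theorem add_p31 (f g : Tr k) : (f + g).p31 = f.p31 + g.p31 := rfl
@[simp] theorem neg_p31 (f : Tr k) : (-f).p31 = -f.p31 := rfl
@[simp] theorem mul_p31 (f g : Tr k) : (f * g).p31 =
    f.p00 * g.p31 + f.p01 * g.p30 + f.p10 * g.p21 + f.p11 * g.p20 + f.p20 * g.p11 + f.p21 *
      g.p10 + f.p30 * g.p01 + f.p31 * g.p00 := rfl
@[simp] theorem zero_p22 : (0 : Tr k).p22 = 0 := rfl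
@[simp] theorem one_p22 : (1 : Tr k).p22 = 0 := rfl
@[simp] theorem add_p22 (f g : Tr k) : (f + g).p22 = f.p22 + g.p22 := rfl
@[simp] theorem neg_p22 (f : Tr k) : (-f).p22 = -f.p22 := rfl
@[simp] theorem mul_p22 (f g : Tr k) : (f * g).p22 =
    f.p00 * g.p22 + f.p01 * g.p21 + f.p02 * g.p20 + f.p10 * g.p12 + f.p11 * g.p11 + f.p12 *
      g.p10 + f.p20 * g.p02 + f.p21 * g.p01 + f.p22 * g.p00 := rfl
@[simp] theorem zero_p13 : (0 : Tr k).p13 = 0 := rfl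
@[simp] theorem one_p13 : (1 : Tr k).p13 = 0 := rfl
@[simp] theorem add_p13 (f g : Tr k) : (f + g).p13 = f.p13 + g.p13 := rfl
@[simp] theorem neg_p13 (f : Tr k) : (-f).p13 = -f.p13 := rfl
@[simp] theorem mul_p13 (f g : Tr k) : (f * g).p13 =
    f.p00 * g.p13 + f.p01 * g.p12 + f.p02 * g.p11 + f.p03 * g.p10 + f.p10 * g.p03 + f.p11 *
      g.p02 + f.p12 * g.p01 + f.p13 * g.p00 - (f.p20 * g.q00 + f.q00 * g.p20 + f.p10 * g.q10 +
      f.q10 * g.p10) := rfl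
@[simp] theorem zero_p04 : (0 : Tr k).p04 = 0 := rfl
@[simp] theorem one_p04 : (1 : Tr k).p04 = 0 := rfl
@[simp] theorem add_p04 (f g : Tr k) : (f + g).p04 = f.p04 + g.p04 := rfl
@[simp] theorem neg_p04 (f : Tr k) : (-f).p04 = -f.p04 := rfl
@[simp] theorem mul_p04 (f g : Tr k) : (f * g).p04 =
    f.p00 * g.p04 + f.p01 * g.p03 + f.p02 * g.p02 + f.p03 * g.p01 + f.p04 * g.p00 := rfl
@[simp] theorem zero_p50 : (0 : Tr k).p50 = 0 := rfl
@[simp] theorem one_p50 : (1 : Tr k).p50 = 0 := rfl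
@[simp] theorem add_p50 (f g : Tr k) : (f + g).p50 = f.p50 + g.p50 := rfl
@[simp] theorem neg_p50 (f : Tr k) : (-f).p50 = -f.p50 := rfl
@[simp] theorem mul_p50 (f g : Tr k) : (f * g).p50 =
    f.p00 * g.p50 + f.p10 * g.p40 + f.p20 * g.p30 + f.p30 * g.p20 + f.p40 * g.p10 + f.p50 *
      g.p00 + f.q00 * g.q00 := rfl
@[simp] theorem zero_p41 : (0 : Tr k).p41 = 0 := rfl
@[simp] theorem one_p41 : (1 : Tr k).p41 = 0 := rfl
@[simp] theorem add_p41 (f g : Tr k) : (f + g).p41 = f.p41 + g.p41 := rfl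
@[simp] theorem neg_p41 (f : Tr k) : (-f).p41 = -f.p41 := rfl
@[simp] theorem mul_p41 (f g : Tr k) : (f * g).p41 =
    f.p00 * g.p41 + f.p01 * g.p40 + f.p10 * g.p31 + f.p11 * g.p30 + f.p20 * g.p21 + f.p21 *
      g.p20 + f.p30 * g.p11 + f.p31 * g.p10 + f.p40 * g.p01 + f.p41 * g.p00 := rfl
@[simp] theorem zero_p32 : (0 : Tr k).p32 = 0 := rfl
@[simp] theorem one_p32 : (1 : Tr k).p32 = 0 := rfl
@[simp] theorem add_p32 (f g : Tr k) : (f + g).p32 = f.p32 + g.p32 := rfl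
@[simp] theorem neg_p32 (f : Tr k) : (-f).p32 = -f.p32 := rfl
@[simp] theorem mul_p32 (f g : Tr k) : (f * g).p32 =
    f.p00 * g.p32 + f.p01 * g.p31 + f.p02 * g.p30 + f.p10 * g.p22 + f.p11 * g.p21 + f.p12 *
      g.p20 + f.p20 * g.p12 + f.p21 * g.p11 + f.p22 * g.p10 + f.p30 * g.p02 + f.p31 * g.p01 +
      f.p32 * g.p00 := rfl
@[simp] theorem zero_p23 : (0 : Tr k).p23 = 0 := rfl
@[simp] theorem one_p23 : (1 : Tr k).p23 = 0 := rfl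
@[simp] theorem add_p23 (f g : Tr k) : (f + g).p23 = f.p23 + g.p23 := rfl
@[simp] theorem neg_p23 (f : Tr k) : (-f).p23 = -f.p23 := rfl
@[simp] theorem mul_p23 (f g : Tr k) : (f * g).p23 =
    f.p00 * g.p23 + f.p01 * g.p22 + f.p02 * g.p21 + f.p03 * g.p20 + f.p10 * g.p13 + f.p11 *
      g.p12 + f.p12 * g.p11 + f.p13 * g.p10 + f.p20 * g.p03 + f.p21 * g.p02 + f.p22 * g.p01 +
      f.p23 * g.p00 - (f.p30 * g.q00 + f.q00 * g.p30 + f.p20 * g.q10 + f.q10 * g.p20) := rfl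
@[simp] theorem zero_p14 : (0 : Tr k).p14 = 0 := rfl
@[simp] theorem one_p14 : (1 : Tr k).p14 = 0 := rfl
@[simp] theorem add_p14 (f g : Tr k) : (f + g).p14 = f.p14 + g.p14 := rfl
@[simp] theorem neg_p14 (f : Tr k) : (-f).p14 = -f.p14 := rfl
@[simp] theorem mul_p14 (f g : Tr k) : (f * g).p14 =
    f.p00 * g.p14 + f.p01 * g.p13 + f.p02 * g.p12 + f.p03 * g.p11 + f.p04 * g.p10 + f.p10 *
      g.p04 + f.p11 * g.p03 + f.p12 * g.p02 + f.p13 * g.p01 + f.p14 * g.p00 - (f.p21 * g.q00 +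
      f.q00 * g.p21 + f.p11 * g.q10 + f.q10 * g.p11 + f.p20 * g.q01 + f.q01 * g.p20 + f.p10 *
      g.q11 + f.q11 * g.p10) := rfl
@[simp] theorem zero_p05 : (0 : Tr k).p05 = 0 := rfl
@[simp] theorem one_p05 : (1 : Tr k).p05 = 0 := rfl
@[simp] theorem add_p05 (f g : Tr k) : (f + g).p05 = f.p05 + g.p05 := rfl
@[simp] theorem neg_p05 (f : Tr k) : (-f).p05 = -f.p05 := rfl
@[simp] theorem mul_p05 (f g : Tr k) : (f * g).p05 =
    f.p00 * g.p05 + f.p01 * g.p04 + f.p02 * g.p03 + f.p03 * g.p02 + f.p04 * g.p01 + f.p05 *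
      g.p00 + (f.p20 * g.q00 + f.q00 * g.p20 + f.p10 * g.q10 + f.q10 * g.p10) := rfl
@[simp] theorem zero_q00 : (0 : Tr k).q00 = 0 := rfl
@[simp] theorem one_q00 : (1 : Tr k).q00 = 0 := rfl
@[simp] theorem add_q00 (f g : Tr k) : (f + g).q00 = f.q00 + g.q00 := rfl
@[simp] theorem neg_q00 (f : Tr k) : (-f).q00 = -f.q00 := rfl
@[simp] theorem mul_q00 (f g : Tr k) : (f * g).q00 =
    f.p00 * g.q00 + f.q00 * g.p00 := rfl
@[simp] theorem zero_q10 : (0 : Tr k).q10 = 0 := rfl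
@[simp] theorem one_q10 : (1 : Tr k).q10 = 0 := rfl
@[simp] theorem add_q10 (f g : Tr k) : (f + g).q10 = f.q10 + g.q10 := rfl
@[simp] theorem neg_q10 (f : Tr k) : (-f).q10 = -f.q10 := rfl
@[simp] theorem mul_q10 (f g : Tr k) : (f * g).q10 =
    f.p10 * g.q00 + f.q00 * g.p10 + f.p00 * g.q10 + f.q10 * g.p00 := rfl
@[simp] theorem zero_q01 : (0 : Tr k).q01 = 0 := rfl
@[simp] theorem one_q01 : (1 : Tr k).q01 = 0 := rfl
@[simp] theorem add_q01 (f g : Tr k) : (f + g).q01 = f.q01 + g.q01 := rfl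
@[simp] theorem neg_q01 (f : Tr k) : (-f).q01 = -f.q01 := rfl
@[simp] theorem mul_q01 (f g : Tr k) : (f * g).q01 =
    f.p01 * g.q00 + f.q00 * g.p01 + f.p00 * g.q01 + f.q01 * g.p00 := rfl
@[simp] theorem zero_q11 : (0 : Tr k).q11 = 0 := rfl
@[simp] theorem one_q11 : (1 : Tr k).q11 = 0 := rfl
@[simp] theorem add_q11 (f g : Tr k) : (f + g).q11 = f.q11 + g.q11 := rfl
@[simp] theorem neg_q11 (f : Tr k) : (-f).q11 = -f.q11 := rfl
@[simp] theorem mul_q11 (f g : Tr k) : (f * g).q11 =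
    f.p11 * g.q00 + f.q00 * g.p11 + f.p01 * g.q10 + f.q10 * g.p01 + f.p10 * g.q01 + f.q01 *
      g.p10 + f.p00 * g.q11 + f.q11 * g.p00 := rfl
@[simp] theorem zero_q02 : (0 : Tr k).q02 = 0 := rfl
@[simp] theorem one_q02 : (1 : Tr k).q02 = 0 := rfl
@[simp] theorem add_q02 (f g : Tr k) : (f + g).q02 = f.q02 + g.q02 := rfl
@[simp] theorem neg_q02 (f : Tr k) : (-f).q02 = -f.q02 := rfl
@[simp] theorem mul_q02 (f g : Tr k) : (f * g).q02 =
    f.p02 * g.q00 + f.q00 * g.p02 + f.p01 * g.q01 + f.q01 * g.p01 + f.p00 * g.q02 + f.q02 *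
      g.p00 := rfl
@[simp] theorem zero_q12 : (0 : Tr k).q12 = 0 := rfl
@[simp] theorem one_q12 : (1 : Tr k).q12 = 0 := rfl
@[simp] theorem add_q12 (f g : Tr k) : (f + g).q12 = f.q12 + g.q12 := rfl
@[simp] theorem neg_q12 (f : Tr k) : (-f).q12 = -f.q12 := rfl
@[simp] theorem mul_q12 (f g : Tr k) : (f * g).q12 =
    f.p12 * g.q00 + f.q00 * g.p12 + f.p02 * g.q10 + f.q10 * g.p02 + f.p11 * g.q01 + f.q01 *
      g.p11 + f.p01 * g.q11 + f.q11 * g.p01 + f.p10 * g.q02 + f.q02 * g.p10 + f.p00 * g.q12 +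
      f.q12 * g.p00 := rfl
@[simp] theorem zero_q03 : (0 : Tr k).q03 = 0 := rfl
@[simp] theorem one_q03 : (1 : Tr k).q03 = 0 := rfl
@[simp] theorem add_q03 (f g : Tr k) : (f + g).q03 = f.q03 + g.q03 := rfl
@[simp] theorem neg_q03 (f : Tr k) : (-f).q03 = -f.q03 := rfl
@[simp] theorem mul_q03 (f g : Tr k) : (f * g).q03 =
    f.p03 * g.q00 + f.q00 * g.p03 + f.p02 * g.q01 + f.q01 * g.p02 + f.p01 * g.q02 + f.q02 *
      g.p01 + f.p00 * g.q03 + f.q03 * g.p00 := rfl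
@[simp] theorem zero_q04 : (0 : Tr k).q04 = 0 := rfl
@[simp] theorem one_q04 : (1 : Tr k).q04 = 0 := rfl
@[simp] theorem add_q04 (f g : Tr k) : (f + g).q04 = f.q04 + g.q04 := rfl
@[simp] theorem neg_q04 (f : Tr k) : (-f).q04 = -f.q04 := rfl
@[simp] theorem mul_q04 (f g : Tr k) : (f * g).q04 =
    f.p04 * g.q00 + f.q00 * g.p04 + f.p03 * g.q01 + f.q01 * g.p03 + f.p02 * g.q02 + f.q02 *
      g.p02 + f.p01 * g.q03 + f.q03 * g.p01 + f.p00 * g.q04 + f.q04 * g.p00 := rfl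

set_option maxHeartbeats 4000000 in
theorem mul_assoc_aux (f g h : Tr k) : f * g * h = f * (g * h) := by
  ext <;> simp only [mul_p00, mul_p10, mul_p01, mul_p20, mul_p11, mul_p02, mul_p30, mul_p21, mul_p12, mul_p03,
    mul_p40, mul_p31, mul_p22, mul_p13, mul_p04, mul_p50, mul_p41, mul_p32, mul_p23, mul_p14,
    mul_p05, mul_q00, mul_q10, mul_q01, mul_q11, mul_q02, mul_q12, mul_q03, mul_q04] <;> ring

set_option maxHeartbeats 1000000 in
theorem left_distrib_aux (f g h : Tr k) : f * (g + h) = f * g + f * h := by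
  ext <;> simp <;> ring

set_option maxHeartbeats 1000000 in
theorem mul_comm_aux (f g : Tr k) : f * g = g * f := by
  ext <;> simp <;> ring

set_option maxHeartbeats 4000000 in
instance : CommRing (Tr k) where
  add_assoc f g h := by ext <;> simp <;> ring
  zero_add f := by ext <;> simp
  add_zero f := by ext <;> simp
  add_comm f g := by ext <;> simp <;> ring
  neg_add_cancel f := by ext <;> simp
  mul_assoc := mul_assoc_aux
  mul_comm := mul_comm_aux
  one_mul f := by ext <;> simp
  mul_one f := by ext <;> simp
  zero_mul f := by ext <;> simp
  mul_zero f := by ext <;> simp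
  left_distrib := left_distrib_aux
  right_distrib f g h := by
    rw [mul_comm_aux, left_distrib_aux, mul_comm_aux h f, mul_comm_aux h g]
  nsmul := nsmulRec
  zsmul := zsmulRec

/-- The constants. -/
def C : k →+* Tr k where
  toFun c := ⟨c, 0, 0, 0, 0, 0, 0, 0, 0, 0, 0, 0, 0, 0, 0, 0, 0, 0, 0, 0, 0, 0, 0, 0, 0, 0, 0, 0, 0⟩
  map_one' := rfl
  map_zero' := rfl
  map_add' a b := by ext <;> simp
  map_mul' a b := by ext <;> simp

/-- The constant coefficient. -/
def ε : Tr k →+* k where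
  toFun f := f.p00
  map_one' := rfl
  map_zero' := rfl
  map_add' a b := rfl
  map_mul' a b := rfl

end Ring

end Tr

namespace Tr

section Fld
variable {k : Type*} [Field k]

def y5 : Tr k := { (0 : Tr k) with p50 := 1 }
def z5 : Tr k := { (0 : Tr k) with p05 := 1 }
def y4z : Tr k := { (0 : Tr k) with p41 := 1 }
def xz4 : Tr k := { (0 : Tr k) with q04 := 1 }

theorem caseIa {f g : Tr k} (h0 : f.p00 = 0) (hz : f.p01 ≠ 0) (h : f * g = y5) : False := by
  rw [Tr.ext_iff] at h
  simp [h0, y5] at h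
  obtain ⟨e10, e01, e20, e11, e02, e30, e21, e12, e03, e40, e31, e22, e13, e04, e50, e41, e32, e23, e14, e05, r00, r10, r01, r11, r02, r12, r03, r04⟩ := h
  simp_all






theorem caseIb1 {f g : Tr k} (h0 : f.p00 = 0) (hz : f.p01 = 0) (hy : f.p10 ≠ 0)
    (h : f * g = z5) : f.q00 = 0 ∧ f.p10 + f.p02 ≠ 0 := by
  rw [Tr.ext_iff] at h
  simp [h0, z5] at h
  obtain ⟨e10, e01, e20, e11, e02, e30, e21, e12, e03, e40, e31, e22, e13, e04, e50, e41, e32, e23, e14, e05, r00, r10, r01, r11, r02, r12, r03, r04⟩ := h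
  grind

theorem caseIb2 {f g : Tr k} (h0 : f.p00 = 0) (hz : f.p01 = 0) (hy : f.p10 ≠ 0) (hx : f.q00 = 0) (hn : f.p10 + f.p02 ≠ 0)
    (h : f * g = xz4) : False := by
  rw [Tr.ext_iff] at h
  simp [h0, xz4] at h
  obtain ⟨e10, e01, e20, e11, e02, e30, e21, e12, e03, e40, e31, e22, e13, e04, e50, e41, e32, e23, e14, e05, r00, r10, r01, r11, r02, r12, r03, r04⟩ := h
  grind

theorem caseIc1 {f g : Tr k} (h0 : f.p00 = 0) (hz : f.p01 = 0) (hy : f.p10 = 0) (hx : f.q00 ≠ 0) 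
    (ha : f.p20 = 0) (hb : f.p11 = 0) (hc : f.p02 = 0)
    (h : f * g = y4z) : False := by
  rw [Tr.ext_iff] at h
  simp [h0, y4z] at h
  obtain ⟨e10, e01, e20, e11, e02, e30, e21, e12, e03, e40, e31, e22, e13, e04, e50, e41, e32, e23, e14, e05, r00, r10, r01, r11, r02, r12, r03, r04⟩ := h
  grind

theorem caseIc2 {f g : Tr k} (h0 : f.p00 = 0) (hz : f.p01 = 0) (hy : f.p10 = 0) (hx : f.q00 ≠ 0) 
    (hab : f.p20 ≠ 0 ∨ f.p11 ≠ 0) (hc : f.p02 = 0)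
    (h : f * g = z5) : False := by
  rw [Tr.ext_iff] at h
  simp [h0, z5] at h
  obtain ⟨e10, e01, e20, e11, e02, e30, e21, e12, e03, e40, e31, e22, e13, e04, e50, e41, e32, e23, e14, e05, r00, r10, r01, r11, r02, r12, r03, r04⟩ := h
  grind

theorem caseIc3 {f g : Tr k} (h0 : f.p00 = 0) (hz : f.p01 = 0) (hy : f.p10 = 0) (hx : f.q00 ≠ 0) 
    (hc : f.p02 ≠ 0)
    (h : f * g = y5) : 2 * f.p20 * f.p11 * f.q00 ^ 2 + 2 * f.p11 ^ 2 * f.p02 * f.q00 + f.p11 * f.p02 ^ 3 +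
      f.p20 * f.p02 ^ 2 * f.q00 = 0 := by
  rw [Tr.ext_iff] at h
  simp [h0, y5] at h
  obtain ⟨e10, e01, e20, e11, e02, e30, e21, e12, e03, e40, e31, e22, e13, e04, e50, e41, e32, e23, e14, e05, r00, r10, r01, r11, r02, r12, r03, r04⟩ := h
  grind

theorem caseIc4 {f g : Tr k} (h0 : f.p00 = 0) (hz : f.p01 = 0) (hy : f.p10 = 0) (hx : f.q00 ≠ 0) 
    (hc : f.p02 ≠ 0)
    (hK : 2 * f.p20 * f.p11 * f.q00 ^ 2 + 2 * f.p11 ^ 2 * f.p02 * f.q00 + f.p11 * f.p02 ^ 3 +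
      f.p20 * f.p02 ^ 2 * f.q00 = 0)
    (h : f * g = y4z) : False := by
  rw [Tr.ext_iff] at h
  simp [h0, y4z] at h
  obtain ⟨e10, e01, e20, e11, e02, e30, e21, e12, e03, e40, e31, e22, e13, e04, e50, e41, e32, e23, e14, e05, r00, r10, r01, r11, r02, r12, r03, r04⟩ := h
  grind







theorem caseIIa {f g : Tr k} (h0 : f.p00 = 0) (hz : f.p01 = 0) (hy : f.p10 = 0) (hx : f.q00 = 0)
    (hc : f.p02 ≠ 0)
    (h : f * g = y5) : False := by
  rw [Tr.ext_iff] at h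
  simp [h0, y5] at h
  obtain ⟨e10, e01, e20, e11, e02, e30, e21, e12, e03, e40, e31, e22, e13, e04, e50, e41, e32, e23, e14, e05, r00, r10, r01, r11, r02, r12, r03, r04⟩ := h
  grind

theorem caseIIb {f g : Tr k} (h0 : f.p00 = 0) (hz : f.p01 = 0) (hy : f.p10 = 0) (hx : f.q00 = 0)
    (hb : f.p11 ≠ 0) (hc : f.p02 = 0)
    (h : f * g = z5) : False := by
  rw [Tr.ext_iff] at h
  simp [h0, z5] at h
  obtain ⟨e10, e01, e20, e11, e02, e30, e21, e12, e03, e40, e31, e22, e13, e04, e50, e41, e32, e23, e14, e05, r00, r10, r01, r11, r02, r12, r03, r04⟩ := h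
  grind

theorem caseIIb2 {f g : Tr k} (h0 : f.p00 = 0) (hz : f.p01 = 0) (hy : f.p10 = 0) (hx : f.q00 = 0)
    (ha : f.p20 ≠ 0) (hb : f.p11 = 0) (hc : f.p02 = 0)
    (h : f * g = z5) : False := by
  rw [Tr.ext_iff] at h
  simp [h0, z5] at h
  obtain ⟨e10, e01, e20, e11, e02, e30, e21, e12, e03, e40, e31, e22, e13, e04, e50, e41, e32, e23, e14, e05, r00, r10, r01, r11, r02, r12, r03, r04⟩ := h
  grind

theorem caseIIc1 {f g : Tr k} (h0 : f.p00 = 0) (hz : f.p01 = 0) (hy : f.p10 = 0) (hx : f.q00 = 0)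
    (ha : f.p20 = 0) (hb : f.p11 = 0) (hc : f.p02 = 0) (he : f.q01 ≠ 0)
    (h : f * g = z5) : f.p03 ≠ 0 := by
  rw [Tr.ext_iff] at h
  simp [h0, z5] at h
  obtain ⟨e10, e01, e20, e11, e02, e30, e21, e12, e03, e40, e31, e22, e13, e04, e50, e41, e32, e23, e14, e05, r00, r10, r01, r11, r02, r12, r03, r04⟩ := h
  grind

theorem caseIIc2 {f g : Tr k} (h0 : f.p00 = 0) (hz : f.p01 = 0) (hy : f.p10 = 0) (hx : f.q00 = 0)
    (ha : f.p20 = 0) (hb : f.p11 = 0) (hc : f.p02 = 0) (he : f.q01 ≠ 0)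
    (hD : f.p03 ≠ 0)
    (h : f * g = y5) : f.p30 ≠ 0 := by
  rw [Tr.ext_iff] at h
  simp [h0, y5] at h
  obtain ⟨e10, e01, e20, e11, e02, e30, e21, e12, e03, e40, e31, e22, e13, e04, e50, e41, e32, e23, e14, e05, r00, r10, r01, r11, r02, r12, r03, r04⟩ := h
  grind

theorem caseIIc3 {f g : Tr k} (h0 : f.p00 = 0) (hz : f.p01 = 0) (hy : f.p10 = 0) (hx : f.q00 = 0)
    (ha : f.p20 = 0) (hb : f.p11 = 0) (hc : f.p02 = 0) (he : f.q01 ≠ 0)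
    (hD : f.p03 ≠ 0) (hA : f.p30 ≠ 0)
    (h : f * g = y4z) : False := by
  rw [Tr.ext_iff] at h
  simp [h0, y4z] at h
  obtain ⟨e10, e01, e20, e11, e02, e30, e21, e12, e03, e40, e31, e22, e13, e04, e50, e41, e32, e23, e14, e05, r00, r10, r01, r11, r02, r12, r03, r04⟩ := h
  grind

theorem caseIId1 {f g : Tr k} (h0 : f.p00 = 0) (hz : f.p01 = 0) (hy : f.p10 = 0) (hx : f.q00 = 0)
    (ha : f.p20 = 0) (hb : f.p11 = 0) (hc : f.p02 = 0) (he : f.q01 = 0)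
    (hd : f.q10 ≠ 0) 
    (h : f * g = z5) : f.p30 = 0 ∧ f.p21 = 0 ∧ f.p12 = 0 ∧ f.p03 = f.q10 := by
  rw [Tr.ext_iff] at h
  simp [h0, z5] at h
  obtain ⟨e10, e01, e20, e11, e02, e30, e21, e12, e03, e40, e31, e22, e13, e04, e50, e41, e32, e23, e14, e05, r00, r10, r01, r11, r02, r12, r03, r04⟩ := h
  grind

theorem caseIId2 {f g : Tr k} (h0 : f.p00 = 0) (hz : f.p01 = 0) (hy : f.p10 = 0) (hx : f.q00 = 0)
    (ha : f.p20 = 0) (hb : f.p11 = 0) (hc : f.p02 = 0) (he : f.q01 = 0)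
    (hd : f.q10 ≠ 0) (hA : f.p30 = 0) (hB : f.p21 = 0) (hC : f.p12 = 0) (hD : f.p03 = f.q10)
    (h : f * g = y5) : f.p40 ≠ 0 := by
  rw [Tr.ext_iff] at h
  simp [h0, y5] at h
  obtain ⟨e10, e01, e20, e11, e02, e30, e21, e12, e03, e40, e31, e22, e13, e04, e50, e41, e32, e23, e14, e05, r00, r10, r01, r11, r02, r12, r03, r04⟩ := h
  grind

theorem caseIId3 {f g : Tr k} (h0 : f.p00 = 0) (hz : f.p01 = 0) (hy : f.p10 = 0) (hx : f.q00 = 0)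
    (ha : f.p20 = 0) (hb : f.p11 = 0) (hc : f.p02 = 0) (he : f.q01 = 0)
    (hd : f.q10 ≠ 0) (hA : f.p30 = 0) (hB : f.p21 = 0) (hC : f.p12 = 0) (hD : f.p03 = f.q10)
    (h40 : f.p40 ≠ 0)
    (h : f * g = y4z) : False := by
  rw [Tr.ext_iff] at h
  simp [h0, y4z] at h
  obtain ⟨e10, e01, e20, e11, e02, e30, e21, e12, e03, e40, e31, e22, e13, e04, e50, e41, e32, e23, e14, e05, r00, r10, r01, r11, r02, r12, r03, r04⟩ := h
  grind

theorem caseIIIa1 {f g : Tr k} (h0 : f.p00 = 0) (hz : f.p01 = 0) (hy : f.p10 = 0) (hx : f.q00 = 0)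
    (ha : f.p20 = 0) (hb : f.p11 = 0) (hc : f.p02 = 0) (he : f.q01 = 0)
    (hd : f.q10 = 0) 
    (hcub : f.p30 ≠ 0 ∨ f.p21 ≠ 0 ∨ f.p12 ≠ 0 ∨ f.p03 ≠ 0)
    (h : f * g = z5) : f.p03 ≠ 0 := by
  rw [Tr.ext_iff] at h
  simp [h0, z5] at h
  obtain ⟨e10, e01, e20, e11, e02, e30, e21, e12, e03, e40, e31, e22, e13, e04, e50, e41, e32, e23, e14, e05, r00, r10, r01, r11, r02, r12, r03, r04⟩ := h
  grind

theorem caseIIIa2 {f g : Tr k} (h0 : f.p00 = 0) (hz : f.p01 = 0) (hy : f.p10 = 0) (hx : f.q00 = 0)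
    (ha : f.p20 = 0) (hb : f.p11 = 0) (hc : f.p02 = 0) (he : f.q01 = 0)
    (hd : f.q10 = 0) (hD : f.p03 ≠ 0)
    (h : f * g = y5) : False := by
  rw [Tr.ext_iff] at h
  simp [h0, y5] at h
  obtain ⟨e10, e01, e20, e11, e02, e30, e21, e12, e03, e40, e31, e22, e13, e04, e50, e41, e32, e23, e14, e05, r00, r10, r01, r11, r02, r12, r03, r04⟩ := h
  grind

theorem caseIIIb {f g : Tr k} (h0 : f.p00 = 0) (hz : f.p01 = 0) (hy : f.p10 = 0) (hx : f.q00 = 0)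
    (ha : f.p20 = 0) (hb : f.p11 = 0) (hc : f.p02 = 0) (he : f.q01 = 0)
    (hd : f.q10 = 0) (hA : f.p30 = 0) (hB : f.p21 = 0) (hC : f.p12 = 0) (hD : f.p03 = 0)
    (hEG : f.q11 ≠ 0 ∨ f.q02 ≠ 0)
    (h : f * g = z5) : False := by
  rw [Tr.ext_iff] at h
  simp [h0, z5] at h
  obtain ⟨e10, e01, e20, e11, e02, e30, e21, e12, e03, e40, e31, e22, e13, e04, e50, e41, e32, e23, e14, e05, r00, r10, r01, r11, r02, r12, r03, r04⟩ := h
  grind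

theorem caseIV1 {f g : Tr k} (h0 : f.p00 = 0) (hz : f.p01 = 0) (hy : f.p10 = 0) (hx : f.q00 = 0)
    (ha : f.p20 = 0) (hb : f.p11 = 0) (hc : f.p02 = 0) (he : f.q01 = 0)
    (hd : f.q10 = 0) (hA : f.p30 = 0) (hB : f.p21 = 0) (hC : f.p12 = 0) (hD : f.p03 = 0)
    (hE : f.q11 = 0) (hG : f.q02 = 0)
    (hq : f.p40 ≠ 0 ∨ f.p31 ≠ 0 ∨ f.p22 ≠ 0 ∨ f.p13 ≠ 0 ∨ f.p04 ≠ 0 ∨ f.q12 ≠ 0 ∨ f.q03 ≠ 0)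
    (h : f * g = z5) : f.p04 ≠ 0 := by
  rw [Tr.ext_iff] at h
  simp [h0, z5] at h
  obtain ⟨e10, e01, e20, e11, e02, e30, e21, e12, e03, e40, e31, e22, e13, e04, e50, e41, e32, e23, e14, e05, r00, r10, r01, r11, r02, r12, r03, r04⟩ := h
  grind

theorem caseIV2 {f g : Tr k} (h0 : f.p00 = 0) (hz : f.p01 = 0) (hy : f.p10 = 0) (hx : f.q00 = 0)
    (ha : f.p20 = 0) (hb : f.p11 = 0) (hc : f.p02 = 0) (he : f.q01 = 0)
    (hd : f.q10 = 0) (hA : f.p30 = 0) (hB : f.p21 = 0) (hC : f.p12 = 0) (hD : f.p03 = 0)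
    (hE : f.q11 = 0) (hG : f.q02 = 0)
    (h04 : f.p04 ≠ 0)
    (h : f * g = y5) : False := by
  rw [Tr.ext_iff] at h
  simp [h0, y5] at h
  obtain ⟨e10, e01, e20, e11, e02, e30, e21, e12, e03, e40, e31, e22, e13, e04, e50, e41, e32, e23, e14, e05, r00, r10, r01, r11, r02, r12, r03, r04⟩ := h
  grind

theorem caseV1 {f g : Tr k} (h0 : f.p00 = 0) (hz : f.p01 = 0) (hy : f.p10 = 0) (hx : f.q00 = 0)
    (ha : f.p20 = 0) (hb : f.p11 = 0) (hc : f.p02 = 0) (he : f.q01 = 0)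
    (hd : f.q10 = 0) (hA : f.p30 = 0) (hB : f.p21 = 0) (hC : f.p12 = 0) (hD : f.p03 = 0)
    (hE : f.q11 = 0) (hG : f.q02 = 0)
    (hp40 : f.p40 = 0) (hp31 : f.p31 = 0) (hp22 : f.p22 = 0) (hp13 : f.p13 = 0) (hp04 : f.p04 = 0) (hq12 : f.q12 = 0) (hq03 : f.q03 = 0)
    (h : f * g = z5) : f.p05 ≠ 0 := by
  rw [Tr.ext_iff] at h
  simp [h0, z5] at h
  obtain ⟨e10, e01, e20, e11, e02, e30, e21, e12, e03, e40, e31, e22, e13, e04, e50, e41, e32, e23, e14, e05, r00, r10, r01, r11, r02, r12, r03, r04⟩ := h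
  grind

theorem caseV2 {f g : Tr k} (h0 : f.p00 = 0) (hz : f.p01 = 0) (hy : f.p10 = 0) (hx : f.q00 = 0)
    (ha : f.p20 = 0) (hb : f.p11 = 0) (hc : f.p02 = 0) (he : f.q01 = 0)
    (hd : f.q10 = 0) (hA : f.p30 = 0) (hB : f.p21 = 0) (hC : f.p12 = 0) (hD : f.p03 = 0)
    (hE : f.q11 = 0) (hG : f.q02 = 0)
    (hp40 : f.p40 = 0) (hp31 : f.p31 = 0) (hp22 : f.p22 = 0) (hp13 : f.p13 = 0) (hp04 : f.p04 = 0) (hq12 : f.q12 = 0) (hq03 : f.q03 = 0) (h05 : f.p05 ≠ 0)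
    (h : f * g = y5) : False := by
  rw [Tr.ext_iff] at h
  simp [h0, y5] at h
  obtain ⟨e10, e01, e20, e11, e02, e30, e21, e12, e03, e40, e31, e22, e13, e04, e50, e41, e32, e23, e14, e05, r00, r10, r01, r11, r02, r12, r03, r04⟩ := h
  grind


theorem main {f g1 g2 g3 g4 : Tr k} (h0 : f.p00 = 0) (h1 : f * g1 = y5) (h2 : f * g2 = z5)
    (h3 : f * g3 = y4z) (h4 : f * g4 = xz4) : False := by
  by_cases hz : f.p01 = 0
  swap
  · exact caseIa h0 hz h1
  by_cases hy : f.p10 = 0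
  swap
  · obtain ⟨a, b⟩ := caseIb1 h0 hz hy h2
    exact caseIb2 h0 hz hy a b h4
  by_cases hx : f.q00 = 0
  swap
  · by_cases hc : f.p02 = 0
    · by_cases hb : f.p11 = 0
      · by_cases ha : f.p20 = 0
        · exact caseIc1 h0 hz hy hx ha hb hc h3
        · exact caseIc2 h0 hz hy hx (Or.inl ha) hc h2
      · exact caseIc2 h0 hz hy hx (Or.inr hb) hc h2
    · exact caseIc4 h0 hz hy hx hc (caseIc3 h0 hz hy hx hc h1) h3
  by_cases hc : f.p02 = 0
  swap
  · exact caseIIa h0 hz hy hx hc h1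
  by_cases hb : f.p11 = 0
  swap
  · exact caseIIb h0 hz hy hx hb hc h2
  by_cases ha : f.p20 = 0
  swap
  · exact caseIIb2 h0 hz hy hx ha hb hc h2
  by_cases he : f.q01 = 0
  swap
  · have hD := caseIIc1 h0 hz hy hx ha hb hc he h2
    have hA := caseIIc2 h0 hz hy hx ha hb hc he hD h1
    exact caseIIc3 h0 hz hy hx ha hb hc he hD hA h3
  by_cases hd : f.q10 = 0
  swap
  · obtain ⟨a, b, c, d⟩ := caseIId1 h0 hz hy hx ha hb hc he hd h2
    have h40 := caseIId2 h0 hz hy hx ha hb hc he hd a b c d h1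
    exact caseIId3 h0 hz hy hx ha hb hc he hd a b c d h40 h3
  by_cases hcub : f.p30 ≠ 0 ∨ f.p21 ≠ 0 ∨ f.p12 ≠ 0 ∨ f.p03 ≠ 0
  · exact caseIIIa2 h0 hz hy hx ha hb hc he hd (caseIIIa1 h0 hz hy hx ha hb hc he hd hcub h2) h1
  push Not at hcub
  obtain ⟨hA, hB, hC, hD⟩ := hcub
  by_cases hEG : f.q11 ≠ 0 ∨ f.q02 ≠ 0
  · exact caseIIIb h0 hz hy hx ha hb hc he hd hA hB hC hD hEG h2
  push Not at hEG
  obtain ⟨hE, hG⟩ := hEG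
  by_cases hq : f.p40 ≠ 0 ∨ f.p31 ≠ 0 ∨ f.p22 ≠ 0 ∨ f.p13 ≠ 0 ∨ f.p04 ≠ 0 ∨ f.q12 ≠ 0 ∨ f.q03 ≠ 0
  · exact caseIV2 h0 hz hy hx ha hb hc he hd hA hB hC hD hE hG
      (caseIV1 h0 hz hy hx ha hb hc he hd hA hB hC hD hE hG hq h2) h1
  push Not at hq
  obtain ⟨q1, q2, q3, q4, q5, q6, q7⟩ := hq
  exact caseV2 h0 hz hy hx ha hb hc he hd hA hB hC hD hE hG q1 q2 q3 q4 q5 q6 q7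
    (caseV1 h0 hz hy hx ha hb hc he hd hA hB hC hD hE hG q1 q2 q3 q4 q5 q6 q7 h2) h1

theorem nilp (n : Tr k) (h : n.p00 = 0) : n ^ 6 = 0 := by
  have key : ∀ m : Tr k, m.p00 = 0 → m.p01 = 0 → m.p10 = 0 → m.q00 = 0 → m * m * m = 0 := by
    intro m h0 h1 h2 h3
    ext <;> simp [h0, h1, h2, h3]
  have e : n ^ 6 = (n * n) * (n * n) * (n * n) := by ring
  rw [e]
  apply key <;> simp [h]

theorem isUnit_of (n : Tr k) (h : n.p00 ≠ 0) : IsUnit n := by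
  have h1 : IsUnit (C n.p00) := (IsUnit.mk0 _ h).map C
  have h2 : IsNilpotent (n - C n.p00) := ⟨6, nilp _ (by
    rw [sub_eq_add_neg, add_p00, neg_p00]; exact add_neg_cancel _)⟩
  have := h2.isUnit_add_left_of_commute h1 (Commute.all _ _)
  simpa using this

def xx : Tr k := { (0 : Tr k) with q00 := 1 }
def yy : Tr k := { (0 : Tr k) with p10 := 1 }
def zz : Tr k := { (0 : Tr k) with p01 := 1 }

theorem rel1 : (xx : Tr k) ^ 2 - yy ^ 5 = 0 := by
  rw [sub_eq_zero]
  simp only [pow_succ, pow_zero, one_mul]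
  ext <;> simp [xx, yy]

theorem rel2 : (xx : Tr k) * yy ^ 2 + yy * zz ^ 3 - zz ^ 5 = 0 := by
  rw [sub_eq_zero]
  simp only [pow_succ, pow_zero, one_mul]
  ext <;> simp [xx, yy, zz]

theorem y5_pow : (yy : Tr k) ^ 5 = y5 := by
  simp only [pow_succ, pow_zero, one_mul]
  ext <;> simp [yy, y5]

theorem z5_pow : (zz : Tr k) ^ 5 = z5 := by
  simp only [pow_succ, pow_zero, one_mul]
  ext <;> simp [zz, z5]

theorem y4z_pow : (yy : Tr k) ^ 4 * zz = y4z := by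
  simp only [pow_succ, pow_zero, one_mul]
  ext <;> simp [yy, zz, y4z]

theorem xz4_pow : (xx : Tr k) * zz ^ 4 = xz4 := by
  simp only [pow_succ, pow_zero, one_mul]
  ext <;> simp [xx, zz, xz4]

end Fld

/-- Transfer of the computation in the truncated ring to any ring mapping to it. -/
theorem transfer {k R : Type*} [Field k] [CommRing R] (φ : R →+* Tr k) (x y z : R)
    (hx : φ x = xx) (hy : φ y = yy) (hz : φ z = zz) (f : R) (hf : f ∈ Ideal.span {x, y, z})
    (hle : (Ideal.span {x, y, z}) ^ 5 ≤ Ideal.span {f}) : False := by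
  have h0 : (φ f).p00 = 0 := by
    have : Ideal.span {x, y, z} ≤ RingHom.ker ((ε : Tr k →+* k).comp φ) := by
      rw [Ideal.span_le]
      rintro t (rfl | rfl | rfl)
      · change ε (φ t) = 0
        rw [hx]; rfl
      · change ε (φ t) = 0
        rw [hy]; rfl
      · change ε (φ t) = 0
        rw [hz]; rfl
    exact this hf
  have mx : x ∈ Ideal.span {x, y, z} := Ideal.subset_span (by simp)
  have my : y ∈ Ideal.span {x, y, z} := Ideal.subset_span (by simp)
  have mz : z ∈ Ideal.span {x, y, z} := Ideal.subset_span (by simp)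
  have get : ∀ t ∈ (Ideal.span {x, y, z}) ^ 5, ∃ g, φ f * g = φ t := by
    intro t ht
    obtain ⟨g, hg⟩ := Ideal.mem_span_singleton.1 (hle ht)
    exact ⟨φ g, by rw [hg, map_mul]⟩
  obtain ⟨g1, h1⟩ := get _ (Ideal.pow_mem_pow my 5)
  obtain ⟨g2, h2⟩ := get _ (Ideal.pow_mem_pow mz 5)
  obtain ⟨g3, h3⟩ := get (y ^ 4 * z) (by
    rw [pow_succ _ 4]; exact Ideal.mul_mem_mul (Ideal.pow_mem_pow my 4) mz)
  obtain ⟨g4, h4⟩ := get (x * z ^ 4) (by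
    rw [pow_succ' _ 4]; exact Ideal.mul_mem_mul mx (Ideal.pow_mem_pow mz 4))
  rw [map_pow, hy, y5_pow] at h1
  rw [map_pow, hz, z5_pow] at h2
  rw [map_mul, map_pow, hy, hz, y4z_pow] at h3
  rw [map_mul, map_pow, hx, hz, xz4_pow] at h4
  exact main h0 h1 h2 h3 h4

end Tr

section Model
universe w

theorem monic_aux {A : Type*} [CommRing A] (a b : A) :
    (Polynomial.X ^ 5 - (Polynomial.C a * Polynomial.X ^ 3 + Polynomial.C b)).Monic := by
  nontriviality A
  apply Polynomial.monic_X_pow_sub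
  refine lt_of_le_of_lt (b := 3) ?_ (by norm_num)
  compute_degree

theorem deg_aux {A : Type*} [CommRing A] [Nontrivial A] (a b : A) :
    (Polynomial.X ^ 5 - (Polynomial.C a * Polynomial.X ^ 3 + Polynomial.C b)).natDegree = 5 := by
  compute_degree!

variable (V : Type w) [CommRing V] (p : V)

abbrev B1 := AdjoinRoot (Polynomial.X ^ 2 - Polynomial.C (p ^ 5) : Polynomial V)

noncomputable abbrev B1x : B1 V p := AdjoinRoot.root _

noncomputable abbrev qpol : Polynomial (B1 V p) :=
  Polynomial.X ^ 5 - (Polynomial.C (algebraMap V (B1 V p) p) * Polynomial.X ^ 3 +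
    Polynomial.C (B1x V p * algebraMap V (B1 V p) p ^ 2))

abbrev BB := AdjoinRoot (qpol V p)

theorem monic1 : (Polynomial.X ^ 2 - Polynomial.C (p ^ 5) : Polynomial V).Monic :=
  Polynomial.monic_X_pow_sub_C _ (by norm_num)

theorem monic2 : (qpol V p).Monic := monic_aux _ _

theorem nt1 [IsDomain V] : Nontrivial (B1 V p) := by
  apply AdjoinRoot.nontrivial
  rw [Polynomial.degree_X_pow_sub_C (by norm_num)]
  norm_num

theorem deg1 [IsDomain V] :
    (Polynomial.X ^ 2 - Polynomial.C (p ^ 5) : Polynomial V).natDegree = 2 :=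
  Polynomial.natDegree_X_pow_sub_C

theorem deg2 [IsDomain V] : (qpol V p).natDegree = 5 := by
  have := nt1 V p
  exact deg_aux _ _

theorem B1_rel : (B1x V p) ^ 2 = algebraMap V (B1 V p) p ^ 5 := by
  have := AdjoinRoot.eval₂_root (Polynomial.X ^ 2 - Polynomial.C (p ^ 5) : Polynomial V)
  rw [Polynomial.eval₂_sub, Polynomial.eval₂_pow, Polynomial.eval₂_X, Polynomial.eval₂_C,
    sub_eq_zero] at this
  exact this.trans (map_pow (AdjoinRoot.of _) p 5)

theorem algMap_eq (v : V) : algebraMap V (BB V p) v =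
    AdjoinRoot.of (qpol V p) (algebraMap V (B1 V p) v) := rfl

theorem BB_rel : (AdjoinRoot.root (qpol V p)) ^ 5 =
    algebraMap V (BB V p) p * (AdjoinRoot.root (qpol V p)) ^ 3 +
      AdjoinRoot.of _ (B1x V p) * algebraMap V (BB V p) p ^ 2 := by
  have := AdjoinRoot.eval₂_root (qpol V p)
  rw [Polynomial.eval₂_sub, Polynomial.eval₂_add, Polynomial.eval₂_mul, Polynomial.eval₂_pow,
    Polynomial.eval₂_pow, Polynomial.eval₂_X, Polynomial.eval₂_C, Polynomial.eval₂_C,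
    sub_eq_zero, map_mul (AdjoinRoot.of _), map_pow (AdjoinRoot.of (qpol V p))] at this
  exact this

noncomputable def modelDD [IsDomain V] : DD V (BB V p) where
  x := AdjoinRoot.of _ (B1x V p)
  z := AdjoinRoot.root _
  p := p
  b := ((AdjoinRoot.powerBasis' (monic1 V p)).basis.reindex (finCongr (deg1 V p))).smulTower
    ((AdjoinRoot.powerBasis' (monic2 V p)).basis.reindex (finCongr (deg2 V p)))
  hb i j := by
    rw [Module.Basis.smulTower_apply, Module.Basis.reindex_apply, Module.Basis.reindex_apply,
      PowerBasis.basis_eq_pow, PowerBasis.basis_eq_pow, Algebra.smul_def]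
    exact congrArg (· * _) (map_pow (AdjoinRoot.of (qpol V p)) _ _)
  h1 := by
    rw [← map_pow (AdjoinRoot.of (qpol V p)), B1_rel, algMap_eq, map_pow (AdjoinRoot.of (qpol V p))]
  h2 := BB_rel V p

/-- `p`, hence `x` and `z`, lie in the Jacobson radical of the model. -/
theorem model_jac [IsDomain V] [IsLocalRing V] (hp : p ∈ maximalIdeal V) (M : Ideal (BB V p))
    (hM : M.IsMaximal) : algebraMap V (BB V p) p ∈ M ∧ AdjoinRoot.of _ (B1x V p) ∈ M ∧
      AdjoinRoot.root (qpol V p) ∈ M := by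
  have : Module.Finite V (BB V p) := Module.Finite.of_basis (modelDD V p).b
  have hy : algebraMap V (BB V p) p ∈ M := by
    have h := Ideal.isMaximal_comap_of_isIntegral_of_isMaximal (R := V) M
    have h2 := IsLocalRing.eq_maximalIdeal h
    rw [← h2] at hp
    exact hp
  have hx : AdjoinRoot.of _ (B1x V p) ∈ M := by
    apply hM.isPrime.mem_of_pow_mem 2
    have := (modelDD V p).h1
    change AdjoinRoot.of (qpol V p) (B1x V p) ^ 2 = algebraMap V (BB V p) p ^ 5 at this
    rw [this]
    exact Ideal.pow_mem_of_mem _ hy 5 (by norm_num)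
  refine ⟨hy, hx, ?_⟩
  apply hM.isPrime.mem_of_pow_mem 5
  rw [BB_rel]
  exact add_mem (Ideal.mul_mem_right _ _ hy) (Ideal.mul_mem_right _ _ hx)

end Model

open MvPolynomial in
theorem sub_C_mem {k : Type*} [Field k] (g : MvPolynomial (Fin 3) k) :
    g - C (constantCoeff g) ∈ (Ideal.span {X 0, X 1, X 2} : Ideal (MvPolynomial (Fin 3) k)) := by
  induction g using MvPolynomial.induction_on with
  | C a => simp
  | add p q hp hq =>
    have := add_mem hp hq
    convert this using 1
    simp only [map_add]; ring
  | mul_X p i _ =>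
    have hX : (X i : MvPolynomial (Fin 3) k) ∈ Ideal.span {X 0, X 1, X 2} := by
      apply Ideal.subset_span
      fin_cases i <;> simp
    have := Ideal.mul_mem_left _ p hX
    simpa using this

open MvPolynomial in
theorem PP_eq_ker (k : Type*) [Field k] :
    (Ideal.span {X 0, X 1, X 2} : Ideal (MvPolynomial (Fin 3) k)) =
      RingHom.ker (constantCoeff (R := k) (σ := Fin 3)) := by
  apply le_antisymm
  · rw [Ideal.span_le]
    rintro t (rfl | rfl | rfl) <;> simp [RingHom.mem_ker]
  · intro g hg
    have := sub_C_mem g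
    rw [(RingHom.mem_ker).1 hg] at this
    simpa using this

open MvPolynomial in
instance PP_prime (k : Type*) [Field k] :
    (Ideal.span {X 0, X 1, X 2} : Ideal (MvPolynomial (Fin 3) k)).IsPrime := by
  rw [PP_eq_ker]; exact RingHom.ker_isPrime _

section Concrete
variable (k : Type u) [Field k]

noncomputable abbrev PP : Ideal (MvPolynomial (Fin 3) k) :=
  Ideal.span {MvPolynomial.X 0, MvPolynomial.X 1, MvPolynomial.X 2}

abbrev SS := Localization.AtPrime (PP k)

noncomputable abbrev II : Ideal (SS k) :=
  (Ideal.span {(MvPolynomial.X 0) ^ 2 - (MvPolynomial.X 1) ^ 5,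
    (MvPolynomial.X 0) * (MvPolynomial.X 1) ^ 2 + (MvPolynomial.X 1) * (MvPolynomial.X 2) ^ 3 -
      (MvPolynomial.X 2) ^ 5}).map (algebraMap (MvPolynomial (Fin 3) k) (SS k))

abbrev RR := SS k ⧸ II k

noncomputable def rho : MvPolynomial (Fin 3) k →+* RR k :=
  (Ideal.Quotient.mk (II k)).comp (algebraMap _ (SS k))

noncomputable def rx : RR k := rho k (MvPolynomial.X 0)
noncomputable def ry : RR k := rho k (MvPolynomial.X 1)
noncomputable def rz : RR k := rho k (MvPolynomial.X 2)

theorem r_rel1 : rx k ^ 2 - ry k ^ 5 = 0 := by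
  rw [rx, ry, ← map_pow, ← map_pow, ← map_sub]
  exact Ideal.Quotient.eq_zero_iff_mem.2 (Ideal.mem_map_of_mem _ (Ideal.subset_span (by simp)))

theorem r_rel2 : rx k * ry k ^ 2 + ry k * rz k ^ 3 - rz k ^ 5 = 0 := by
  rw [rx, ry, rz, ← map_pow, ← map_pow, ← map_pow, ← map_mul, ← map_mul, ← map_add, ← map_sub]
  exact Ideal.Quotient.eq_zero_iff_mem.2 (Ideal.mem_map_of_mem _ (Ideal.subset_span (by simp)))

variable {k}

theorem RR_lift {B : Type*} [CommRing B] (θ : MvPolynomial (Fin 3) k →+* B)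
    (hu : ∀ g ∉ PP k, IsUnit (θ g))
    (h1 : θ (MvPolynomial.X 0) ^ 2 - θ (MvPolynomial.X 1) ^ 5 = 0)
    (h2 : θ (MvPolynomial.X 0) * θ (MvPolynomial.X 1) ^ 2 +
      θ (MvPolynomial.X 1) * θ (MvPolynomial.X 2) ^ 3 - θ (MvPolynomial.X 2) ^ 5 = 0) :
    ∃ φ : RR k →+* B, φ.comp (rho k) = θ := by
  let ψ : SS k →+* B := IsLocalization.lift (M := (PP k).primeCompl) (S := SS k) (g := θ)
    (fun g => hu g g.2)
  have hψ : ψ.comp (algebraMap _ (SS k)) = θ := IsLocalization.lift_comp _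
  refine ⟨Ideal.Quotient.lift (II k) ψ ?_, ?_⟩
  · have : II k ≤ RingHom.ker ψ := by
      rw [II, Ideal.map_le_iff_le_comap, Ideal.span_le]
      rintro t (rfl | rfl)
      · change ψ (algebraMap _ (SS k) _) = 0
        rw [← RingHom.comp_apply, hψ]; simpa using h1
      · change ψ (algebraMap _ (SS k) _) = 0
        rw [← RingHom.comp_apply, hψ]; simpa using h2
    exact fun a ha => this ha
  · exact RingHom.ext fun t => RingHom.congr_fun hψ t

theorem RR_ext {B : Type*} [CommRing B] {φ ψ : RR k →+* B}
    (h : φ.comp (rho k) = ψ.comp (rho k)) : φ = ψ := by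
  apply Ideal.Quotient.ringHom_ext
  apply IsLocalization.ringHom_ext (PP k).primeCompl
  exact h

theorem constantCoeff_ne {g : MvPolynomial (Fin 3) k} (hg : g ∉ PP k) :
    MvPolynomial.constantCoeff g ≠ 0 := by
  intro h
  apply hg
  rw [PP, PP_eq_ker]
  exact h

/-- The truncation map. -/
theorem exists_trunc : ∃ φ : RR k →+* Tr k, φ (rx k) = Tr.xx ∧ φ (ry k) = Tr.yy ∧
    φ (rz k) = Tr.zz := by
  let θ : MvPolynomial (Fin 3) k →+* Tr k :=
    MvPolynomial.eval₂Hom Tr.C ![Tr.xx, Tr.yy, Tr.zz]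
  have hθ0 : θ (MvPolynomial.X 0) = Tr.xx := by simp [θ]
  have hθ1 : θ (MvPolynomial.X 1) = Tr.yy := by simp [θ]
  have hθ2 : θ (MvPolynomial.X 2) = Tr.zz := by simp [θ]
  have hε : (Tr.ε : Tr k →+* k).comp θ = MvPolynomial.constantCoeff := by
    apply MvPolynomial.ringHom_ext
    · intro a
      have : θ (MvPolynomial.C a) = Tr.C a := by simp [θ]
      rw [RingHom.comp_apply, this, MvPolynomial.constantCoeff_C]; rfl
    · intro i
      rw [RingHom.comp_apply, MvPolynomial.constantCoeff_X]
      fin_cases i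
      · exact (congrArg Tr.ε hθ0).trans rfl
      · exact (congrArg Tr.ε hθ1).trans rfl
      · exact (congrArg Tr.ε hθ2).trans rfl
  obtain ⟨φ, hφ⟩ := RR_lift θ (fun g hg => Tr.isUnit_of _ (by
    have := constantCoeff_ne hg
    rw [← hε] at this
    exact this)) (by rw [hθ0, hθ1]; exact Tr.rel1) (by rw [hθ0, hθ1, hθ2]; exact Tr.rel2)
  have hφ' : ∀ t, φ (rho k t) = θ t := fun t => by rw [← hφ]; rfl
  exact ⟨φ, (hφ' _).trans hθ0, (hφ' _).trans hθ1, (hφ' _).trans hθ2⟩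

instance : Nontrivial (RR k) := by
  obtain ⟨φ, hφ, -⟩ := exists_trunc (k := k)
  have : (Tr.xx : Tr k) ≠ 0 := fun h => by
    have := congrArg Tr.q00 h
    simp [Tr.xx] at this
  refine ⟨⟨rx k, 0, fun h => this ?_⟩⟩
  rw [← hφ, h, map_zero]

instance : IsLocalRing (RR k) :=
  IsLocalRing.of_surjective' (Ideal.Quotient.mk (II k)) Ideal.Quotient.mk_surjective

instance : IsNoetherianRing (RR k) := by
  have : IsNoetherianRing (SS k) :=
    IsLocalization.isNoetherianRing (PP k).primeCompl _ inferInstance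
  exact inferInstance

theorem map_max_aux {S : Type*} [CommRing S] [IsLocalRing S] (I : Ideal S) [IsLocalRing (S ⧸ I)] :
    (maximalIdeal S).map (Ideal.Quotient.mk I) = maximalIdeal (S ⧸ I) := by
  have : (maximalIdeal (S ⧸ I)).comap (Ideal.Quotient.mk I) = maximalIdeal S := by
    have hs := Ideal.comap_isMaximal_of_surjective (Ideal.Quotient.mk I)
      Ideal.Quotient.mk_surjective (K := maximalIdeal (S ⧸ I))
    exact IsLocalRing.eq_maximalIdeal hs
  rw [← this, Ideal.map_comap_of_surjective _ Ideal.Quotient.mk_surjective]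

theorem map_rho : (PP k).map (rho k) = Ideal.span {rx k, ry k, rz k} := by
  rw [Ideal.map_span, Set.image_insert_eq, Set.image_insert_eq, Set.image_singleton, rx, ry, rz]

theorem RR_max : maximalIdeal (RR k) = Ideal.span {rx k, ry k, rz k} := by
  rw [← map_max_aux (II k), ← Localization.AtPrime.map_eq_maximalIdeal, Ideal.map_map, ← map_rho,
    rho]

theorem A_aux {R : Type*} [CommRing R] [IsLocalRing R] (φ : R →+* Tr k) (x y z : R)
    (hx : φ x = Tr.xx) (hy : φ y = Tr.yy) (hz : φ z = Tr.zz)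
    (hm : maximalIdeal R = Ideal.span {x, y, z}) (f : R) (hf : f ∈ maximalIdeal R) :
    ¬ maximalIdeal R ^ 5 ≤ Ideal.span {f} := by
  intro h
  rw [hm] at hf h
  exact Tr.transfer φ _ _ _ hx hy hz f hf h

theorem RR_A : ∀ f ∈ maximalIdeal (RR k), ¬ maximalIdeal (RR k) ^ 5 ≤ Ideal.span {f} := by
  obtain ⟨φ, hx, hy, hz⟩ := exists_trunc (k := k)
  exact fun f hf => A_aux φ _ _ _ hx hy hz RR_max f hf

end Concrete

section Transport
universe w
open Polynomial in
instance spanX_prime (k : Type*) [Field k] : (Ideal.span {(X : k[X])}).IsPrime :=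
  (Ideal.span_singleton_prime Polynomial.X_ne_zero).2 Polynomial.prime_X

theorem not_mem_spanX {k : Type*} [Field k] {g : Polynomial k}
    (hg : g ∉ Ideal.span {(Polynomial.X : Polynomial k)}) : g.coeff 0 ≠ 0 := fun h =>
  hg (Ideal.mem_span_singleton.2 (Polynomial.X_dvd_iff.2 h))

theorem loc_dvr (k : Type*) [Field k] :
    IsDiscreteValuationRing (Localization.AtPrime (Ideal.span {(Polynomial.X : Polynomial k)})) :=
  IsLocalization.AtPrime.isDiscreteValuationRing_of_dedekind_domain (Polynomial k)
    (P := Ideal.span {(Polynomial.X : Polynomial k)})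
    (by simp) _

theorem loc_irr (k : Type*) [Field k] :
    Irreducible (algebraMap (Polynomial k)
      (Localization.AtPrime (Ideal.span {(Polynomial.X : Polynomial k)})) Polynomial.X) := by
  have := loc_dvr k
  rw [IsDiscreteValuationRing.irreducible_iff_uniformizer,
    ← Localization.AtPrime.map_eq_maximalIdeal, Ideal.map_span, Set.image_singleton]

/-- Homomorphisms out of the model, into a local ring. -/
theorem model_lift {k : Type*} [Field k] {V : Type*} [CommRing V] [Algebra (Polynomial k) V]
    [IsLocalization.AtPrime V (Ideal.span {(Polynomial.X : Polynomial k)})]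
    {R : Type*} [CommRing R] [IsLocalRing R] (c : k →+* R) (x y z : R) (hy : y ∈ maximalIdeal R)
    (h1 : x ^ 2 - y ^ 5 = 0) (h2 : x * y ^ 2 + y * z ^ 3 - z ^ 5 = 0)
    (p : V) (hp : p = algebraMap (Polynomial k) V Polynomial.X) :
    ∃ ψ : BB V p →+* R,
      (∀ a, ψ (algebraMap V (BB V p) (algebraMap (Polynomial k) V (Polynomial.C a))) = c a) ∧
      ψ (AdjoinRoot.of _ (B1x V p)) = x ∧ ψ (algebraMap V (BB V p) p) = y ∧
      ψ (AdjoinRoot.root (qpol V p)) = z := by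
  let f0 : Polynomial k →+* R := Polynomial.eval₂RingHom c y
  have hf0 : ∀ g : (Ideal.span {(Polynomial.X : Polynomial k)}).primeCompl, IsUnit (f0 g) := by
    intro g
    have hg := not_mem_spanX g.2
    by_contra hn
    have hn : f0 g ∈ maximalIdeal R := (mem_maximalIdeal _).2 hn
    have e : f0 g = f0 (Polynomial.divX (g : Polynomial k)) * y + c ((g : Polynomial k).coeff 0) := by
      conv_lhs => rw [← Polynomial.divX_mul_X_add (g : Polynomial k)]
      simp [f0]
    rw [e] at hn
    have h3 := (Ideal.add_mem_iff_right _ (Ideal.mul_mem_left _ _ hy)).1 hn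
    exact (mem_maximalIdeal _).1 h3 ((isUnit_iff_ne_zero.2 hg).map c)
  let f1 : V →+* R := IsLocalization.lift
    (M := (Ideal.span {(Polynomial.X : Polynomial k)}).primeCompl) (S := V) (g := f0) hf0
  have hf1 : ∀ t, f1 (algebraMap _ V t) = f0 t := fun t => IsLocalization.lift_eq _ t
  have hpy : f1 p = y := by rw [hp, hf1]; simp [f0]
  let f2 : B1 V p →+* R := AdjoinRoot.lift f1 x (by
    simp only [Polynomial.eval₂_sub, Polynomial.eval₂_pow, Polynomial.eval₂_X, Polynomial.eval₂_C,
      map_pow, hpy]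
    exact h1)
  have hf2 : ∀ v, f2 (algebraMap V (B1 V p) v) = f1 v := fun v => AdjoinRoot.lift_of _
  have hf2x : f2 (B1x V p) = x := AdjoinRoot.lift_root _
  let f3 : BB V p →+* R := AdjoinRoot.lift f2 z (by
    rw [Polynomial.eval₂_sub, Polynomial.eval₂_add, Polynomial.eval₂_mul, Polynomial.eval₂_pow,
      Polynomial.eval₂_pow, Polynomial.eval₂_X, Polynomial.eval₂_C, Polynomial.eval₂_C,
      map_mul f2, map_pow f2, hf2, hpy, hf2x]
    linear_combination -h2)
  have hf3 : ∀ v, f3 (AdjoinRoot.of _ v) = f2 v := fun v => AdjoinRoot.lift_of _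
  refine ⟨f3, fun a => ?_, ?_, ?_, AdjoinRoot.lift_root _⟩
  · rw [algMap_eq, hf3, hf2, hf1]; simp [f0]
  · rw [hf3, hf2x]
  · rw [algMap_eq, hf3, hf2, hpy]

theorem model_ext {k : Type*} [Field k] {V : Type*} [CommRing V] [Algebra (Polynomial k) V]
    [IsLocalization.AtPrime V (Ideal.span {(Polynomial.X : Polynomial k)})]
    {R : Type*} [CommRing R]
    (p : V) (hp : p = algebraMap (Polynomial k) V Polynomial.X) (φ ψ : BB V p →+* R)
    (hc : ∀ a, φ (algebraMap V (BB V p) (algebraMap (Polynomial k) V (Polynomial.C a))) =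
      ψ (algebraMap V (BB V p) (algebraMap (Polynomial k) V (Polynomial.C a))))
    (hx : φ (AdjoinRoot.of _ (B1x V p)) = ψ (AdjoinRoot.of _ (B1x V p)))
    (hy : φ (algebraMap V (BB V p) p) = ψ (algebraMap V (BB V p) p))
    (hz : φ (AdjoinRoot.root (qpol V p)) = ψ (AdjoinRoot.root (qpol V p))) : φ = ψ := by
  subst hp
  refine AdjoinRoot.ringHom_ext ?_ hz
  refine AdjoinRoot.ringHom_ext ?_ hx
  refine IsLocalization.ringHom_ext (Ideal.span {(Polynomial.X : Polynomial k)}).primeCompl ?_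
  refine Polynomial.ringHom_ext ?_ ?_
  · exact hc
  · exact hy

theorem unit_aux {k : Type*} [Field k] {V : Type*} [CommRing V] [IsDomain V] [IsLocalRing V]
    (p : V) (hp : p ∈ maximalIdeal V) (θ : MvPolynomial (Fin 3) k →+* BB V p)
    (h0 : θ (MvPolynomial.X 0) = AdjoinRoot.of _ (B1x V p))
    (h1 : θ (MvPolynomial.X 1) = algebraMap V (BB V p) p)
    (h2 : θ (MvPolynomial.X 2) = AdjoinRoot.root (qpol V p))
    (g : MvPolynomial (Fin 3) k) (hg : g ∉ PP k) : IsUnit (θ g) := by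
  by_contra hn
  obtain ⟨M, hM, hgM⟩ := exists_max_ideal_of_mem_nonunits hn
  obtain ⟨hy, hx, hz⟩ := model_jac V p hp M hM
  have hle : PP k ≤ M.comap θ := by
    rw [PP, Ideal.span_le]
    rintro t (rfl | rfl | rfl)
    · change θ _ ∈ M; rw [h0]; exact hx
    · change θ _ ∈ M; rw [h1]; exact hy
    · change θ _ ∈ M; rw [h2]; exact hz
  have h3 : θ (g - MvPolynomial.C (MvPolynomial.constantCoeff g)) ∈ M := hle (sub_C_mem g)
  rw [map_sub] at h3
  have h4 := sub_mem hgM h3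
  rw [sub_sub_cancel] at h4
  have hu : IsUnit (θ (MvPolynomial.C (MvPolynomial.constantCoeff g))) :=
    ((isUnit_iff_ne_zero.2 (constantCoeff_ne hg)).map MvPolynomial.C).map θ
  exact hM.ne_top (Ideal.eq_top_of_isUnit_mem _ h4 hu)

/-- The abstract isomorphism with the model. -/
theorem equiv_aux {k : Type*} [Field k] {V : Type*} [CommRing V] [IsDomain V] [IsLocalRing V]
    [Algebra (Polynomial k) V]
    [IsLocalization.AtPrime V (Ideal.span {(Polynomial.X : Polynomial k)})]
    {R : Type*} [CommRing R] [IsLocalRing R] (ρ : MvPolynomial (Fin 3) k →+* R) (x y z : R)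
    (hx : ρ (MvPolynomial.X 0) = x) (hy : ρ (MvPolynomial.X 1) = y)
    (hz : ρ (MvPolynomial.X 2) = z)
    (hym : y ∈ maximalIdeal R)
    (h1 : x ^ 2 - y ^ 5 = 0) (h2 : x * y ^ 2 + y * z ^ 3 - z ^ 5 = 0)
    (p : V) (hp : p = algebraMap (Polynomial k) V Polynomial.X) (hpm : p ∈ maximalIdeal V)
    (hlift : ∀ θ : MvPolynomial (Fin 3) k →+* BB V p, (∀ g ∉ PP k, IsUnit (θ g)) →
      (θ (MvPolynomial.X 0) ^ 2 - θ (MvPolynomial.X 1) ^ 5 = 0) →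
      (θ (MvPolynomial.X 0) * θ (MvPolynomial.X 1) ^ 2 +
      θ (MvPolynomial.X 1) * θ (MvPolynomial.X 2) ^ 3 - θ (MvPolynomial.X 2) ^ 5 = 0) →
      ∃ φ : R →+* BB V p, φ.comp ρ = θ)
    (hext : ∀ φ ψ : R →+* R, φ.comp ρ = ψ.comp ρ → φ = ψ) :
    ∃ e : BB V p ≃+* R, e (AdjoinRoot.of _ (B1x V p)) = x ∧ e (algebraMap V (BB V p) p) = y ∧
      e (AdjoinRoot.root (qpol V p)) = z := by
  obtain ⟨ψ, hψc, hψx, hψy, hψz⟩ :=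
    model_lift (V := V) (ρ.comp MvPolynomial.C) x y z hym h1 h2 p hp
  let cc : k →+* BB V p :=
    (algebraMap V (BB V p)).comp ((algebraMap (Polynomial k) V).comp Polynomial.C)
  let θ : MvPolynomial (Fin 3) k →+* BB V p := MvPolynomial.eval₂Hom cc
    ![AdjoinRoot.of _ (B1x V p), algebraMap V (BB V p) p, AdjoinRoot.root (qpol V p)]
  have hθC : ∀ a, θ (MvPolynomial.C a) = cc a := fun a => MvPolynomial.eval₂Hom_C _ _ _
  have hθ0 : θ (MvPolynomial.X 0) = AdjoinRoot.of _ (B1x V p) := MvPolynomial.eval₂Hom_X' _ _ _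
  have hθ1 : θ (MvPolynomial.X 1) = algebraMap V (BB V p) p := MvPolynomial.eval₂Hom_X' _ _ _
  have hθ2 : θ (MvPolynomial.X 2) = AdjoinRoot.root (qpol V p) := MvPolynomial.eval₂Hom_X' _ _ _
  obtain ⟨φ, hφ⟩ := hlift θ (unit_aux p hpm θ hθ0 hθ1 hθ2)
    (by rw [hθ0, hθ1, sub_eq_zero]; exact (modelDD V p).h1)
    (by rw [hθ0, hθ1, hθ2, BB_rel]; ring)
  have hφ' : ∀ t, φ (ρ t) = θ t := fun t => by rw [← hφ]; rfl
  have hφx : φ x = AdjoinRoot.of _ (B1x V p) := by rw [← hx, hφ', hθ0]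
  have hφy : φ y = algebraMap V (BB V p) p := by rw [← hy, hφ', hθ1]
  have hφz : φ z = AdjoinRoot.root (qpol V p) := by rw [← hz, hφ', hθ2]
  refine ⟨RingEquiv.ofRingHom ψ φ ?_ ?_, hψx, hψy, hψz⟩
  · apply hext
    apply MvPolynomial.ringHom_ext
    · intro a
      change ψ (φ (ρ _)) = ρ _
      rw [hφ', hθC]
      exact hψc a
    · intro i
      change ψ (φ (ρ _)) = ρ _
      fin_cases i
      · change ψ (φ (ρ (MvPolynomial.X 0))) = ρ (MvPolynomial.X 0)
        rw [hx, hφx, hψx]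
      · change ψ (φ (ρ (MvPolynomial.X 1))) = ρ (MvPolynomial.X 1)
        rw [hy, hφy, hψy]
      · change ψ (φ (ρ (MvPolynomial.X 2))) = ρ (MvPolynomial.X 2)
        rw [hz, hφz, hψz]
  · apply model_ext (k := k) p hp
    · intro a
      change φ (ψ _) = _
      rw [hψc]
      change φ (ρ _) = _
      rw [hφ', hθC]; rfl
    · change φ (ψ _) = _
      rw [hψx, hφx]; rfl
    · change φ (ψ _) = _
      rw [hψy, hφy]; rfl
    · change φ (ψ _) = _
      rw [hψz, hφz]; rfl

theorem final_aux {V : Type w} [CommRing V] [IsDomain V] [IsDiscreteValuationRing V]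
    {B : Type*} [CommRing B] [Algebra V B] (D : DD V B) (hp : Irreducible D.p)
    {R : Type u} [CommRing R] [IsLocalRing R] [IsNoetherianRing R] (e : B ≃+* R) (x y z : R)
    (hx : e D.x = x) (hy : e (algebraMap V B D.p) = y) (hz : e D.z = z)
    (hm : maximalIdeal R = Ideal.span {x, y, z})
    (hA : ∀ f ∈ maximalIdeal R, ¬ maximalIdeal R ^ 5 ≤ Ideal.span {f}) :
    gll R = 6 ∧ ringIndex R = 5 := by
  let _ : Algebra V R := ((e : B →+* R).comp (algebraMap V B)).toAlgebra
  have hal : ∀ v, algebraMap V R v = e (algebraMap V B v) := fun v => rfl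
  let el : B ≃ₗ[V] R :=
    { e with
      map_smul' := fun v b => by
        change e (v • b) = v • e b
        rw [Algebra.smul_def, Algebra.smul_def, map_mul, hal] }
  have hel : ∀ b, el b = e b := fun _ => rfl
  let D' : DD V R :=
    { x := x
      z := z
      p := D.p
      b := D.b.map el
      hb := fun i j => by
        rw [Module.Basis.map_apply, hel, D.hb, map_mul, map_pow, map_pow, hx, hz]
      h1 := by rw [hal, ← hx, ← map_pow, D.h1, map_pow]
      h2 := by rw [hal, ← hx, ← hz, ← map_pow, D.h2]; simp only [map_add, map_mul, map_pow] }
  have hm' : maximalIdeal R = Ideal.span {D'.x, D'.y, D'.z} := by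
    rw [hm, ← hy]; rfl
  have hd := D'.krull hp hm'
  exact ⟨D'.gll_eq hp hm' hd hA, D'.index_eq hp hm' hd⟩

end Transport

theorem RR_final (k : Type u) [Field k] : gll (RR k) = 6 ∧ ringIndex (RR k) = 5 := by
  have := loc_dvr k
  have hirr := loc_irr k
  obtain ⟨e, h0, h1, h2⟩ := equiv_aux
    (V := Localization.AtPrime (Ideal.span {(Polynomial.X : Polynomial k)}))
    (R := RR k) (rho k) (rx k) (ry k) (rz k) rfl rfl rfl
    (by rw [RR_max]; exact Ideal.subset_span (by simp)) (r_rel1 k) (r_rel2 k) _ rfl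
    ((mem_maximalIdeal _).2 hirr.not_isUnit) (fun θ a b c => RR_lift θ a b c)
    (fun φ ψ h => RR_ext h)
  exact final_aux (modelDD _ _) hirr e _ _ _ h0 h1 h2 RR_max RR_A

open MvPolynomial

/-- For the ring `R = (k[x,y,z]/(x² − y⁵, xy² + yz³ − z⁵))` localized at
`(x,y,z)`: for every nonzero `f ∈ m` one has `m⁵ ⊄ fR`; hence `gℓℓ(R) = 6` while
`index(R) = 5`, so `index(R) ≠ gℓℓ(R)` (here `x = X 0`, `y = X 1`, `z = X 2`). -/
theorem counterexample_to_Ding (k : Type*) [Field k] :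
    ∃ hP : (Ideal.span {X 0, X 1, X 2} : Ideal (MvPolynomial (Fin 3) k)).IsPrime,
      letI := hP
      let T := MvPolynomial (Fin 3) k
      let S := Localization.AtPrime (Ideal.span {X 0, X 1, X 2} : Ideal T)
      let I : Ideal S := (Ideal.span {(X 0) ^ 2 - (X 1) ^ 5,
        (X 0) * (X 1) ^ 2 + (X 1) * (X 2) ^ 3 - (X 2) ^ 5}).map (algebraMap T S)
      let R := S ⧸ I
      ∃ hnt : Nontrivial R,
        letI := hnt
        letI : IsLocalRing R :=
          IsLocalRing.of_surjective' (Ideal.Quotient.mk I) Ideal.Quotient.mk_surjective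
        (∀ f ∈ IsLocalRing.maximalIdeal R, f ≠ 0 →
            ¬ IsLocalRing.maximalIdeal R ^ 5 ≤ Ideal.span {f}) ∧
          gll R = 6 ∧ ringIndex R = 5 ∧ ringIndex R ≠ gll R := by
  refine ⟨PP_prime k, ?_⟩
  intro T S I R
  obtain ⟨hg, hi⟩ := RR_final k
  refine ⟨inferInstanceAs (Nontrivial (RR k)), fun f hf _ => RR_A f hf, hg, hi, fun h => ?_⟩
  have h' : ringIndex (RR k) = gll (RR k) := h
  rw [hg, hi] at h'
  exact absurd h' (by decide)
end
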